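/- arXiv:2507.17362 — 2 statements merged into one kernel-verified Lean document; each statement's English description precedes it below -/
import Mathlib

section
/- Polyhedrality of the solution set in PU(n,1): For every integer n ≥ 1 there exist finitely many polytopes Q₁, …, Q_N ⊆ (ℝⁿ)³ such that 𝒫ₙ ∩ (𝒯ₙ°)³ = (Q₁ ∪ ⋯ ∪ Q_N) ∩ (𝒯ₙ°)³, where a polytope means a finite intersection of affine half-spaces, each of the form {x ∈ (ℝⁿ)³ : f(x) ≤ c} or {x ∈ (ℝⁿ)³ : f(x) < c} for some linear functional f on (ℝⁿ)³ and c ∈ ℝ. -/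
open Real Matrix Set

noncomputable section

abbrev TriN (n : ℕ) : Type := (Fin n → ℝ) × (Fin n → ℝ) × (Fin n → ℝ)

/-- `α ∈ 𝒯ₙ = {α ∈ [0,2π)ⁿ : α₁ ≥ … ≥ αₙ}` (index `0` ↔ subscript 1). -/
def memTn (n : ℕ) (α : Fin n → ℝ) : Prop :=
  (∀ i, 0 ≤ α i ∧ α i < 2 * π) ∧ ∀ i j : Fin n, i ≤ j → α j ≤ α i

def memTn3 (n : ℕ) (τ : TriN n) : Prop := memTn n τ.1 ∧ memTn n τ.2.1 ∧ memTn n τ.2.2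

/-- `α ∈ 𝒯ₙ° = {α : 0 < αₙ < … < α₁ < 2π}`. -/
def memTnInt (n : ℕ) (α : Fin n → ℝ) : Prop :=
  (∀ i, 0 < α i ∧ α i < 2 * π) ∧ ∀ i j : Fin n, i < j → α j < α i

def memTnInt3 (n : ℕ) (τ : TriN n) : Prop :=
  memTnInt n τ.1 ∧ memTnInt n τ.2.1 ∧ memTnInt n τ.2.2

abbrev MatN (n : ℕ) : Type := Matrix (Fin (n + 1)) (Fin (n + 1)) ℂ

/-- The form Jₙ = diag(1,…,1,−1). -/
def Jn (n : ℕ) : MatN n := Matrix.diagonal (fun i => if (i : ℕ) = n then -1 else 1)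

/-- Membership in U(n,1). -/
def memUn (n : ℕ) (M : MatN n) : Prop := Mᴴ * Jn n * M = Jn n

/-- The diagonal matrix E(α) = diag(e^{iα₁}, …, e^{iαₙ}, 1). -/
def En (n : ℕ) (α : Fin n → ℝ) : MatN n :=
  Matrix.diagonal (fun i =>
    if h : (i : ℕ) < n then Complex.exp ((α ⟨i.1, h⟩ : ℝ) * Complex.I) else 1)

/-- `M` is of elliptic type `α`: conjugate in U(n,1) to E(α). -/
def ellTypeN (n : ℕ) (M : MatN n) (α : Fin n → ℝ) : Prop :=
  ∃ P : MatN n, memUn n P ∧ M = P * En n α * P⁻¹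

/-- The elliptic Horn solution set 𝒫ₙ in PU(n,1). -/
def HornSolN (n : ℕ) : Set (TriN n) := {τ | memTn3 n τ ∧ ∃ A B C : MatN n,
  memUn n A ∧ memUn n B ∧ memUn n C ∧
  ellTypeN n A τ.1 ∧ ellTypeN n B τ.2.1 ∧ ellTypeN n C τ.2.2 ∧
  ∃ lam : ℂ, A * B * C = lam • (1 : MatN n)}

/-- A polytope: a finite intersection of affine half-spaces, each of the form
`{x : f x ≤ c}` or `{x : f x < c}` for a linear functional `f`. -/
def IsPolytope {n : ℕ} (Q : Set (TriN n)) : Prop :=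
  ∃ (m : ℕ) (f : Fin m → (TriN n →ₗ[ℝ] ℝ)) (c : Fin m → ℝ) (strict : Fin m → Bool),
    Q = ⋂ j : Fin m, {x : TriN n | if strict j then f j x < c j else f j x ≤ c j}

set_option linter.unusedSectionVars false

namespace Horn

/-! ### Semilinear sets -/

inductive Poly {E : Type*} [AddCommGroup E] [Module ℝ E] : Set E → Prop
  | univ : Poly Set.univ
  | lt (f : E →ₗ[ℝ] ℝ) (c : ℝ) (Q : Set E) : Poly Q → Poly ({x | f x < c} ∩ Q)
  | le (f : E →ₗ[ℝ] ℝ) (c : ℝ) (Q : Set E) : Poly Q → Poly ({x | f x ≤ c} ∩ Q)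

inductive SL {E : Type*} [AddCommGroup E] [Module ℝ E] : Set E → Prop
  | lt (f : E →ₗ[ℝ] ℝ) (c : ℝ) : SL {x | f x < c}
  | compl (S : Set E) : SL S → SL Sᶜ
  | inter (S T : Set E) : SL S → SL T → SL (S ∩ T)

def FP {E : Type*} [AddCommGroup E] [Module ℝ E] (S : Set E) : Prop :=
  ∃ F : Set (Set E), F.Finite ∧ (∀ Q ∈ F, Poly Q) ∧ S = ⋃₀ F

section
variable {E : Type*} [AddCommGroup E] [Module ℝ E]

theorem Poly.inter {S T : Set E} (hS : Poly S) (hT : Poly T) : Poly (S ∩ T) := by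
  induction hS with
  | univ => simpa using hT
  | lt f c Q _ ih => rw [Set.inter_assoc]; exact Poly.lt f c _ ih
  | le f c Q _ ih => rw [Set.inter_assoc]; exact Poly.le f c _ ih

theorem Poly.convex {S : Set E} (hS : Poly S) : Convex ℝ S := by
  induction hS with
  | univ => exact convex_univ
  | lt f c Q _ ih => exact (convex_halfSpace_lt f.isLinear c).inter ih
  | le f c Q _ ih => exact (convex_halfSpace_le f.isLinear c).inter ih

theorem Poly.fp {S : Set E} (hS : Poly S) : FP S := ⟨{S}, by simp, by simpa using hS, by simp⟩

theorem FP.union {S T : Set E} (hS : FP S) (hT : FP T) : FP (S ∪ T) := by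
  obtain ⟨F, hF, hF', rfl⟩ := hS
  obtain ⟨G, hG, hG', rfl⟩ := hT
  refine ⟨F ∪ G, hF.union hG, ?_, (Set.sUnion_union F G).symm⟩
  rintro Q (h | h)
  · exact hF' Q h
  · exact hG' Q h

theorem FP.inter {S T : Set E} (hS : FP S) (hT : FP T) : FP (S ∩ T) := by
  obtain ⟨F, hF, hF', rfl⟩ := hS
  obtain ⟨G, hG, hG', rfl⟩ := hT
  refine ⟨Set.image2 (· ∩ ·) F G, hF.image2 _ hG, ?_, ?_⟩
  · rintro Q ⟨A, hA, B, hB, rfl⟩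
    exact (hF' A hA).inter (hG' B hB)
  · ext x
    simp only [Set.mem_inter_iff, Set.mem_sUnion, Set.mem_image2]
    constructor
    · rintro ⟨⟨A, hA, hxA⟩, ⟨B, hB, hxB⟩⟩
      exact ⟨A ∩ B, ⟨A, hA, B, hB, rfl⟩, hxA, hxB⟩
    · rintro ⟨_, ⟨A, hA, B, hB, rfl⟩, hxA, hxB⟩
      exact ⟨⟨A, hA, hxA⟩, ⟨B, hB, hxB⟩⟩

theorem SL.fp_aux {S : Set E} (hS : SL S) : FP S ∧ FP Sᶜ := by
  induction hS with
  | lt f c =>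
    constructor
    · simpa using (Poly.lt f c _ Poly.univ).fp
    · have := (Poly.le (-f) (-c) _ Poly.univ).fp
      convert this using 1
      ext x; simp
  | compl S _ ih => exact ⟨ih.2, by simpa using ih.1⟩
  | inter S T _ _ ihS ihT =>
    refine ⟨ihS.1.inter ihT.1, ?_⟩
    rw [Set.compl_inter]
    exact ihS.2.union ihT.2

theorem SL.fp {S : Set E} (hS : SL S) : FP S := hS.fp_aux.1

theorem SL.union {S T : Set E} (hS : SL S) (hT : SL T) : SL (S ∪ T) := by
  have := SL.compl _ (SL.inter _ _ (SL.compl _ hS) (SL.compl _ hT))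
  simpa [Set.compl_inter] using this

theorem SL.univ : SL (Set.univ : Set E) := by
  have := SL.lt (0 : E →ₗ[ℝ] ℝ) 1
  convert this using 1
  ext; simp

theorem SL.empty : SL (∅ : Set E) := by
  simpa using SL.compl _ (SL.univ (E := E))

theorem SL.le (f : E →ₗ[ℝ] ℝ) (c : ℝ) : SL {x | f x ≤ c} := by
  have := SL.compl _ (SL.lt (-f) (-c))
  convert this using 1
  ext x; simp

theorem SL.eq (f : E →ₗ[ℝ] ℝ) (c : ℝ) : SL {x | f x = c} := by
  have := SL.inter _ _ (SL.le f c) (SL.compl _ (SL.lt f c))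
  convert this using 1
  ext x; simp [le_antisymm_iff]

theorem SL.diff {S T : Set E} (hS : SL S) (hT : SL T) : SL (S \ T) :=
  SL.inter _ _ hS (SL.compl _ hT)

theorem SL.biUnion {ι : Type*} (s : Finset ι) (S : ι → Set E) (h : ∀ i ∈ s, SL (S i)) :
    SL (⋃ i ∈ s, S i) := by
  classical
  induction s using Finset.induction_on with
  | empty => simpa using SL.empty
  | insert a s ha ih =>
    rw [Finset.set_biUnion_insert]
    exact (h a (by simp)).union (ih fun i hi => h i (by simp [hi]))

theorem SL.iUnion {ι : Type*} [Finite ι] (S : ι → Set E) (h : ∀ i, SL (S i)) :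
    SL (⋃ i, S i) := by
  cases nonempty_fintype ι
  simpa using SL.biUnion Finset.univ S (fun i _ => h i)

theorem SL.iInter {ι : Type*} [Finite ι] (S : ι → Set E) (h : ∀ i, SL (S i)) :
    SL (⋂ i, S i) := by
  have := SL.compl _ (SL.iUnion (fun i => (S i)ᶜ) (fun i => SL.compl _ (h i)))
  simpa [Set.compl_iUnion] using this

theorem SL.all {ι : Type*} [Finite ι] (p : ι → E → Prop) (h : ∀ i, SL {x | p i x}) :
    SL {x | ∀ i, p i x} := by
  have := SL.iInter _ h
  convert this using 1
  ext x; simp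

theorem SL.poly {S : Set E} (hS : Poly S) : SL S := by
  induction hS with
  | univ => exact SL.univ
  | lt f c Q _ ih => exact SL.inter _ _ (SL.lt f c) ih
  | le f c Q _ ih => exact SL.inter _ _ (SL.le f c) ih

theorem SL.preimage {F : Type*} [AddCommGroup F] [Module ℝ F] {S : Set F} (hS : SL S)
    (L : E →ₗ[ℝ] F) (v : F) : SL {x | L x + v ∈ S} := by
  induction hS with
  | lt f c =>
    have := SL.lt (f ∘ₗ L) (c - f v)
    convert this using 1
    ext x; simp [lt_sub_iff_add_lt]
  | compl S _ ih => exact SL.compl _ ih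
  | inter S T _ _ ihS ihT => exact SL.inter _ _ ihS ihT

theorem SL.preimage_lin {F : Type*} [AddCommGroup F] [Module ℝ F] {S : Set F} (hS : SL S)
    (L : E →ₗ[ℝ] F) : SL {x | L x ∈ S} := by
  simpa using hS.preimage L 0

theorem SL.const (p : Prop) : SL {_x : E | p} := by
  by_cases h : p
  · simpa [h] using SL.univ (E := E)
  · simpa [h] using SL.empty (E := E)

theorem SL.of_clopen [TopologicalSpace E] [ContinuousAdd E] [ContinuousSMul ℝ E]
    {X Y : Set E} (hX : SL X) (hYX : Y ⊆ X)
    (hopen : ∀ x ∈ Y, ∀ᶠ y in nhds x, y ∈ X → y ∈ Y)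
    (hclosed : ∀ x ∈ X, x ∈ closure Y → x ∈ Y) : SL Y := by
  obtain ⟨F, hF, hF', rfl⟩ := hX.fp
  have key : ∀ Q ∈ F, ∀ x ∈ Q, x ∈ Y → Q ⊆ Y := by
    intro Q hQ x hxQ hxY
    have hc := (hF' Q hQ).convex.isPreconnected
    have hQX : Q ⊆ ⋃₀ F := Set.subset_sUnion_of_mem hQ
    have hmemu : ∀ y ∈ Y, y ∈ interior (Y ∪ (⋃₀ F)ᶜ) := by
      intro y hy
      rw [mem_interior_iff_mem_nhds]
      filter_upwards [hopen y hy] with z hz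
      by_cases h : z ∈ ⋃₀ F
      · exact Or.inl (hz h)
      · exact Or.inr h
    have hu' : ∀ y ∈ ⋃₀ F, y ∈ interior (Y ∪ (⋃₀ F)ᶜ) → y ∈ Y := by
      intro y hy h
      rcases interior_subset h with h | h
      · exact h
      · exact absurd hy h
    have hsub : Q ⊆ interior (Y ∪ (⋃₀ F)ᶜ) ∪ (closure Y)ᶜ := by
      intro y hy
      by_cases h : y ∈ closure Y
      · exact Or.inl (hmemu y (hclosed y (hQX hy) h))
      · exact Or.inr h
    by_contra hcon
    obtain ⟨y, hyQ, hyY⟩ := Set.not_subset.1 hcon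
    obtain ⟨z, hzQ, hzu, hzv⟩ := hc _ _ isOpen_interior isClosed_closure.isOpen_compl hsub
      ⟨x, hxQ, hmemu x hxY⟩ ⟨y, hyQ, fun h => hyY (hclosed y (hQX hyQ) h)⟩
    exact hzv (subset_closure (hu' z (hQX hzQ) hzu))
  have hY : Y = ⋃₀ {Q ∈ F | Q ⊆ Y} := by
    ext x
    constructor
    · intro hx
      obtain ⟨Q, hQ, hxQ⟩ := hYX hx
      exact ⟨Q, ⟨hQ, key Q hQ x hxQ hx⟩, hxQ⟩
    · rintro ⟨Q, ⟨_, hQ⟩, hxQ⟩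
      exact hQ hxQ
  rw [hY]
  have hfin : {Q ∈ F | Q ⊆ Y}.Finite := hF.subset (fun Q h => h.1)
  have := SL.biUnion hfin.toFinset (fun Q => Q)
    (fun Q hQ => SL.poly (hF' Q ((hfin.mem_toFinset.1 hQ).1)))
  convert this using 1
  ext x; simp

end

end Horn

namespace Horn

/-! ### Pseudo-unitary matrices -/

section
variable {ι κ μ : Type} [Fintype ι] [DecidableEq ι] [Fintype κ] [DecidableEq κ]
  [Fintype μ] [DecidableEq μ]

def Jd (ε : ι → ℝ) : Matrix ι ι ℂ := Matrix.diagonal fun i => (ε i : ℂ)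

def Dg (a : ι → ℝ) : Matrix ι ι ℂ := Matrix.diagonal fun i => Complex.exp ((a i : ℂ) * Complex.I)

def IsoU (ε₁ : ι → ℝ) (ε₂ : κ → ℝ) (Q : Matrix ι κ ℂ) : Prop :=
  Qᴴ * Jd ε₁ * Q = Jd ε₂ ∧ Q * Jd ε₂ * Qᴴ = Jd ε₁

def Qs (ε₁ : ι → ℝ) (ε₂ : κ → ℝ) (Q : Matrix ι κ ℂ) : Matrix κ ι ℂ :=
  Jd ε₂ * Qᴴ * Jd ε₁

def HS (ε₁ : ι → ℝ) (ε₂ : κ → ℝ) (ε₃ : μ → ℝ) : Set ((ι → ℝ) × (κ → ℝ) × (μ → ℝ)) :=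
  {x | ∃ (Q : Matrix ι κ ℂ) (R : Matrix ι μ ℂ), IsoU ε₁ ε₂ Q ∧ IsoU ε₁ ε₃ R ∧
    Dg x.1 * (Q * Dg x.2.1 * Qs ε₁ ε₂ Q) * (R * Dg x.2.2 * Qs ε₁ ε₃ R) = 1}

def Sgn (ε : ι → ℝ) : Prop := ∀ i, ε i = 1 ∨ ε i = -1

def Sig (ε : ι → ℝ) : Prop := Sgn ε ∧ ∀ i j, ε i = -1 → ε j = -1 → i = j

theorem Jd_mul_Jd {ε : ι → ℝ} (h : Sgn ε) : Jd ε * Jd ε = 1 := by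
  unfold Jd
  rw [Matrix.diagonal_mul_diagonal, ← Matrix.diagonal_one]
  congr 1; funext i
  rcases h i with h | h <;> simp [h]

theorem Jd_conjTranspose (ε : ι → ℝ) : (Jd ε)ᴴ = Jd ε := by
  unfold Jd
  rw [Matrix.diagonal_conjTranspose]
  congr 1; funext i; simp

theorem IsoU.mul_Qs {ε₁ : ι → ℝ} {ε₂ : κ → ℝ} {Q : Matrix ι κ ℂ} (h : IsoU ε₁ ε₂ Q)
    (h₁ : Sgn ε₁) : Q * Qs ε₁ ε₂ Q = 1 := by
  unfold Qs
  rw [← Matrix.mul_assoc, ← Matrix.mul_assoc, h.2, Jd_mul_Jd h₁]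

theorem IsoU.Qs_mul {ε₁ : ι → ℝ} {ε₂ : κ → ℝ} {Q : Matrix ι κ ℂ} (h : IsoU ε₁ ε₂ Q)
    (h₂ : Sgn ε₂) : Qs ε₁ ε₂ Q * Q = 1 := by
  unfold Qs
  rw [Matrix.mul_assoc, Matrix.mul_assoc, ← Matrix.mul_assoc Qᴴ, h.1, Jd_mul_Jd h₂]

theorem Dg_mul (a b : ι → ℝ) : Dg a * Dg b = Dg (a + b) := by
  unfold Dg
  rw [Matrix.diagonal_mul_diagonal]
  congr 1; funext i
  rw [← Complex.exp_add]; congr 1; simp; ring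

theorem Dg_zero : Dg (0 : ι → ℝ) = 1 := by
  unfold Dg; simp

theorem Dg_neg_mul (a : ι → ℝ) : Dg (-a) * Dg a = 1 := by
  rw [Dg_mul, neg_add_cancel, Dg_zero]

theorem Dg_mul_neg (a : ι → ℝ) : Dg a * Dg (-a) = 1 := by
  rw [Dg_mul, add_neg_cancel, Dg_zero]

theorem Dg_conjTranspose (a : ι → ℝ) : (Dg a)ᴴ = Dg (-a) := by
  unfold Dg
  rw [Matrix.diagonal_conjTranspose]
  congr 1; funext i
  simp [← Complex.exp_conj]

/-- The Hermitian form. -/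
def Bf (ε : ι → ℝ) (u v : ι → ℂ) : ℂ := ∑ i, (ε i : ℂ) * (star (u i) * v i)

theorem Bf_eq (ε : ι → ℝ) (u v : ι → ℂ) : Bf ε u v = star u ⬝ᵥ (Jd ε *ᵥ v) := by
  unfold Bf Jd dotProduct
  refine Finset.sum_congr rfl fun i _ => ?_
  rw [Matrix.mulVec_diagonal]; simp; ring

theorem IsoU.Bf {ε₁ : ι → ℝ} {ε₂ : κ → ℝ} {Q : Matrix ι κ ℂ} (h : IsoU ε₁ ε₂ Q) (u v : κ → ℂ) :
    Bf ε₁ (Q *ᵥ u) (Q *ᵥ v) = Horn.Bf ε₂ u v := by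
  rw [Bf_eq, Bf_eq, ← h.1, Matrix.star_mulVec, ← Matrix.dotProduct_mulVec,
    Matrix.mulVec_mulVec, Matrix.mulVec_mulVec, Matrix.mul_assoc]

theorem Bf_self (ε : ι → ℝ) (u : ι → ℂ) : Bf ε u u = ((∑ i, ε i * ‖u i‖ ^ 2 : ℝ) : ℂ) := by
  unfold Bf
  push_cast
  refine Finset.sum_congr rfl fun i _ => ?_
  congr 1
  exact Complex.conj_mul' (u i)

end
end Horn

namespace Horn

section
variable {ι κ μ : Type} [Fintype ι] [DecidableEq ι] [Fintype κ] [DecidableEq κ]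
  [Fintype μ] [DecidableEq μ]

theorem Sig.pos {ε : ι → ℝ} (h : Sig ε) {i₀ : ι} (h₀ : ε i₀ = -1) {i : ι} (hi : i ≠ i₀) :
    ε i = 1 := by
  rcases h.1 i with h' | h'
  · exact h'
  · exact absurd (h.2 i i₀ h' h₀) hi

theorem lor_sum {ε : ι → ℝ} (h : Sig ε) {i₀ : ι} (h₀ : ε i₀ = -1) (f : ι → ℝ) :
    ∑ i, ε i * f i = ∑ i ∈ Finset.univ.erase i₀, f i - f i₀ := by
  rw [← Finset.sum_erase_add _ _ (Finset.mem_univ i₀), h₀,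
    Finset.sum_congr rfl (g := f) (fun i hi => by rw [h.pos h₀ (Finset.ne_of_mem_erase hi), one_mul])]
  ring

theorem lor_sumC {ε : ι → ℝ} (h : Sig ε) {i₀ : ι} (h₀ : ε i₀ = -1) (f : ι → ℂ) :
    ∑ i, (ε i : ℂ) * f i = ∑ i ∈ Finset.univ.erase i₀, f i - f i₀ := by
  rw [← Finset.sum_erase_add _ _ (Finset.mem_univ i₀), h₀,
    Finset.sum_congr rfl (g := f) (fun i hi => by
      rw [h.pos h₀ (Finset.ne_of_mem_erase hi), Complex.ofReal_one, one_mul])]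
  push_cast; ring

theorem Dg_mulVec (a : ι → ℝ) (q : ι → ℂ) (i : ι) :
    (Dg a *ᵥ q) i = Complex.exp ((a i : ℂ) * Complex.I) * q i := by
  unfold Dg; rw [Matrix.mulVec_diagonal]

theorem norm_Dg_mulVec (a : ι → ℝ) (q : ι → ℂ) (i : ι) : ‖(Dg a *ᵥ q) i‖ = ‖q i‖ := by
  rw [Dg_mulVec, norm_mul, Complex.norm_exp_ofReal_mul_I, one_mul]

theorem Bf_Dg (ε : ι → ℝ) (a : ι → ℝ) (u v : ι → ℂ) :
    Bf ε (Dg a *ᵥ u) (Dg a *ᵥ v) = Bf ε u v := by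
  unfold Bf
  refine Finset.sum_congr rfl fun i _ => ?_
  rw [Dg_mulVec, Dg_mulVec]
  congr 1
  have h : star (Complex.exp ((a i : ℂ) * Complex.I)) * Complex.exp ((a i : ℂ) * Complex.I) = 1 := by
    have := Complex.conj_mul' (Complex.exp ((a i : ℂ) * Complex.I))
    rw [Complex.norm_exp_ofReal_mul_I] at this
    simpa using this
  rw [star_mul']
  linear_combination (star (u i) * v i) * h

theorem lor_angle {ε : ι → ℝ} (h : Sig ε) {i₀ : ι} (h₀ : ε i₀ = -1) (q : ι → ℂ)
    (hq : Bf ε q q = -1) (a : ι → ℝ) {δ : ℝ} (hδ : 0 < δ) (hδ1 : δ ≤ 1)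
    (ha : ∀ i, i ≠ i₀ → δ ≤ 1 - Real.cos (a i - a i₀)) :
    δ * ‖q i₀‖ ^ 2 ≤ ‖Bf ε q (Dg a *ᵥ q)‖ ∧ 1 ≤ ‖Bf ε q (Dg a *ᵥ q)‖ := by
  have h1 : ∑ i ∈ Finset.univ.erase i₀, ‖q i‖ ^ 2 - ‖q i₀‖ ^ 2 = -1 := by
    rw [← lor_sum h h₀ (fun i => ‖q i‖ ^ 2)]
    rw [Bf_self] at hq
    exact_mod_cast hq
  set w := Complex.exp ((-(a i₀) : ℝ) * Complex.I) with hw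
  have hwn : ‖w‖ = 1 := Complex.norm_exp_ofReal_mul_I _
  have h2 : (w * Bf ε q (Dg a *ᵥ q)).re =
      ∑ i, ε i * (Real.cos (a i - a i₀) * ‖q i‖ ^ 2) := by
    unfold Bf
    rw [Finset.mul_sum, Complex.re_sum]
    refine Finset.sum_congr rfl fun i _ => ?_
    rw [Dg_mulVec]
    have e1 : w * ((ε i : ℂ) * (star (q i) * (Complex.exp ((a i : ℂ) * Complex.I) * q i))) =
      ((ε i * ‖q i‖ ^ 2 : ℝ) : ℂ) * Complex.exp ((a i - a i₀ : ℝ) * Complex.I) := by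
      have := Complex.conj_mul' (q i)
      have e2 : Complex.exp ((a i - a i₀ : ℝ) * Complex.I) = w * Complex.exp ((a i : ℂ) * Complex.I) := by
        rw [hw, ← Complex.exp_add]; congr 1; push_cast; ring
      rw [e2]
      push_cast
      rw [← this]
      simp only [starRingEnd_apply]
      ring
    rw [e1, Complex.re_ofReal_mul, Complex.exp_ofReal_mul_I_re]
    ring
  rw [lor_sum h h₀] at h2
  have h3 : ∑ i ∈ Finset.univ.erase i₀, Real.cos (a i - a i₀) * ‖q i‖ ^ 2 ≤
      (1 - δ) * ∑ i ∈ Finset.univ.erase i₀, ‖q i‖ ^ 2 := by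
    rw [Finset.mul_sum]
    refine Finset.sum_le_sum fun i hi => ?_
    have := ha i (Finset.ne_of_mem_erase hi)
    have h5 : 0 ≤ ‖q i‖ ^ 2 := by positivity
    nlinarith
  have h4 : -(w * Bf ε q (Dg a *ᵥ q)).re ≤ ‖Bf ε q (Dg a *ᵥ q)‖ := by
    have := Complex.abs_re_le_norm (w * Bf ε q (Dg a *ᵥ q))
    rw [norm_mul, hwn, one_mul] at this
    exact (neg_le_abs _).trans this
  have h6 : 0 ≤ ∑ i ∈ Finset.univ.erase i₀, ‖q i‖ ^ 2 := Finset.sum_nonneg fun i _ => by positivity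
  simp only [sub_self, Real.cos_zero, one_mul] at h2
  constructor <;> nlinarith

theorem real_core {p0 p' m0 m' n0 M2 c : ℝ} (hp0 : 0 ≤ p0) (hp' : 0 ≤ p')
    (hm0 : 0 ≤ m0) (hm' : 0 ≤ m') (hn0 : 0 ≤ n0) (hM : 0 < M2) (hc : 0 ≤ c)
    (hp : p' ^ 2 ≤ p0 ^ 2) (hm : m' ^ 2 = m0 ^ 2 - M2)
    (h : p0 * m0 - p' * m' ≤ n0) (hm1 : m0 ^ 2 ≤ c * M2) (hn1 : n0 ^ 2 ≤ c * M2) :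
    p0 ≤ 2 * c := by
  have h1 : p' ≤ p0 := abs_le_of_sq_le_sq' hp hp0 |>.2
  have h2 : m' ≤ m0 := abs_le_of_sq_le_sq' (by linarith) hm0 |>.2
  have h3 : p0 * (m0 - m') ≤ n0 := by nlinarith
  have h4 : p0 * M2 ≤ n0 * (m0 + m') := by
    have : M2 = (m0 - m') * (m0 + m') := by nlinarith
    rw [this]; nlinarith
  have h5 : n0 * (m0 + m') ≤ 2 * (n0 * m0) := by nlinarith
  have h6 : 2 * (n0 * m0) ≤ 2 * (c * M2) := by nlinarith [sq_nonneg (n0 - m0)]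
  have h7 : p0 * M2 ≤ (2 * c) * M2 := by linarith
  exact le_of_mul_le_mul_right h7 hM

theorem core_bound {ε₁ : ι → ℝ} {ε₂ : κ → ℝ} (h₁ : Sig ε₁) (h₂ : Sig ε₂)
    {i₀ : ι} {j₀ : κ} (hi₀ : ε₁ i₀ = -1) (hj₀ : ε₂ j₀ = -1) {Q : Matrix ι κ ℂ}
    (hQ : IsoU ε₁ ε₂ Q) {δ : ℝ} (hδ : 0 < δ) (hδ1 : δ ≤ 1) (a : ι → ℝ) (b : κ → ℝ)
    (ha : ∀ i, i ≠ i₀ → δ ≤ 1 - Real.cos (a i - a i₀))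
    (hb : ∀ j, j ≠ j₀ → δ ≤ 1 - Real.cos (b j - b j₀))
    (t : κ → ℂ) (ht : Bf ε₂ t t = -1) (ω : ℂ) (hω : ‖ω‖ = 1)
    (heq : Q *ᵥ (Dg b *ᵥ t) = ω • (Dg a *ᵥ (Q *ᵥ t))) :
    ‖Q i₀ j₀‖ ≤ 4 / δ := by
  have hq : Bf ε₁ (Q *ᵥ t) (Q *ᵥ t) = -1 := by rw [hQ.Bf, ht]
  set z := Bf ε₂ t (Dg b *ᵥ t) with hz
  have hz' : z = ω * Bf ε₁ (Q *ᵥ t) (Dg a *ᵥ (Q *ᵥ t)) := by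
    rw [hz, ← hQ.Bf, heq]
    simp only [Bf, Finset.mul_sum, Pi.smul_apply, smul_eq_mul]
    exact Finset.sum_congr rfl fun i _ => by ring
  obtain ⟨hb1, hb2⟩ := lor_angle h₂ hj₀ t ht b hδ hδ1 hb
  obtain ⟨ha1, ha2⟩ := lor_angle h₁ hi₀ _ hq a hδ hδ1 ha
  have hzn : ‖z‖ = ‖Bf ε₁ (Q *ᵥ t) (Dg a *ᵥ (Q *ᵥ t))‖ := by rw [hz', norm_mul, hω, one_mul]
  rw [← hzn] at ha1 ha2
  rw [← hz] at hb1 hb2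
  have hz0 : (‖z‖ : ℂ) ≠ 0 := by
    have : ‖z‖ ≠ 0 := by linarith
    exact_mod_cast this
  set u : ℂ := -(star z) / ‖z‖ with hu
  have hun : ‖u‖ = 1 := by
    rw [hu, norm_div, norm_neg, norm_star, Complex.norm_real, norm_norm]
    exact div_self (by linarith)
  have huz : u * z = -‖z‖ := by
    have := Complex.conj_mul' z
    simp only [starRingEnd_apply] at this
    rw [hu, div_mul_eq_mul_div, neg_mul, this]
    field_simp
  have huu : star u * u = 1 := by
    have := Complex.conj_mul' u
    rw [hun] at this; simpa using this
  set n : κ → ℂ := t + u • (Dg b *ᵥ t) with hn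
  have hnn : Bf ε₂ n n = -(2 + 2 * ‖z‖ : ℝ) := by
    have e1 : Bf ε₂ n n = Bf ε₂ t t + u * z + star (u * z) +
        (star u * u) * Bf ε₂ (Dg b *ᵥ t) (Dg b *ᵥ t) := by
      rw [hz]
      simp only [Bf, Finset.mul_sum, hn, star_mul', star_sum, ← Finset.sum_add_distrib]
      refine Finset.sum_congr rfl fun i _ => ?_
      simp only [Pi.add_apply, Pi.smul_apply, smul_eq_mul, star_add, star_mul', star_star]
      have : star (ε₂ i : ℂ) = ε₂ i := by simp
      rw [this]
      ring
    rw [e1, Bf_Dg, ht, huu, huz]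
    simp; ring
  set m := Q *ᵥ n with hm
  have hmm : Bf ε₁ m m = -(2 + 2 * ‖z‖ : ℝ) := by rw [hm, hQ.Bf, hnn]
  set e : κ → ℂ := Pi.single j₀ 1 with he
  have hp : Bf ε₁ (Q *ᵥ e) (Q *ᵥ e) = -1 := by
    rw [hQ.Bf]; simp [Bf, he, Pi.single_apply, hj₀]
  have hpm : Bf ε₁ (Q *ᵥ e) m = - n j₀ := by
    rw [hm, hQ.Bf]; simp [Bf, he, Pi.single_apply, hj₀]
  have hQe : ∀ i, (Q *ᵥ e) i = Q i j₀ := by intro i; simp [he]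
  have hmi : ‖m i₀‖ ≤ 2 * ‖(Q *ᵥ t) i₀‖ := by
    rw [hm, hn, Matrix.mulVec_add, Matrix.mulVec_smul, heq]
    refine (norm_add_le _ _).trans ?_
    simp only [Pi.smul_apply, norm_smul, hun, hω, one_mul, norm_Dg_mulVec]
    linarith
  have hnj : ‖n j₀‖ ≤ 2 * ‖t j₀‖ := by
    rw [hn]
    refine (norm_add_le _ _).trans ?_
    simp only [Pi.smul_apply, norm_smul, hun, one_mul, norm_Dg_mulVec]
    linarith
  have hmi2 : ‖m i₀‖ ^ 2 ≤ 2 / δ * (2 + 2 * ‖z‖) := by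
    have : δ * ‖m i₀‖ ^ 2 ≤ 2 * (2 + 2 * ‖z‖) := by
      have : ‖m i₀‖ ^ 2 ≤ 4 * ‖(Q *ᵥ t) i₀‖ ^ 2 := by nlinarith [norm_nonneg (m i₀)]
      nlinarith
    rw [div_mul_eq_mul_div, le_div_iff₀ hδ]; linarith
  have hnj2 : ‖n j₀‖ ^ 2 ≤ 2 / δ * (2 + 2 * ‖z‖) := by
    have : δ * ‖n j₀‖ ^ 2 ≤ 2 * (2 + 2 * ‖z‖) := by
      have : ‖n j₀‖ ^ 2 ≤ 4 * ‖t j₀‖ ^ 2 := by nlinarith [norm_nonneg (n j₀)]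
      nlinarith
    rw [div_mul_eq_mul_div, le_div_iff₀ hδ]; linarith
  have hps : ∑ i ∈ Finset.univ.erase i₀, ‖Q i j₀‖ ^ 2 - ‖Q i₀ j₀‖ ^ 2 = -1 := by
    rw [Bf_self] at hp
    simp only [hQe] at hp
    rw [← lor_sum h₁ hi₀ (fun i => ‖Q i j₀‖ ^ 2)]
    exact_mod_cast hp
  have hms : ∑ i ∈ Finset.univ.erase i₀, ‖m i‖ ^ 2 - ‖m i₀‖ ^ 2 = -(2 + 2 * ‖z‖) := by
    rw [Bf_self] at hmm
    rw [← lor_sum h₁ hi₀ (fun i => ‖m i‖ ^ 2)]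
    exact_mod_cast hmm
  have hP0 : 0 ≤ ∑ i ∈ Finset.univ.erase i₀, ‖Q i j₀‖ ^ 2 :=
    Finset.sum_nonneg fun i _ => by positivity
  have hM0 : 0 ≤ ∑ i ∈ Finset.univ.erase i₀, ‖m i‖ ^ 2 :=
    Finset.sum_nonneg fun i _ => by positivity
  have hcs : ‖Q i₀ j₀‖ * ‖m i₀‖ - √(∑ i ∈ Finset.univ.erase i₀, ‖Q i j₀‖ ^ 2) *
      √(∑ i ∈ Finset.univ.erase i₀, ‖m i‖ ^ 2) ≤ ‖n j₀‖ := by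
    have e1 : Bf ε₁ (Q *ᵥ e) m = ∑ i ∈ Finset.univ.erase i₀, star (Q i j₀) * m i -
        star (Q i₀ j₀) * m i₀ := by
      simp only [Bf, hQe]
      exact lor_sumC h₁ hi₀ (fun i => star (Q i j₀) * m i)
    rw [hpm] at e1
    have e2 : star (Q i₀ j₀) * m i₀ = ∑ i ∈ Finset.univ.erase i₀, star (Q i j₀) * m i + n j₀ := by
      linear_combination e1
    have e3 : ‖star (Q i₀ j₀) * m i₀‖ = ‖Q i₀ j₀‖ * ‖m i₀‖ := by rw [norm_mul, norm_star]
    have e4 : ‖∑ i ∈ Finset.univ.erase i₀, star (Q i j₀) * m i‖ ≤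
        √(∑ i ∈ Finset.univ.erase i₀, ‖Q i j₀‖ ^ 2) * √(∑ i ∈ Finset.univ.erase i₀, ‖m i‖ ^ 2) := by
      refine (norm_sum_le _ _).trans ?_
      simp only [norm_mul, norm_star]
      exact Real.sum_mul_le_sqrt_mul_sqrt _ _ _
    have e5 := norm_add_le (∑ i ∈ Finset.univ.erase i₀, star (Q i j₀) * m i) (n j₀)
    rw [← e2, e3] at e5
    linarith
  have := real_core (norm_nonneg _) (Real.sqrt_nonneg _) (norm_nonneg _) (Real.sqrt_nonneg _)
    (norm_nonneg _) (M2 := 2 + 2 * ‖z‖) (c := 2 / δ) (by positivity) (by positivity)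
    (by rw [Real.sq_sqrt hP0]; linarith) (by rw [Real.sq_sqrt hM0]; linarith) hcs hmi2 hnj2
  calc _ ≤ _ := this
    _ = 4 / δ := by ring

end
end Horn

namespace Horn

section
variable {ι κ μ : Type} [Fintype ι] [DecidableEq ι] [Fintype κ] [DecidableEq κ]
  [Fintype μ] [DecidableEq μ]

theorem IsoU.row {ε₁ : ι → ℝ} {ε₂ : κ → ℝ} {Q : Matrix ι κ ℂ} (h : IsoU ε₁ ε₂ Q) (i : ι) :
    ∑ j, ε₂ j * ‖Q i j‖ ^ 2 = ε₁ i := by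
  have h1 := congrFun (congrFun h.2 i) i
  have h2 : (Q * Jd ε₂ * Qᴴ) i i = ((∑ j, ε₂ j * ‖Q i j‖ ^ 2 : ℝ) : ℂ) := by
    rw [Matrix.mul_apply]
    push_cast
    refine Finset.sum_congr rfl fun j _ => ?_
    rw [Jd, Matrix.mul_diagonal, Matrix.conjTranspose_apply, ← Complex.conj_mul']
    simp only [starRingEnd_apply]; ring
  rw [h2, Jd, Matrix.diagonal_apply_eq] at h1
  exact_mod_cast h1

theorem IsoU.col {ε₁ : ι → ℝ} {ε₂ : κ → ℝ} {Q : Matrix ι κ ℂ} (h : IsoU ε₁ ε₂ Q) (j : κ) :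
    ∑ i, ε₁ i * ‖Q i j‖ ^ 2 = ε₂ j := by
  have h1 := congrFun (congrFun h.1 j) j
  have h2 : (Qᴴ * Jd ε₁ * Q) j j = ((∑ i, ε₁ i * ‖Q i j‖ ^ 2 : ℝ) : ℂ) := by
    rw [Matrix.mul_apply]
    push_cast
    refine Finset.sum_congr rfl fun i _ => ?_
    rw [Jd, Matrix.mul_diagonal, Matrix.conjTranspose_apply, ← Complex.conj_mul']
    simp only [starRingEnd_apply]; ring
  rw [h2, Jd, Matrix.diagonal_apply_eq] at h1
  exact_mod_cast h1

theorem IsoU.bound_def {ε₁ : ι → ℝ} {ε₂ : κ → ℝ} {Q : Matrix ι κ ℂ} (h : IsoU ε₁ ε₂ Q)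
    (h₁ : Sgn ε₁) (h₂ : Sgn ε₂) (hneg : ∀ j, ε₂ j ≠ -1) (i : ι) (j : κ) : ‖Q i j‖ ≤ 1 := by
  have h3 := h.row i
  have h4 : ∀ j, ε₂ j = 1 := fun j => (h₂ j).resolve_right (hneg j)
  simp only [h4, one_mul] at h3
  have h5 : ‖Q i j‖ ^ 2 ≤ ε₁ i := by
    rw [← h3]
    exact Finset.single_le_sum (f := fun j => ‖Q i j‖ ^ 2) (fun _ _ => by positivity)
      (Finset.mem_univ j)
  have h6 : ε₁ i ≤ 1 := by rcases h₁ i with h | h <;> rw [h] <;> norm_num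
  nlinarith [norm_nonneg (Q i j)]

theorem IsoU.bound_lor {ε₁ : ι → ℝ} {ε₂ : κ → ℝ} {Q : Matrix ι κ ℂ} (h : IsoU ε₁ ε₂ Q)
    (h₁ : Sig ε₁) (h₂ : Sig ε₂) {i₀ : ι} {j₀ : κ} (hi₀ : ε₁ i₀ = -1) (hj₀ : ε₂ j₀ = -1)
    {B : ℝ} (hB : ‖Q i₀ j₀‖ ≤ B) (i : ι) (j : κ) : ‖Q i j‖ ≤ 1 + B := by
  have hB0 : 0 ≤ B := (norm_nonneg _).trans hB
  have hcol : ∀ i, ‖Q i j₀‖ ≤ B := by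
    intro i
    by_cases hi : i = i₀
    · rw [hi]; exact hB
    have h3 := h.col j₀
    rw [lor_sum h₁ hi₀, hj₀] at h3
    have h4 : ‖Q i j₀‖ ^ 2 ≤ ∑ i ∈ Finset.univ.erase i₀, ‖Q i j₀‖ ^ 2 :=
      Finset.single_le_sum (f := fun i => ‖Q i j₀‖ ^ 2) (fun _ _ => by positivity)
        (Finset.mem_erase.2 ⟨hi, Finset.mem_univ i⟩)
    have h5 : ‖Q i j₀‖ ^ 2 ≤ B ^ 2 := by nlinarith [norm_nonneg (Q i₀ j₀)]
    exact abs_le_of_sq_le_sq' h5 hB0 |>.2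
  by_cases hj : j = j₀
  · rw [hj]; linarith [hcol i]
  have h3 := h.row i
  rw [lor_sum h₂ hj₀] at h3
  have h4 : ‖Q i j‖ ^ 2 ≤ ∑ j ∈ Finset.univ.erase j₀, ‖Q i j‖ ^ 2 :=
    Finset.single_le_sum (f := fun j => ‖Q i j‖ ^ 2) (fun _ _ => by positivity)
      (Finset.mem_erase.2 ⟨hj, Finset.mem_univ j⟩)
  have h6 : ε₁ i ≤ 1 := by rcases h₁.1 i with h | h <;> rw [h] <;> norm_num
  have h5 : ‖Q i j‖ ^ 2 ≤ (1 + B) ^ 2 := by nlinarith [norm_nonneg (Q i j₀), hcol i]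
  exact abs_le_of_sq_le_sq' h5 (by linarith) |>.2

theorem IsoU.neg_iff {ε₁ : ι → ℝ} {ε₂ : κ → ℝ} {Q : Matrix ι κ ℂ} (h : IsoU ε₁ ε₂ Q)
    (h₁ : Sgn ε₁) (h₂ : Sgn ε₂) : (∃ i, ε₁ i = -1) ↔ ∃ j, ε₂ j = -1 := by
  constructor
  · rintro ⟨i, hi⟩
    by_contra hcon
    push Not at hcon
    have h4 : ∀ j, ε₂ j = 1 := fun j => (h₂ j).resolve_right (hcon j)
    have := h.row i
    simp only [h4, one_mul, hi] at this
    have h5 : 0 ≤ ∑ j, ‖Q i j‖ ^ 2 := Finset.sum_nonneg fun _ _ => by positivity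
    linarith
  · rintro ⟨j, hj⟩
    by_contra hcon
    push Not at hcon
    have h4 : ∀ i, ε₁ i = 1 := fun i => (h₁ i).resolve_right (hcon i)
    have := h.col j
    simp only [h4, one_mul, hj] at this
    have h5 : 0 ≤ ∑ i, ‖Q i j‖ ^ 2 := Finset.sum_nonneg fun _ _ => by positivity
    linarith

/-- Off-wall condition with margin. -/
def Mar (δ : ℝ) (a : ι → ℝ) : Prop := ∀ i j, i ≠ j → δ ≤ 1 - Real.cos (a i - a j)

theorem Mar.neg {δ : ℝ} {a : ι → ℝ} (h : Mar δ a) : Mar δ (-a) := by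
  intro i j hij
  have := h j i hij.symm
  rwa [Pi.neg_apply, Pi.neg_apply, neg_sub_neg]

theorem Dg_single (c : μ → ℝ) (k : μ) : Dg c *ᵥ (Pi.single k 1) =
    Complex.exp ((c k : ℂ) * Complex.I) • (Pi.single k 1 : μ → ℂ) := by
  funext i
  rw [Dg_mulVec]
  by_cases h : i = k
  · subst h; simp
  · simp [h]

theorem sol_bound {ε₁ : ι → ℝ} {ε₂ : κ → ℝ} {ε₃ : μ → ℝ} (h₁ : Sig ε₁) (h₂ : Sig ε₂) (h₃ : Sig ε₃)
    {Q : Matrix ι κ ℂ} {R : Matrix ι μ ℂ} (hQ : IsoU ε₁ ε₂ Q) (hR : IsoU ε₁ ε₃ R)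
    {a : ι → ℝ} {b : κ → ℝ} {c : μ → ℝ}
    (heq : Dg a * (Q * Dg b * Qs ε₁ ε₂ Q) * (R * Dg c * Qs ε₁ ε₃ R) = 1)
    {δ : ℝ} (hδ : 0 < δ) (hδ1 : δ ≤ 1) (ha : Mar δ a) (hb : Mar δ b) (hc : Mar δ c) :
    (∀ i j, ‖Q i j‖ ≤ 1 + 4 / δ) ∧ (∀ i k, ‖R i k‖ ≤ 1 + 4 / δ) := by
  have hpos : 0 < 4 / δ := by positivity
  by_cases hn : ∃ i, ε₁ i = -1
  · obtain ⟨j₀, hj₀⟩ := (hQ.neg_iff h₁.1 h₂.1).1 hn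
    obtain ⟨k₀, hk₀⟩ := (hR.neg_iff h₁.1 h₃.1).1 hn
    obtain ⟨i₀, hi₀⟩ := hn
    have hω : ∀ r : ℝ, ‖Complex.exp ((r : ℂ) * Complex.I)‖ = 1 := Complex.norm_exp_ofReal_mul_I
    constructor
    · refine hQ.bound_lor h₁ h₂ hi₀ hj₀ ?_
      -- `A⁻¹ q = ω B q` for the negative eigenvector `q` of `C`
      have hQt : Q *ᵥ (Qs ε₁ ε₂ Q *ᵥ (R *ᵥ Pi.single k₀ 1)) = R *ᵥ Pi.single k₀ 1 := by
        rw [Matrix.mulVec_mulVec, hQ.mul_Qs h₁.1, Matrix.one_mulVec]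
      refine core_bound h₁ h₂ hi₀ hj₀ hQ hδ hδ1 (-a) b (fun i hi => ha.neg i i₀ hi)
        (fun j hj => hb j j₀ hj) (Qs ε₁ ε₂ Q *ᵥ (R *ᵥ Pi.single k₀ 1)) ?_
        (Complex.exp (((-c k₀ : ℝ) : ℂ) * Complex.I)) (hω _) ?_
      · rw [← hQ.Bf, hQt, hR.Bf]; simp [Bf, Pi.single_apply, hk₀]
      · rw [hQt]
        have h5 := congrArg (fun M => M *ᵥ (R *ᵥ Pi.single k₀ (1 : ℂ))) heq
        simp only [Matrix.one_mulVec] at h5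
        have h6 : (R * Dg c * Qs ε₁ ε₃ R) *ᵥ (R *ᵥ Pi.single k₀ (1 : ℂ)) =
            Complex.exp ((c k₀ : ℂ) * Complex.I) • (R *ᵥ Pi.single k₀ 1) := by
          rw [Matrix.mulVec_mulVec, Matrix.mul_assoc, hR.Qs_mul h₃.1, Matrix.mul_one,
            ← Matrix.mulVec_mulVec, Dg_single, Matrix.mulVec_smul]
        rw [← Matrix.mulVec_mulVec, h6, Matrix.mulVec_smul] at h5
        nth_rewrite 2 [← h5]
        rw [Matrix.mulVec_smul, smul_smul, ← Complex.exp_add]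
        have h7 : ((-c k₀ : ℝ) : ℂ) * Complex.I + (c k₀ : ℂ) * Complex.I = 0 := by push_cast; ring
        rw [h7, Complex.exp_zero, one_smul]
        simp only [Matrix.mulVec_mulVec, ← Matrix.mul_assoc]
        rw [Dg_neg_mul, Matrix.one_mul]
    · refine hR.bound_lor h₁ h₃ hi₀ hk₀ ?_
      have hRt : R *ᵥ (Qs ε₁ ε₃ R *ᵥ (Q *ᵥ Pi.single j₀ 1)) = Q *ᵥ Pi.single j₀ 1 := by
        rw [Matrix.mulVec_mulVec, hR.mul_Qs h₁.1, Matrix.one_mulVec]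
      refine core_bound h₁ h₃ hi₀ hk₀ hR hδ hδ1 a (-c) (fun i hi => ha i i₀ hi)
        (fun j hj => hc.neg j k₀ hj) (Qs ε₁ ε₃ R *ᵥ (Q *ᵥ Pi.single j₀ 1)) ?_
        (Complex.exp (((b j₀ : ℝ) : ℂ) * Complex.I)) (hω _) ?_
      · rw [← hR.Bf, hRt, hQ.Bf]; simp [Bf, Pi.single_apply, hj₀]
      · rw [hRt]
        have hinv : (R * Dg (-c) * Qs ε₁ ε₃ R) = Dg a * (Q * Dg b * Qs ε₁ ε₂ Q) := by
          have e1 : (R * Dg c * Qs ε₁ ε₃ R) * (R * Dg (-c) * Qs ε₁ ε₃ R) = 1 := by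
            calc _ = R * (Dg c * (Qs ε₁ ε₃ R * R) * Dg (-c)) * Qs ε₁ ε₃ R := by
                  simp only [Matrix.mul_assoc]
              _ = 1 := by
                rw [hR.Qs_mul h₃.1, Matrix.mul_one, Dg_mul_neg, Matrix.mul_one, hR.mul_Qs h₁.1]
          calc _ = (Dg a * (Q * Dg b * Qs ε₁ ε₂ Q) * (R * Dg c * Qs ε₁ ε₃ R)) *
                (R * Dg (-c) * Qs ε₁ ε₃ R) := by rw [heq, Matrix.one_mul]
            _ = _ := by rw [Matrix.mul_assoc, e1, Matrix.mul_one]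
        have h6 : (Q * Dg b * Qs ε₁ ε₂ Q) *ᵥ (Q *ᵥ Pi.single j₀ (1 : ℂ)) =
            Complex.exp ((b j₀ : ℂ) * Complex.I) • (Q *ᵥ Pi.single j₀ 1) := by
          rw [Matrix.mulVec_mulVec, Matrix.mul_assoc, hQ.Qs_mul h₂.1, Matrix.mul_one,
            ← Matrix.mulVec_mulVec, Dg_single, Matrix.mulVec_smul]
        have h7 := congrArg (fun M => M *ᵥ (Q *ᵥ Pi.single j₀ (1 : ℂ))) hinv
        rw [← Matrix.mulVec_mulVec (M := Dg a), h6, Matrix.mulVec_smul] at h7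
        rw [← h7]
        simp only [Matrix.mulVec_mulVec, Matrix.mul_assoc]
  · have hn2 : ∀ j, ε₂ j ≠ -1 := fun j hj => hn ((hQ.neg_iff h₁.1 h₂.1).2 ⟨j, hj⟩)
    have hn3 : ∀ j, ε₃ j ≠ -1 := fun j hj => hn ((hR.neg_iff h₁.1 h₃.1).2 ⟨j, hj⟩)
    exact ⟨fun i j => (hQ.bound_def h₁.1 h₂.1 hn2 i j).trans (by linarith),
      fun i j => (hR.bound_def h₁.1 h₃.1 hn3 i j).trans (by linarith)⟩

theorem continuous_Dg : Continuous (Dg : (ι → ℝ) → Matrix ι ι ℂ) := by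
  unfold Dg
  refine Continuous.matrix_diagonal ?_
  fun_prop

/-- Solutions with bounded matrices. -/
def HB (ε₁ : ι → ℝ) (ε₂ : κ → ℝ) (ε₃ : μ → ℝ) (B : ℝ) : Set ((ι → ℝ) × (κ → ℝ) × (μ → ℝ)) :=
  {x | ∃ (Q : Matrix ι κ ℂ) (R : Matrix ι μ ℂ), ((∀ i j, ‖Q i j‖ ≤ B) ∧ (∀ i j, ‖R i j‖ ≤ B)) ∧
    IsoU ε₁ ε₂ Q ∧ IsoU ε₁ ε₃ R ∧
    Dg x.1 * (Q * Dg x.2.1 * Qs ε₁ ε₂ Q) * (R * Dg x.2.2 * Qs ε₁ ε₃ R) = 1}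

theorem isCompact_bdd (B : ℝ) : IsCompact {Q : Matrix ι κ ℂ | ∀ i j, ‖Q i j‖ ≤ B} := by
  have h : IsCompact (Set.univ.pi fun _ : ι => Set.univ.pi fun _ : κ => Metric.closedBall (0 : ℂ) B) :=
    isCompact_univ_pi fun i => isCompact_univ_pi fun j => isCompact_closedBall 0 B
  have e : {Q : ι → κ → ℂ | ∀ i j, ‖Q i j‖ ≤ B} =
      (Set.univ.pi fun _ : ι => Set.univ.pi fun _ : κ => Metric.closedBall (0 : ℂ) B) := by
    ext Q; simp [Set.mem_pi]
  rw [← e] at h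
  exact h

theorem isClosed_HB (ε₁ : ι → ℝ) (ε₂ : κ → ℝ) (ε₃ : μ → ℝ) (B : ℝ) : IsClosed (HB ε₁ ε₂ ε₃ B) := by
  set K₁ := {Q : Matrix ι κ ℂ | ∀ i j, ‖Q i j‖ ≤ B}
  set K₂ := {Q : Matrix ι μ ℂ | ∀ i j, ‖Q i j‖ ≤ B}
  have : CompactSpace K₁ := isCompact_iff_compactSpace.1 (isCompact_bdd B)
  have : CompactSpace K₂ := isCompact_iff_compactSpace.1 (isCompact_bdd B)
  have h := isClosedMap_fst_of_compactSpace (X := (ι → ℝ) × (κ → ℝ) × (μ → ℝ)) (Y := K₁ × K₂)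
  have hcl : IsClosed {p : ((ι → ℝ) × (κ → ℝ) × (μ → ℝ)) × (K₁ × K₂) |
      IsoU ε₁ ε₂ p.2.1.1 ∧ IsoU ε₁ ε₃ p.2.2.1 ∧
      Dg p.1.1 * (p.2.1.1 * Dg p.1.2.1 * Qs ε₁ ε₂ p.2.1.1) *
        (p.2.2.1 * Dg p.1.2.2 * Qs ε₁ ε₃ p.2.2.1) = 1} := by
    have c1 : Continuous fun p : ((ι → ℝ) × (κ → ℝ) × (μ → ℝ)) × (K₁ × K₂) => Dg p.1.1 :=
      continuous_Dg.comp (by fun_prop)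
    have c2 : Continuous fun p : ((ι → ℝ) × (κ → ℝ) × (μ → ℝ)) × (K₁ × K₂) => Dg p.1.2.1 :=
      continuous_Dg.comp (by fun_prop)
    have c3 : Continuous fun p : ((ι → ℝ) × (κ → ℝ) × (μ → ℝ)) × (K₁ × K₂) => Dg p.1.2.2 :=
      continuous_Dg.comp (by fun_prop)
    have d1 : Continuous fun p : ((ι → ℝ) × (κ → ℝ) × (μ → ℝ)) × (K₁ × K₂) => p.2.1.1 := by
      fun_prop
    have d2 : Continuous fun p : ((ι → ℝ) × (κ → ℝ) × (μ → ℝ)) × (K₁ × K₂) => p.2.2.1 := by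
      fun_prop
    unfold IsoU Qs
    refine IsClosed.inter (IsClosed.inter ?_ ?_) (IsClosed.inter (IsClosed.inter ?_ ?_) ?_) <;>
    refine isClosed_eq ?_ ?_ <;> fun_prop
  have h2 := h _ hcl
  convert h2 using 1
  ext x
  constructor
  · rintro ⟨Q, R, ⟨hQ, hR⟩, h⟩
    exact ⟨(x, ⟨Q, hQ⟩, ⟨R, hR⟩), h, rfl⟩
  · rintro ⟨⟨x, ⟨Q, hQ⟩, ⟨R, hR⟩⟩, h, rfl⟩
    exact ⟨Q, R, ⟨hQ, hR⟩, h⟩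

/-- Regularity: distinct, differences less than `2π`. -/
def Reg (a : ι → ℝ) : Prop := ∀ i j, i ≠ j → a i ≠ a j ∧ |a i - a j| < 2 * π

theorem Reg.cos_lt {a : ι → ℝ} (h : Reg a) {i j : ι} (hij : i ≠ j) : Real.cos (a i - a j) < 1 := by
  refine lt_of_le_of_ne (Real.cos_le_one _) fun h1 => ?_
  obtain ⟨h2, h3⟩ := h i j hij
  rw [abs_lt] at h3
  exact h2 (sub_eq_zero.1 ((Real.cos_eq_one_iff_of_lt_of_lt h3.1 h3.2).1 h1))

theorem Reg.eventually_mar {a : ι → ℝ} (h : Reg a) :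
    ∃ δ : ℝ, 0 < δ ∧ δ ≤ 1 ∧ ∀ᶠ a' in nhds a, ∀ i j : ι, i ≠ j → δ ≤ 1 - Real.cos (a' i - a' j) := by
  have h1 : ∀ p : ι × ι, ∃ δ : ℝ, 0 < δ ∧ ∀ᶠ a' in nhds a, p.1 ≠ p.2 →
      δ ≤ 1 - Real.cos (a' p.1 - a' p.2) := by
    intro p
    by_cases hp : p.1 = p.2
    · exact ⟨1, one_pos, by simp [hp]⟩
    have hlt := h.cos_lt hp
    refine ⟨(1 - Real.cos (a p.1 - a p.2)) / 2, by linarith, ?_⟩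
    have hc : Continuous fun a' : ι → ℝ => 1 - Real.cos (a' p.1 - a' p.2) := by fun_prop
    have := hc.continuousAt.eventually (lt_mem_nhds (a := (1 - Real.cos (a p.1 - a p.2)) / 2)
      (b := 1 - Real.cos (a p.1 - a p.2)) (by linarith))
    filter_upwards [this] with a' ha' _ using ha'.le
  choose d hd hd' using h1
  have hne : (insert 1 (Finset.univ.image d)).Nonempty := ⟨1, by simp⟩
  refine ⟨(insert 1 (Finset.univ.image d)).min' hne, ?_, Finset.min'_le _ _ (by simp), ?_⟩
  · rw [Finset.lt_min'_iff]
    intro y hy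
    rcases Finset.mem_insert.1 hy with rfl | hy
    · exact one_pos
    · obtain ⟨p, _, rfl⟩ := Finset.mem_image.1 hy
      exact hd p
  · have := Filter.eventually_all.2 hd'
    filter_upwards [this] with a' ha' i j hij
    refine le_trans (Finset.min'_le _ _ ?_) (ha' (i, j) hij)
    exact Finset.mem_insert_of_mem (Finset.mem_image_of_mem d (Finset.mem_univ _))

theorem Mar.mono {δ δ' : ℝ} {a : ι → ℝ} (h : Mar δ a) (h' : δ' ≤ δ) : Mar δ' a :=
  fun i j hij => h'.trans (h i j hij)

theorem HS_closed {ε₁ : ι → ℝ} {ε₂ : κ → ℝ} {ε₃ : μ → ℝ} (h₁ : Sig ε₁) (h₂ : Sig ε₂) (h₃ : Sig ε₃)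
    (x : (ι → ℝ) × (κ → ℝ) × (μ → ℝ)) (hr1 : Reg x.1) (hr2 : Reg x.2.1) (hr3 : Reg x.2.2)
    (hx : x ∈ closure (HS ε₁ ε₂ ε₃)) : x ∈ HS ε₁ ε₂ ε₃ := by
  obtain ⟨d1, hd1, hd1', e1⟩ := hr1.eventually_mar
  obtain ⟨d2, hd2, hd2', e2⟩ := hr2.eventually_mar
  obtain ⟨d3, hd3, hd3', e3⟩ := hr3.eventually_mar
  set δ := min d1 (min d2 d3) with hδ
  have hδ0 : 0 < δ := lt_min hd1 (lt_min hd2 hd3)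
  have hδ1 : δ ≤ 1 := (min_le_left _ _).trans hd1'
  have f1 := (continuous_fst.tendsto x).eventually e1
  have f2 := ((continuous_fst.comp continuous_snd).tendsto x).eventually e2
  have f3 := ((continuous_snd.comp continuous_snd).tendsto x).eventually e3
  have key : ∀ᶠ y in nhds x, y ∈ HS ε₁ ε₂ ε₃ → y ∈ HB ε₁ ε₂ ε₃ (1 + 4 / δ) := by
    filter_upwards [f1, f2, f3] with y g1 g2 g3
    rintro ⟨Q, R, hQ, hR, heq⟩
    exact ⟨Q, R, sol_bound h₁ h₂ h₃ hQ hR heq hδ0 hδ1 (Mar.mono g1 (min_le_left _ _))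
      (Mar.mono g2 ((min_le_right _ _).trans (min_le_left _ _)))
      (Mar.mono g3 ((min_le_right _ _).trans (min_le_right _ _))), hQ, hR, heq⟩
  have hB : x ∈ HB ε₁ ε₂ ε₃ (1 + 4 / δ) := by
    rw [← (isClosed_HB ε₁ ε₂ ε₃ (1 + 4 / δ)).closure_eq]
    rw [mem_closure_iff_frequently] at hx ⊢
    exact hx.mp key
  obtain ⟨Q, R, _, h⟩ := hB
  exact ⟨Q, R, h⟩

end
end Horn

namespace Horn

section
variable {ι κ μ : Type} [Fintype ι] [DecidableEq ι] [Fintype κ] [DecidableEq κ]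
  [Fintype μ] [DecidableEq μ]

/-! ### The involution and the infinitesimal computation -/

theorem Qs_self_mul {ε : ι → ℝ} (h : Sgn ε) (M N : Matrix ι ι ℂ) :
    Qs ε ε (M * N) = Qs ε ε N * Qs ε ε M := by
  unfold Qs
  rw [Matrix.conjTranspose_mul]
  calc _ = Jd ε * Nᴴ * 1 * Mᴴ * Jd ε := by simp only [Matrix.mul_assoc, Matrix.one_mul]
    _ = _ := by rw [← Jd_mul_Jd h]; simp only [Matrix.mul_assoc]

theorem Qs_Qs {ε : ι → ℝ} (h : Sgn ε) (M : Matrix ι ι ℂ) : Qs ε ε (Qs ε ε M) = M := by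
  unfold Qs
  simp only [Matrix.conjTranspose_mul, Jd_conjTranspose, Matrix.conjTranspose_conjTranspose]
  calc _ = (Jd ε * Jd ε) * M * (Jd ε * Jd ε) := by simp only [Matrix.mul_assoc]
    _ = M := by rw [Jd_mul_Jd h]; simp

theorem Qs_one {ε : ι → ℝ} (h : Sgn ε) : Qs ε ε (1 : Matrix ι ι ℂ) = 1 := by
  unfold Qs; simp [Jd_mul_Jd h]

theorem Qs_smul_one {ε : ι → ℝ} (h : Sgn ε) (z : ℂ) :
    Qs ε ε (z • (1 : Matrix ι ι ℂ)) = star z • 1 := by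
  unfold Qs; simp [Jd_mul_Jd h]

theorem trace_Qs {ε : ι → ℝ} (h : Sgn ε) (M : Matrix ι ι ℂ) :
    (Qs ε ε M).trace = star M.trace := by
  unfold Qs
  rw [Matrix.trace_mul_comm, ← Matrix.mul_assoc, Jd_mul_Jd h, Matrix.one_mul,
    Matrix.trace_conjTranspose]

def SL' (ε : ι → ℝ) : Matrix ι ι ℂ →ₗ[ℝ] Matrix ι ι ℂ where
  toFun := Qs ε ε
  map_add' M N := by unfold Qs; simp [Matrix.mul_add, Matrix.add_mul]
  map_smul' r M := by unfold Qs; simp [Matrix.conjTranspose_smul]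

/-- Projection to the Lie algebra. -/
def sk (ε : ι → ℝ) : Matrix ι ι ℂ →ₗ[ℝ] Matrix ι ι ℂ :=
  (1 / 2 : ℝ) • (LinearMap.id - SL' ε)

theorem sk_apply (ε : ι → ℝ) (M : Matrix ι ι ℂ) : sk ε M = (1 / 2 : ℝ) • (M - Qs ε ε M) := rfl

theorem Qs_sk {ε : ι → ℝ} (h : Sgn ε) (M : Matrix ι ι ℂ) : Qs ε ε (sk ε M) = - sk ε M := by
  change SL' ε (sk ε M) = _
  rw [sk_apply, map_smul, map_sub]
  change (1 / 2 : ℝ) • (Qs ε ε M - Qs ε ε (Qs ε ε M)) = _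
  rw [Qs_Qs h, ← smul_neg, neg_sub]

theorem sk_of_skew {ε : ι → ℝ} {M : Matrix ι ι ℂ} (hM : Qs ε ε M = -M) : sk ε M = M := by
  rw [sk_apply, hM, sub_neg_eq_add, ← two_smul ℝ M, smul_smul]; norm_num

theorem trace_sk {ε : ι → ℝ} (h : Sgn ε) (M : Matrix ι ι ℂ) :
    (sk ε M).trace = (M.trace.im : ℂ) * Complex.I := by
  rw [sk_apply, Matrix.trace_smul, Matrix.trace_sub, trace_Qs h]
  apply Complex.ext <;> simp
  ring

/-- Projection to the trace-free part of the Lie algebra. -/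
def pT (ε : ι → ℝ) : Matrix ι ι ℂ →ₗ[ℝ] Matrix ι ι ℂ where
  toFun M := sk ε M - ((sk ε M).trace / (Fintype.card ι : ℂ)) • (1 : Matrix ι ι ℂ)
  map_add' M N := by
    rw [map_add, Matrix.trace_add, add_div, add_smul]; abel
  map_smul' r M := by
    rw [map_smul, Matrix.trace_smul, RingHom.id_apply, smul_sub, ← smul_assoc]
    congr 3
    rw [Complex.real_smul, Complex.real_smul, mul_div_assoc]

theorem pT_apply (ε : ι → ℝ) (M : Matrix ι ι ℂ) :
    pT ε M = sk ε M - ((sk ε M).trace / (Fintype.card ι : ℂ)) • (1 : Matrix ι ι ℂ) := rfl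

theorem Qs_pT {ε : ι → ℝ} (h : Sgn ε) (M : Matrix ι ι ℂ) : Qs ε ε (pT ε M) = - pT ε M := by
  have h1 : Qs ε ε (pT ε M) = Qs ε ε (sk ε M) -
      Qs ε ε (((sk ε M).trace / (Fintype.card ι : ℂ)) • (1 : Matrix ι ι ℂ)) :=
    map_sub (SL' ε) _ _
  rw [h1, Qs_sk h, Qs_smul_one h, pT_apply, trace_sk h]
  have : star ((M.trace.im : ℂ) * Complex.I / (Fintype.card ι : ℂ)) =
    -((M.trace.im : ℂ) * Complex.I / (Fintype.card ι : ℂ)) := by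
    simp [neg_div]
  rw [this, neg_smul]; abel

theorem trace_pT [Nonempty ι] (ε : ι → ℝ) (M : Matrix ι ι ℂ) : (pT ε M).trace = 0 := by
  have : (Fintype.card ι : ℂ) ≠ 0 := by exact_mod_cast Fintype.card_ne_zero
  rw [pT_apply, Matrix.trace_sub, Matrix.trace_smul, Matrix.trace_one, smul_eq_mul,
    div_mul_cancel₀ _ this, sub_self]

theorem pT_of {ε : ι → ℝ} {M : Matrix ι ι ℂ} (hM : Qs ε ε M = -M) (ht : M.trace = 0) :
    pT ε M = M := by
  rw [pT_apply, sk_of_skew hM, ht, zero_div, zero_smul, sub_zero]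

theorem pT_pT [Nonempty ι] {ε : ι → ℝ} (h : Sgn ε) (M : Matrix ι ι ℂ) :
    pT ε (pT ε M) = pT ε M := pT_of (Qs_pT h M) (trace_pT ε M)

theorem exists_trace_rep (f : Matrix ι ι ℂ →ₗ[ℂ] ℂ) :
    ∃ Z : Matrix ι ι ℂ, ∀ M, f M = (Z * M).trace := by
  refine ⟨Matrix.of fun j i => f (Matrix.single i j 1), fun M => ?_⟩
  conv_lhs => rw [Matrix.matrix_eq_sum_single M]
  rw [map_sum, Matrix.trace]
  simp only [Matrix.diag_apply, Matrix.mul_apply, Matrix.of_apply, map_sum]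
  rw [Finset.sum_comm]
  refine Finset.sum_congr rfl fun j _ => Finset.sum_congr rfl fun i _ => ?_
  have : Matrix.single i j (M i j) = (M i j) • Matrix.single i j (1 : ℂ) := by
    rw [Matrix.smul_single]; simp
  rw [this, map_smul, smul_eq_mul, mul_comm]

theorem trace_ext {Y Z : Matrix ι ι ℂ} (h : ∀ X, (Y * X).trace = (Z * X).trace) : Y = Z := by
  ext i j
  have := h (Matrix.single j i 1)
  simpa [Matrix.trace_mul_single] using this

/-- Infinitesimal map. -/
def LL (A A' P P' : Matrix ι ι ℂ) : Matrix ι ι ℂ × Matrix ι ι ℂ →ₗ[ℂ] Matrix ι ι ℂ where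
  toFun p := A * p.1 * A' - P * p.1 * P' + (P * p.2 * P' - p.2)
  map_add' p q := by
    simp only [Prod.fst_add, Prod.snd_add, Matrix.mul_add, Matrix.add_mul]; abel
  map_smul' r p := by
    simp [smul_sub, smul_add]

theorem LL_surj {A A' P P' : Matrix ι ι ℂ} (hA : A * A' = 1) (hP : P * P' = 1)
    (hirr : ∀ Z : Matrix ι ι ℂ, Z * A = A * Z → Z * P = P * Z → ∃ z : ℂ, Z = z • 1)
    (M : Matrix ι ι ℂ) (hM : M.trace = 0) : ∃ p, LL A A' P P' p = M := by
  by_contra hcon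
  have hA' : A' * A = 1 := mul_eq_one_comm.1 hA
  have hP' : P' * P = 1 := mul_eq_one_comm.1 hP
  have hnot : M ∉ LinearMap.range (LL A A' P P') := fun ⟨p, hp⟩ => hcon ⟨p, hp⟩
  obtain ⟨f, hf, hle⟩ := Submodule.exists_le_ker_of_notMem hnot
  obtain ⟨Z, hZ⟩ := exists_trace_rep f
  have hz : ∀ p, f (LL A A' P P' p) = 0 := fun p => hle ⟨p, rfl⟩
  have h2 : P' * Z * P = Z := by
    refine trace_ext fun Y => ?_
    have := hz (0, Y)
    rw [hZ] at this
    simp only [LL, LinearMap.coe_mk, AddHom.coe_mk, Matrix.mul_zero, Matrix.zero_mul, sub_self,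
      zero_add, Matrix.mul_sub, Matrix.trace_sub, sub_eq_zero] at this
    rw [← this, Matrix.mul_assoc, Matrix.mul_assoc, Matrix.trace_mul_comm]
    simp only [Matrix.mul_assoc]
  have h1 : A' * Z * A = P' * Z * P := by
    refine trace_ext fun Y => ?_
    have := hz (Y, 0)
    rw [hZ] at this
    simp only [LL, LinearMap.coe_mk, AddHom.coe_mk, Matrix.mul_zero, Matrix.zero_mul, sub_self,
      add_zero, Matrix.mul_sub, Matrix.trace_sub, sub_eq_zero] at this
    rw [Matrix.mul_assoc, Matrix.mul_assoc, Matrix.trace_mul_comm, Matrix.mul_assoc P',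
      Matrix.mul_assoc P', Matrix.trace_mul_comm P']
    simpa only [Matrix.mul_assoc] using this
  rw [h2] at h1
  have c1 : Z * A = A * Z := by
    calc Z * A = (A * A') * Z * A := by rw [hA, Matrix.one_mul]
      _ = A * (A' * Z * A) := by simp only [Matrix.mul_assoc]
      _ = _ := by rw [h1]
  have c2 : Z * P = P * Z := by
    calc Z * P = (P * P') * Z * P := by rw [hP, Matrix.one_mul]
      _ = P * (P' * Z * P) := by simp only [Matrix.mul_assoc]
      _ = _ := by rw [h2]
  obtain ⟨z, rfl⟩ := hirr Z c1 c2
  apply hf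
  rw [hZ, Matrix.smul_mul, Matrix.one_mul, Matrix.trace_smul, hM, smul_zero]

theorem LL_surj_real {ε : ι → ℝ} (h : Sgn ε) {A P : Matrix ι ι ℂ}
    (hA : A * Qs ε ε A = 1) (hP : P * Qs ε ε P = 1)
    (hirr : ∀ Z : Matrix ι ι ℂ, Z * A = A * Z → Z * P = P * Z → ∃ z : ℂ, Z = z • 1)
    (M : Matrix ι ι ℂ) (hM : M.trace = 0) (hs : Qs ε ε M = -M) :
    ∃ X Y : Matrix ι ι ℂ, LL A (Qs ε ε A) P (Qs ε ε P) (sk ε X, sk ε Y) = M := by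
  obtain ⟨⟨X, Y⟩, hp⟩ := LL_surj hA hP hirr M hM
  refine ⟨X, Y, ?_⟩
  have key : LL A (Qs ε ε A) P (Qs ε ε P) (Qs ε ε X, Qs ε ε Y) = Qs ε ε M := by
    rw [← hp]
    simp only [LL, LinearMap.coe_mk, AddHom.coe_mk]
    change _ = SL' ε _
    simp only [map_add, map_sub]
    simp only [SL', LinearMap.coe_mk, AddHom.coe_mk, Qs_self_mul h, Qs_Qs h, Matrix.mul_assoc]
  have e : ((sk ε X, sk ε Y) : Matrix ι ι ℂ × Matrix ι ι ℂ) =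
      (1 / 2 : ℝ) • ((X, Y) - (Qs ε ε X, Qs ε ε Y)) := rfl
  have e2 : ∀ p : Matrix ι ι ℂ × Matrix ι ι ℂ, (1 / 2 : ℝ) • p = (1 / 2 : ℂ) • p := by
    intro p
    have : ((1 / 2 : ℝ) : ℂ) = 1 / 2 := by push_cast; rfl
    rw [← this, Complex.coe_smul]
  rw [e, e2, map_smul, map_sub, key, hp, hs, sub_neg_eq_add, ← two_smul ℂ M, smul_smul]
  norm_num

end
end Horn

namespace Horn

section
variable {ι κ μ : Type} [Fintype ι] [DecidableEq ι] [Fintype κ] [DecidableEq κ]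
  [Fintype μ] [DecidableEq μ]

attribute [local instance] Matrix.linftyOpNormedAddCommGroup Matrix.linftyOpNormedSpace
  Matrix.linftyOpNormedRing Matrix.linftyOpNormedAlgebra

theorem exp_sk_props {ε : ι → ℝ} (h : Sgn ε) (X : Matrix ι ι ℂ) :
    Qs ε ε (NormedSpace.exp (sk ε X)) = NormedSpace.exp (-(sk ε X)) ∧
    NormedSpace.exp (sk ε X) * NormedSpace.exp (-(sk ε X)) = 1 ∧
    NormedSpace.exp (-(sk ε X)) * NormedSpace.exp (sk ε X) = 1 := by
  have hJ : (Jd ε)⁻¹ = Jd ε := Matrix.inv_eq_right_inv (Jd_mul_Jd h)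
  have hu : IsUnit (Jd ε) := IsUnit.of_mul_eq_one _ (Jd_mul_Jd h)
  have h2 : NormedSpace.exp (sk ε X) * NormedSpace.exp (-(sk ε X)) = 1 := by
    rw [← Matrix.exp_add_of_commute _ _ (Commute.neg_right (Commute.refl (sk ε X))), add_neg_cancel,
      NormedSpace.exp_zero]
  refine ⟨?_, h2, mul_eq_one_comm.1 h2⟩
  rw [← Qs_sk h, Qs, Qs, ← Matrix.exp_conjTranspose]
  have := Matrix.exp_conj (Jd ε) ((sk ε X)ᴴ) hu
  rw [hJ] at this
  exact this.symm

theorem IsoU.mul_left {ε₁ : ι → ℝ} {ε₂ : κ → ℝ} (h₁ : Sgn ε₁) (h₂ : Sgn ε₂)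
    {Q : Matrix ι κ ℂ} (hQ : IsoU ε₁ ε₂ Q) {g : Matrix ι ι ℂ} (hg : g * Qs ε₁ ε₁ g = 1) :
    IsoU ε₁ ε₂ (g * Q) ∧ Qs ε₁ ε₂ (g * Q) = Qs ε₁ ε₂ Q * Qs ε₁ ε₁ g := by
  have hg' : Qs ε₁ ε₁ g * g = 1 := mul_eq_one_comm.1 hg
  have hq : Qs ε₁ ε₂ (g * Q) = Qs ε₁ ε₂ Q * Qs ε₁ ε₁ g := by
    unfold Qs
    rw [Matrix.conjTranspose_mul]
    calc _ = Jd ε₂ * Qᴴ * (1 : Matrix ι ι ℂ) * gᴴ * Jd ε₁ := by simp only [Matrix.mul_assoc, Matrix.one_mul]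
      _ = _ := by rw [← Jd_mul_Jd h₁]; simp only [Matrix.mul_assoc]
  have r1 : Qs ε₁ ε₂ (g * Q) * (g * Q) = 1 := by
    rw [hq]
    calc _ = Qs ε₁ ε₂ Q * (Qs ε₁ ε₁ g * g) * Q := by simp only [Matrix.mul_assoc]
      _ = 1 := by rw [hg', Matrix.mul_one, hQ.Qs_mul h₂]
  have r2 : (g * Q) * Qs ε₁ ε₂ (g * Q) = 1 := by
    rw [hq]
    calc _ = g * (Q * Qs ε₁ ε₂ Q) * Qs ε₁ ε₁ g := by simp only [Matrix.mul_assoc]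
      _ = 1 := by rw [hQ.mul_Qs h₁, Matrix.mul_one, hg]
  refine ⟨⟨?_, ?_⟩, hq⟩
  · calc _ = (Jd ε₂ * Jd ε₂) * ((g * Q)ᴴ * Jd ε₁ * (g * Q)) := by rw [Jd_mul_Jd h₂, Matrix.one_mul]
      _ = Jd ε₂ * (Qs ε₁ ε₂ (g * Q) * (g * Q)) := by unfold Qs; simp only [Matrix.mul_assoc]
      _ = _ := by rw [r1, Matrix.mul_one]
  · calc _ = ((g * Q) * Jd ε₂ * (g * Q)ᴴ) * (Jd ε₁ * Jd ε₁) := by rw [Jd_mul_Jd h₁, Matrix.mul_one]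
      _ = ((g * Q) * Qs ε₁ ε₂ (g * Q)) * Jd ε₁ := by unfold Qs; simp only [Matrix.mul_assoc]
      _ = _ := by rw [r2, Matrix.one_mul]

theorem quad_scalar {W : Matrix ι ι ℂ} (hW : ‖W - 1‖ * ‖(1 : Matrix ι ι ℂ)‖ < 1 / 2) (s : ℂ)
    (h : W * W - s • W = 1) : ∃ w : ℂ, W = w • 1 := by
  obtain ⟨r, hr⟩ : ∃ r : ℂ, 1 * (r * r) + (-s) * r + (-1) = 0 :=
    exists_quadratic_eq_zero one_ne_zero (IsAlgClosed.exists_eq_mul_self _)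
  have hspec : ∀ k : ℂ, ¬ IsUnit (algebraMap ℂ (Matrix ι ι ℂ) k - W) → ‖k - 1‖ < 1 / 2 := by
    intro k hk
    rw [← spectrum.mem_iff] at hk
    have h1 : (k - 1) + 1 ∈ spectrum ℂ (algebraMap ℂ (Matrix ι ι ℂ) 1 + (W - 1)) := by
      rw [map_one, sub_add_cancel, add_sub_cancel]; exact hk
    rw [spectrum.add_mem_add_iff] at h1
    exact (spectrum.norm_le_norm_mul_of_mem h1).trans_lt hW
  have hprod : (algebraMap ℂ (Matrix ι ι ℂ) r - W) * (algebraMap ℂ (Matrix ι ι ℂ) (s - r) - W) = 0 := by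
    rw [Algebra.algebraMap_eq_smul_one, Algebra.algebraMap_eq_smul_one]
    have e : (r • (1 : Matrix ι ι ℂ) - W) * ((s - r) • 1 - W) =
        (r * (s - r)) • (1 : Matrix ι ι ℂ) + (W * W - s • W) := by
      simp only [sub_mul, mul_sub, smul_mul_assoc, mul_smul_comm, one_mul, mul_one, smul_smul,
        sub_smul, smul_sub, mul_comm s r]
      abel
    have e2 : r * (s - r) = -1 := by linear_combination -hr
    rw [e, h, e2]; simp
  by_cases u1 : IsUnit (algebraMap ℂ (Matrix ι ι ℂ) r - W)
  · refine ⟨s - r, ?_⟩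
    have := (u1.mul_right_eq_zero).1 hprod
    rw [sub_eq_zero, Algebra.algebraMap_eq_smul_one] at this
    exact this.symm
  by_cases u2 : IsUnit (algebraMap ℂ (Matrix ι ι ℂ) (s - r) - W)
  · refine ⟨r, ?_⟩
    have := (u2.mul_left_eq_zero).1 hprod
    rw [sub_eq_zero, Algebra.algebraMap_eq_smul_one] at this
    exact this.symm
  exfalso
  have n1 := hspec r u1
  have n2 := hspec _ u2
  have e3 : (2 : ℂ) = -((r - 1) + (s - r - 1) + (r - 1) * (s - r - 1)) := by
    linear_combination -hr
  have e4 : ‖(2 : ℂ)‖ ≤ ‖r - 1‖ + ‖s - r - 1‖ + ‖r - 1‖ * ‖s - r - 1‖ := by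
    conv_lhs => rw [e3]
    rw [norm_neg, ← norm_mul]
    exact (norm_add_le _ _).trans (add_le_add_left (norm_add_le _ _) _)
  have e5 : ‖(2 : ℂ)‖ = 2 := by simp
  rw [e5] at e4
  nlinarith [norm_nonneg (r - 1), norm_nonneg (s - r - 1)]

theorem near_one [Nonempty ι] (ε : ι → ℝ) : ∀ᶠ W in nhds (1 : Matrix ι ι ℂ),
    W * Qs ε ε W = 1 → pT ε W = 0 → W.det = 1 → W = 1 := by
  have hcard : (Fintype.card ι : ℂ) ≠ 0 := by exact_mod_cast Fintype.card_ne_zero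
  have c1 : ∀ᶠ W in nhds (1 : Matrix ι ι ℂ), ‖W - 1‖ * ‖(1 : Matrix ι ι ℂ)‖ < 1 / 2 := by
    have hc : Continuous fun W : Matrix ι ι ℂ => ‖W - 1‖ * ‖(1 : Matrix ι ι ℂ)‖ := by fun_prop
    exact hc.continuousAt.eventually (gt_mem_nhds (by simp))
  have c2 : ∀ᶠ W in nhds (1 : Matrix ι ι ℂ), (W.trace / (Fintype.card ι : ℂ)) ^ (Fintype.card ι) = 1 →
      (W.trace / (Fintype.card ι : ℂ)) = 1 := by
    have hd : HasDerivAt (fun z : ℂ => z ^ Fintype.card ι)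
        ((Fintype.card ι : ℂ) * 1 ^ (Fintype.card ι - 1)) 1 := hasDerivAt_pow _ _
    have he := hd.eventually_ne (c := 1) (by simpa using hcard)
    rw [eventually_nhdsWithin_iff] at he
    have hc : Continuous fun W : Matrix ι ι ℂ => W.trace / (Fintype.card ι : ℂ) := by
      refine Continuous.div_const ?_ _
      exact Continuous.matrix_trace continuous_id
    have h1 : (1 : Matrix ι ι ℂ).trace / (Fintype.card ι : ℂ) = 1 := by
      rw [Matrix.trace_one, div_self hcard]
    have h2 := hc.tendsto (1 : Matrix ι ι ℂ)
    rw [h1] at h2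
    filter_upwards [h2.eventually he] with W hW h3
    by_contra h4
    exact hW h4 h3
  filter_upwards [c1, c2] with W h1 h2 hU hp hdet
  have e1 : W - Qs ε ε W = (2 * ((sk ε W).trace / (Fintype.card ι : ℂ))) • (1 : Matrix ι ι ℂ) := by
    rw [pT_apply, sub_eq_zero] at hp
    rw [mul_smul, ← hp, sk_apply]
    have : (2 : ℂ) • (1 / 2 : ℝ) • (W - Qs ε ε W) = (2 : ℝ) • (1 / 2 : ℝ) • (W - Qs ε ε W) := by
      have : ((2 : ℝ) : ℂ) = 2 := by push_cast; rfl
      rw [← this, Complex.coe_smul]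
    rw [this, smul_smul]; norm_num
  obtain ⟨w, hw⟩ := quad_scalar h1 (2 * ((sk ε W).trace / (Fintype.card ι : ℂ))) (by
    have := congrArg (fun M => W * M) e1
    simp only [Matrix.mul_sub, hU, Matrix.mul_smul, Matrix.mul_one] at this
    rw [← this]; abel)
  have e2 : W.trace / (Fintype.card ι : ℂ) = w := by
    rw [hw, Matrix.trace_smul, Matrix.trace_one, smul_eq_mul, mul_div_assoc, div_self hcard, mul_one]
  rw [e2] at h2
  rw [hw, Matrix.det_smul, Matrix.det_one, mul_one] at hdet
  rw [hw, h2 hdet, one_smul]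

theorem contDiff_Dg : ContDiff ℝ 1 (Dg : (ι → ℝ) → Matrix ι ι ℂ) := by
  have h1 : ContDiff ℝ 1 (fun a : ι → ℝ => fun i => Complex.exp ((a i : ℂ) * Complex.I)) := by
    rw [contDiff_pi]
    intro i
    have : ContDiff ℝ 1 (fun a : ι → ℝ => ((a i : ℝ) : ℂ)) :=
      Complex.ofRealCLM.contDiff.comp (contDiff_apply ℝ ℝ i)
    exact (this.mul contDiff_const).cexp
  exact (LinearMap.toContinuousLinearMap (Matrix.diagonalLinearMap ι ℝ ℂ)).contDiff.comp h1

theorem contDiff_expM : ContDiff ℝ 1 (NormedSpace.exp : Matrix ι ι ℂ → Matrix ι ι ℂ) := by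
  rw [contDiff_iff_contDiffAt]
  intro x
  exact (NormedSpace.exp_analytic (𝕂 := ℝ) x).contDiffAt

theorem Dg_comm_Jd (ε a : ι → ℝ) : Dg a * Jd ε = Jd ε * Dg a := by
  unfold Dg Jd
  rw [Matrix.diagonal_mul_diagonal, Matrix.diagonal_mul_diagonal]
  congr 1; funext i; ring

theorem Qs_Dg {ε : ι → ℝ} (h : Sgn ε) (a : ι → ℝ) : Qs ε ε (Dg a) = Dg (-a) := by
  unfold Qs
  rw [Dg_conjTranspose, ← Dg_comm_Jd, Matrix.mul_assoc, Jd_mul_Jd h, Matrix.mul_one]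

theorem Qs_conj {ε₁ : ι → ℝ} {ε₂ : κ → ℝ} (h₁ : Sgn ε₁) (Q : Matrix ι κ ℂ) (b : κ → ℝ) :
    Qs ε₁ ε₁ (Q * Dg b * Qs ε₁ ε₂ Q) = Q * Dg (-b) * Qs ε₁ ε₂ Q := by
  unfold Qs
  simp only [Matrix.conjTranspose_mul, Jd_conjTranspose, Matrix.conjTranspose_conjTranspose,
    Dg_conjTranspose]
  calc _ = (Jd ε₁ * Jd ε₁) * Q * (Jd ε₂ * Dg (-b)) * Qᴴ * Jd ε₁ := by simp only [Matrix.mul_assoc]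
    _ = _ := by rw [Jd_mul_Jd h₁, Matrix.one_mul, ← Dg_comm_Jd]; simp only [Matrix.mul_assoc]

theorem un_conj {ε₁ : ι → ℝ} {ε₂ : κ → ℝ} (h₁ : Sgn ε₁) (h₂ : Sgn ε₂) {Q : Matrix ι κ ℂ}
    (hQ : IsoU ε₁ ε₂ Q) (b : κ → ℝ) :
    (Q * Dg b * Qs ε₁ ε₂ Q) * Qs ε₁ ε₁ (Q * Dg b * Qs ε₁ ε₂ Q) = 1 := by
  rw [Qs_conj h₁]
  calc _ = Q * (Dg b * (Qs ε₁ ε₂ Q * Q) * Dg (-b)) * Qs ε₁ ε₂ Q := by simp only [Matrix.mul_assoc]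
    _ = 1 := by rw [hQ.Qs_mul h₂, Matrix.mul_one, Dg_mul_neg, Matrix.mul_one, hQ.mul_Qs h₁]

theorem un_mul {ε : ι → ℝ} (h : Sgn ε) {M N : Matrix ι ι ℂ} (hM : M * Qs ε ε M = 1)
    (hN : N * Qs ε ε N = 1) : (M * N) * Qs ε ε (M * N) = 1 := by
  rw [Qs_self_mul h]
  calc _ = M * (N * Qs ε ε N) * Qs ε ε M := by simp only [Matrix.mul_assoc]
    _ = 1 := by rw [hN, Matrix.mul_one, hM]

theorem un_Dg {ε : ι → ℝ} (h : Sgn ε) (a : ι → ℝ) : Dg a * Qs ε ε (Dg a) = 1 := by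
  rw [Qs_Dg h, Dg_mul_neg]

/-- Sum of all the angles. -/
def sm (x : (ι → ℝ) × (κ → ℝ) × (μ → ℝ)) : ℝ := ∑ i, x.1 i + ∑ j, x.2.1 j + ∑ k, x.2.2 k

theorem det_Dg (a : ι → ℝ) : (Dg a).det = Complex.exp (((∑ i, a i : ℝ) : ℂ) * Complex.I) := by
  unfold Dg
  rw [Matrix.det_diagonal, ← Complex.exp_sum, ← Finset.sum_mul]
  push_cast; rfl

theorem det_sol {ε₁ : ι → ℝ} {ε₂ : κ → ℝ} {ε₃ : μ → ℝ} (h₁ : Sgn ε₁) (h₂ : Sgn ε₂) (h₃ : Sgn ε₃)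
    {Q : Matrix ι κ ℂ} {R : Matrix ι μ ℂ} (hQ : IsoU ε₁ ε₂ Q) (hR : IsoU ε₁ ε₃ R)
    (x : (ι → ℝ) × (κ → ℝ) × (μ → ℝ)) :
    (Dg x.1 * (Q * Dg x.2.1 * Qs ε₁ ε₂ Q) * (R * Dg x.2.2 * Qs ε₁ ε₃ R)).det =
      Complex.exp ((sm x : ℂ) * Complex.I) := by
  rw [Matrix.det_mul, Matrix.det_mul,
    Matrix.det_conj_of_mul_eq_one (hQ.mul_Qs h₁) (hQ.Qs_mul h₂),
    Matrix.det_conj_of_mul_eq_one (hR.mul_Qs h₁) (hR.Qs_mul h₃), det_Dg, det_Dg, det_Dg,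
    ← Complex.exp_add, ← Complex.exp_add]
  congr 1; unfold sm; push_cast; ring

end
end Horn

namespace Horn

section
variable {ι κ μ : Type} [Fintype ι] [DecidableEq ι] [Fintype κ] [DecidableEq κ]
  [Fintype μ] [DecidableEq μ]

attribute [local instance] Matrix.linftyOpNormedAddCommGroup Matrix.linftyOpNormedSpace
  Matrix.linftyOpNormedRing Matrix.linftyOpNormedAlgebra

/-- The deformed product. -/
def Wm (ε₁ : ι → ℝ) (ε₂ : κ → ℝ) (ε₃ : μ → ℝ) (Q : Matrix ι κ ℂ) (R : Matrix ι μ ℂ)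
    (p : Matrix ι ι ℂ × Matrix ι ι ℂ × Matrix ι ι ℂ × ((ι → ℝ) × (κ → ℝ) × (μ → ℝ))) :
    Matrix ι ι ℂ :=
  Dg p.2.2.2.1 * (NormedSpace.exp (sk ε₁ p.1) * (Q * Dg p.2.2.2.2.1 * Qs ε₁ ε₂ Q) *
    NormedSpace.exp (-(sk ε₁ p.1))) * (NormedSpace.exp (sk ε₁ p.2.1) *
    (R * Dg p.2.2.2.2.2 * Qs ε₁ ε₃ R) * NormedSpace.exp (-(sk ε₁ p.2.1)))

theorem contDiff_mul_const {l m n : Type} [Fintype l] [Fintype m] [Fintype n] [DecidableEq l]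
    [DecidableEq m] [DecidableEq n] (Q : Matrix l m ℂ) (R : Matrix m l ℂ) :
    ContDiff ℝ 1 (fun M : Matrix m m ℂ => Q * M * R) := by
  let f : Matrix m m ℂ →ₗ[ℝ] Matrix l l ℂ :=
    { toFun := fun M => Q * M * R
      map_add' := fun a b => by rw [Matrix.mul_add, Matrix.add_mul]
      map_smul' := fun a b => by rw [Matrix.mul_smul, Matrix.smul_mul]; rfl }
  exact (LinearMap.toContinuousLinearMap f).contDiff

theorem contDiff_Wm (ε₁ : ι → ℝ) (ε₂ : κ → ℝ) (ε₃ : μ → ℝ) (Q : Matrix ι κ ℂ)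
    (R : Matrix ι μ ℂ) : ContDiff ℝ 1 (Wm ε₁ ε₂ ε₃ Q R) := by
  have hs : ContDiff ℝ 1 (sk ε₁) := (LinearMap.toContinuousLinearMap (sk ε₁)).contDiff
  unfold Wm
  have e1 := contDiff_expM.comp (hs.comp (contDiff_fst (E := Matrix ι ι ℂ)
    (F := Matrix ι ι ℂ × Matrix ι ι ℂ × ((ι → ℝ) × (κ → ℝ) × (μ → ℝ)))))
  have e1' := contDiff_expM.comp (hs.comp (contDiff_fst (E := Matrix ι ι ℂ)
    (F := Matrix ι ι ℂ × Matrix ι ι ℂ × ((ι → ℝ) × (κ → ℝ) × (μ → ℝ))))).neg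
  have p2 : ContDiff ℝ 1 (fun p : Matrix ι ι ℂ × Matrix ι ι ℂ × Matrix ι ι ℂ ×
      ((ι → ℝ) × (κ → ℝ) × (μ → ℝ)) => p.2.1) := by fun_prop
  have e2 := contDiff_expM.comp (hs.comp p2)
  have e2' := contDiff_expM.comp (hs.comp p2).neg
  have pa : ContDiff ℝ 1 (fun p : Matrix ι ι ℂ × Matrix ι ι ℂ × Matrix ι ι ℂ ×
      ((ι → ℝ) × (κ → ℝ) × (μ → ℝ)) => p.2.2.2.1) := by fun_prop
  have pb : ContDiff ℝ 1 (fun p : Matrix ι ι ℂ × Matrix ι ι ℂ × Matrix ι ι ℂ ×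
      ((ι → ℝ) × (κ → ℝ) × (μ → ℝ)) => p.2.2.2.2.1) := by fun_prop
  have pc : ContDiff ℝ 1 (fun p : Matrix ι ι ℂ × Matrix ι ι ℂ × Matrix ι ι ℂ ×
      ((ι → ℝ) × (κ → ℝ) × (μ → ℝ)) => p.2.2.2.2.2) := by fun_prop
  have fa := contDiff_Dg.comp pa
  have fb := (contDiff_mul_const (n := ι) Q (Qs ε₁ ε₂ Q)).comp (contDiff_Dg.comp pb)
  have fc := (contDiff_mul_const (n := ι) R (Qs ε₁ ε₃ R)).comp (contDiff_Dg.comp pc)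
  exact (fa.mul ((e1.mul fb).mul e1')).mul ((e2.mul fc).mul e2')

theorem hasDerivAt_conj (S B : Matrix ι ι ℂ) :
    HasDerivAt (fun t : ℝ => NormedSpace.exp (t • S) * B * NormedSpace.exp (-(t • S)))
      (S * B - B * S) 0 := by
  have h1 : HasDerivAt (fun t : ℝ => NormedSpace.exp (t • S)) S 0 := by
    have := hasDerivAt_exp_smul_const (𝕂 := ℝ) S (0 : ℝ)
    simp only [zero_smul, NormedSpace.exp_zero, one_mul] at this
    exact this
  have h2 : HasDerivAt (fun t : ℝ => NormedSpace.exp (-(t • S))) (-S) 0 := by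
    have := hasDerivAt_exp_smul_const (𝕂 := ℝ) (-S) (0 : ℝ)
    simp only [zero_smul, smul_neg, neg_zero, NormedSpace.exp_zero, one_mul] at this
    exact this
  have h := (h1.mul_const B).mul h2
  refine h.congr_deriv ?_
  simp
  abel

theorem surj_aux {E F : Type*} [NormedAddCommGroup E] [NormedSpace ℝ E] [NormedAddCommGroup F]
    [NormedSpace ℝ F] {f : E → F} {f' : E →L[ℝ] F} {a : E} (hf : HasStrictFDerivAt f f' a)
    (hE : CompleteSpace E) (hF : CompleteSpace F) (h : ∀ w, ∃ v, f' v = w) (p : E → Prop)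
    (hp : ∀ᶠ x in nhds a, p x) : ∀ᶠ q in nhds (f a), ∃ x, f x = q ∧ p x := by
  rw [← hf.map_nhds_eq_of_surj (LinearMap.range_eq_top.2 h), Filter.eventually_map]
  filter_upwards [hp] with x hx
  exact ⟨x, rfl, hx⟩

theorem HS_open {ε₁ : ι → ℝ} {ε₂ : κ → ℝ} {ε₃ : μ → ℝ} (h₁ : Sgn ε₁) (h₂ : Sgn ε₂) (h₃ : Sgn ε₃)
    (x : (ι → ℝ) × (κ → ℝ) × (μ → ℝ))
    {Q : Matrix ι κ ℂ} {R : Matrix ι μ ℂ} (hQ : IsoU ε₁ ε₂ Q) (hR : IsoU ε₁ ε₃ R)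
    (heq : Dg x.1 * (Q * Dg x.2.1 * Qs ε₁ ε₂ Q) * (R * Dg x.2.2 * Qs ε₁ ε₃ R) = 1)
    (hirr : ∀ Z : Matrix ι ι ℂ, Z * Dg x.1 = Dg x.1 * Z →
      Z * (Dg x.1 * (Q * Dg x.2.1 * Qs ε₁ ε₂ Q)) = (Dg x.1 * (Q * Dg x.2.1 * Qs ε₁ ε₂ Q)) * Z →
      ∃ z : ℂ, Z = z • 1) :
    ∀ᶠ y in nhds x, sm y = sm x → y ∈ HS ε₁ ε₂ ε₃ := by
  rcases isEmpty_or_nonempty ι with hι | hι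
  · exact Filter.Eventually.of_forall fun y _ => ⟨Q, R, hQ, hR, Subsingleton.elim _ _⟩
  set A := Dg x.1 with hA
  set B := Q * Dg x.2.1 * Qs ε₁ ε₂ Q with hB
  set C := R * Dg x.2.2 * Qs ε₁ ε₃ R with hC
  have uA : A * Qs ε₁ ε₁ A = 1 := un_Dg h₁ _
  have uB : B * Qs ε₁ ε₁ B = 1 := un_conj h₁ h₂ hQ _
  have uP : (A * B) * Qs ε₁ ε₁ (A * B) = 1 := un_mul h₁ uA uB
  have eC : Qs ε₁ ε₁ (A * B) = C := by
    have := mul_eq_one_comm.1 uP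
    exact left_inv_eq_right_inv this heq
  have eA : Qs ε₁ ε₁ A = B * C := by
    have := mul_eq_one_comm.1 uA
    exact left_inv_eq_right_inv this (by rw [← Matrix.mul_assoc]; exact heq)
  have hexp : Complex.exp ((sm x : ℂ) * Complex.I) = 1 := by
    rw [← det_sol h₁ h₂ h₃ hQ hR x, heq, Matrix.det_one]
  let Pt : Matrix ι ι ℂ →L[ℝ] Matrix ι ι ℂ := LinearMap.toContinuousLinearMap (pT ε₁)
  let Φ : Matrix ι ι ℂ × Matrix ι ι ℂ × Matrix ι ι ℂ × ((ι → ℝ) × (κ → ℝ) × (μ → ℝ)) →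
      Matrix ι ι ℂ × ((ι → ℝ) × (κ → ℝ) × (μ → ℝ)) := fun p =>
    (Pt (Wm ε₁ ε₂ ε₃ Q R p) + (p.2.2.1 - Pt p.2.2.1), p.2.2.2)
  let p0 : Matrix ι ι ℂ × Matrix ι ι ℂ × Matrix ι ι ℂ × ((ι → ℝ) × (κ → ℝ) × (μ → ℝ)) :=
    (0, 0, 0, x)
  have hW0 : Wm ε₁ ε₂ ε₃ Q R p0 = 1 := by
    simp only [Wm, p0, map_zero, neg_zero, NormedSpace.exp_zero, Matrix.one_mul, Matrix.mul_one]
    exact heq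
  have cW := contDiff_Wm ε₁ ε₂ ε₃ Q R
  have cΦ : ContDiff ℝ 1 Φ := by
    refine ContDiff.prodMk ((Pt.contDiff.comp cW).add ?_) (by fun_prop)
    exact ContDiff.sub (by fun_prop) (Pt.contDiff.comp (by fun_prop))
  have hΦ := (cΦ.contDiffAt (x := p0)).hasStrictFDerivAt one_ne_zero
  have hΦ0 : Φ p0 = (0, x) := by
    simp only [Φ, hW0]
    refine Prod.ext ?_ rfl
    simp only [p0, map_zero, sub_zero, add_zero]
    change pT ε₁ 1 = 0
    rw [pT_apply, sk_apply, Qs_one h₁]; simp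
  have hdir : ∀ X Y V : Matrix ι ι ℂ, fderiv ℝ Φ p0 (X, Y, V, 0) =
      (Pt (LL A (Qs ε₁ ε₁ A) (A * B) (Qs ε₁ ε₁ (A * B)) (sk ε₁ X, sk ε₁ Y)) + (V - Pt V), 0) := by
    intro X Y V
    have hl : HasDerivAt (fun t : ℝ => Φ (p0 + t • (X, Y, V, 0)))
        (fderiv ℝ Φ p0 (X, Y, V, 0)) 0 := by
      have hd := hΦ.hasFDerivAt
      have h0 : p0 = p0 + (0 : ℝ) • ((X, Y, V, 0) : Matrix ι ι ℂ × Matrix ι ι ℂ × Matrix ι ι ℂ ×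
        ((ι → ℝ) × (κ → ℝ) × (μ → ℝ))) := by simp
      have hc : HasDerivAt (fun t : ℝ => p0 + t • ((X, Y, V, 0) : Matrix ι ι ℂ × Matrix ι ι ℂ ×
          Matrix ι ι ℂ × ((ι → ℝ) × (κ → ℝ) × (μ → ℝ)))) (X, Y, V, 0) 0 := by
        have := (((hasDerivAt_id (0 : ℝ)).smul_const ((X, Y, V, 0) : Matrix ι ι ℂ × Matrix ι ι ℂ ×
          Matrix ι ι ℂ × ((ι → ℝ) × (κ → ℝ) × (μ → ℝ)))).const_add p0)
        rw [one_smul] at this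
        exact this
      exact HasFDerivAt.comp_hasDerivAt_of_eq (0 : ℝ) hd hc h0
    have hr : HasDerivAt (fun t : ℝ => Φ (p0 + t • (X, Y, V, 0)))
        (Pt (LL A (Qs ε₁ ε₁ A) (A * B) (Qs ε₁ ε₁ (A * B)) (sk ε₁ X, sk ε₁ Y)) + (V - Pt V), 0) 0 := by
      have hfun : (fun t : ℝ => Φ (p0 + t • (X, Y, V, 0))) = fun t : ℝ =>
          (Pt (A * (NormedSpace.exp (t • sk ε₁ X) * B * NormedSpace.exp (-(t • sk ε₁ X))) *
            (NormedSpace.exp (t • sk ε₁ Y) * C * NormedSpace.exp (-(t • sk ε₁ Y)))) +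
            (t • (V - Pt V)), x) := by
        funext t
        simp only [Φ, p0, Wm, Prod.smul_mk, Prod.mk_add_mk, zero_add, smul_zero, add_zero,
          map_smul, smul_sub, hA, hB, hC]
      rw [hfun]
      have d1 := hasDerivAt_conj (sk ε₁ X) B
      have d2 := hasDerivAt_conj (sk ε₁ Y) C
      have d3 := (d1.const_mul A).mul d2
      have d4 := Pt.hasFDerivAt.comp_hasDerivAt (0 : ℝ) d3
      have d5 := (hasDerivAt_id (0 : ℝ)).smul_const (V - Pt V)
      have d6 := (d4.add d5).prodMk (hasDerivAt_const (0 : ℝ) x)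
      refine d6.congr_deriv ?_
      refine Prod.ext ?_ rfl
      simp only [one_smul]
      congr 2
      simp only [zero_smul, NormedSpace.exp_zero, neg_zero, one_mul, mul_one]
      change _ = A * sk ε₁ X * Qs ε₁ ε₁ A - (A * B) * sk ε₁ X * Qs ε₁ ε₁ (A * B) +
        ((A * B) * sk ε₁ Y * Qs ε₁ ε₁ (A * B) - sk ε₁ Y)
      rw [eA, eC]
      have e3 : A * (B * (C * sk ε₁ Y)) = sk ε₁ Y := by
        rw [← Matrix.mul_assoc, ← Matrix.mul_assoc, heq, Matrix.one_mul]
      simp only [Matrix.mul_sub, Matrix.sub_mul, Matrix.mul_assoc, e3]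
    exact hl.unique hr
  have hsnd : ∀ v, (fderiv ℝ Φ p0 v).2 = v.2.2.2 := by
    intro v
    have hd := hΦ.hasFDerivAt.snd
    let L3 : Matrix ι ι ℂ × Matrix ι ι ℂ × Matrix ι ι ℂ × ((ι → ℝ) × (κ → ℝ) × (μ → ℝ)) →L[ℝ]
        ((ι → ℝ) × (κ → ℝ) × (μ → ℝ)) :=
      (ContinuousLinearMap.snd ℝ _ _).comp ((ContinuousLinearMap.snd ℝ _ _).comp
          (ContinuousLinearMap.snd ℝ _ _))
    have hd2 := L3.hasFDerivAt (x := p0)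
    have := hd.unique hd2
    have := DFunLike.congr_fun this v
    exact this
  have hsurj : ∀ w, ∃ v, fderiv ℝ Φ p0 v = w := by
    rintro ⟨T, y⟩
    set T' := T - (fderiv ℝ Φ p0 (0, 0, 0, y)).1 with hT'
    obtain ⟨X, Y, hXY⟩ := LL_surj_real h₁ uA uP hirr (pT ε₁ T') (trace_pT ε₁ T') (Qs_pT h₁ T')
    refine ⟨(X, Y, T', y), ?_⟩
    have : ((X, Y, T', y) : Matrix ι ι ℂ × Matrix ι ι ℂ × Matrix ι ι ℂ ×
        ((ι → ℝ) × (κ → ℝ) × (μ → ℝ))) = (X, Y, T', 0) + (0, 0, 0, y) := by simp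
    change fderiv ℝ Φ p0 (X, Y, T', y) = (T, y)
    rw [this, map_add, hdir, hXY]
    refine Prod.ext ?_ ?_
    · change pT ε₁ (pT ε₁ T') + (T' - pT ε₁ T') + _ = T
      rw [pT_pT h₁, hT']; abel
    · simp [hsnd]
  have cM : CompleteSpace (Matrix ι ι ℂ) := FiniteDimensional.complete ℝ _
  have hev : ∀ᶠ p in nhds p0, Wm ε₁ ε₂ ε₃ Q R p * Qs ε₁ ε₁ (Wm ε₁ ε₂ ε₃ Q R p) = 1 →
      pT ε₁ (Wm ε₁ ε₂ ε₃ Q R p) = 0 → (Wm ε₁ ε₂ ε₃ Q R p).det = 1 → Wm ε₁ ε₂ ε₃ Q R p = 1 := by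
    have := cW.continuous.tendsto p0
    rw [hW0] at this
    exact this.eventually (near_one ε₁)
  have hev2 : ∀ᶠ q in nhds ((0, x) : Matrix ι ι ℂ × ((ι → ℝ) × (κ → ℝ) × (μ → ℝ))),
      ∃ p, Φ p = q ∧ (Wm ε₁ ε₂ ε₃ Q R p * Qs ε₁ ε₁ (Wm ε₁ ε₂ ε₃ Q R p) = 1 →
      pT ε₁ (Wm ε₁ ε₂ ε₃ Q R p) = 0 → (Wm ε₁ ε₂ ε₃ Q R p).det = 1 → Wm ε₁ ε₂ ε₃ Q R p = 1) := by
    have := surj_aux hΦ (@CompleteSpace.prod _ _ _ _ cM (@CompleteSpace.prod _ _ _ _ cM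
      (@CompleteSpace.prod _ _ _ _ cM inferInstance)))
      (@CompleteSpace.prod _ _ _ _ cM inferInstance) hsurj _ hev
    rw [hΦ0] at this
    exact this
  have hct : Filter.Tendsto (fun y : (ι → ℝ) × (κ → ℝ) × (μ → ℝ) => ((0 : Matrix ι ι ℂ), y)) (nhds x)
      (nhds (0, x)) := Continuous.tendsto (by fun_prop) x
  filter_upwards [hct.eventually hev2] with y hy hsm
  obtain ⟨⟨X, Y, V, y'⟩, hp, himp⟩ := hy
  have hy' : y' = y := congrArg Prod.snd hp
  subst hy'
  have hp1 : pT ε₁ (Wm ε₁ ε₂ ε₃ Q R (X, Y, V, y')) + (V - pT ε₁ V) = 0 := congrArg Prod.fst hp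
  have hp2 : pT ε₁ (Wm ε₁ ε₂ ε₃ Q R (X, Y, V, y')) = 0 := by
    have := congrArg (pT ε₁) hp1
    rwa [map_add, map_sub, pT_pT h₁, pT_pT h₁, sub_self, add_zero, map_zero] at this
  obtain ⟨gx1, gx2, gx3⟩ := exp_sk_props h₁ X
  obtain ⟨gy1, gy2, gy3⟩ := exp_sk_props h₁ Y
  obtain ⟨iQ, sQ⟩ := hQ.mul_left h₁ h₂ (g := NormedSpace.exp (sk ε₁ X)) (by rw [gx1, gx2])
  obtain ⟨iR, sR⟩ := hR.mul_left h₁ h₃ (g := NormedSpace.exp (sk ε₁ Y)) (by rw [gy1, gy2])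
  have hWeq : Wm ε₁ ε₂ ε₃ Q R (X, Y, V, y') = Dg y'.1 *
      ((NormedSpace.exp (sk ε₁ X) * Q) * Dg y'.2.1 * Qs ε₁ ε₂ (NormedSpace.exp (sk ε₁ X) * Q)) *
      ((NormedSpace.exp (sk ε₁ Y) * R) * Dg y'.2.2 * Qs ε₁ ε₃ (NormedSpace.exp (sk ε₁ Y) * R)) := by
    rw [sQ, sR, gx1, gy1]
    simp only [Wm, Matrix.mul_assoc]
  refine ⟨_, _, iQ, iR, ?_⟩
  rw [← hWeq]
  refine himp ?_ hp2 ?_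
  · rw [hWeq]
    exact un_mul h₁ (un_mul h₁ (un_Dg h₁ _) (un_conj h₁ h₂ iQ _)) (un_conj h₁ h₃ iR _)
  · rw [hWeq, det_sol h₁ h₂ h₃ iQ iR y', hsm, hexp]

end
end Horn

namespace Horn

section
variable {ι κ μ : Type} [Fintype ι] [DecidableEq ι] [Fintype κ] [DecidableEq κ]
  [Fintype μ] [DecidableEq μ]

/-- Restriction of a vector of angles or signs. -/
def res (I : Finset ι) (a : ι → ℝ) : I → ℝ := fun i => a i

def sbm (I : Finset ι) (J : Finset κ) (M : Matrix ι κ ℂ) : Matrix I J ℂ := fun i j => M i j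

def Blk (I : Finset ι) (J : Finset κ) (M : Matrix ι κ ℂ) : Prop :=
  ∀ i j, (i ∈ I ↔ j ∉ J) → M i j = 0

theorem Blk.compl {I : Finset ι} {J : Finset κ} {M : Matrix ι κ ℂ} (h : Blk I J M) :
    Blk Iᶜ Jᶜ M := by
  intro i j hij
  refine h i j ?_
  simp only [Finset.mem_compl] at hij
  tauto

theorem Blk.mul {I : Finset ι} {J : Finset κ} {K : Finset μ} {M : Matrix ι κ ℂ} {N : Matrix κ μ ℂ}
    (hM : Blk I J M) (hN : Blk J K N) : Blk I K (M * N) := by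
  intro i k hik
  rw [Matrix.mul_apply]
  refine Finset.sum_eq_zero fun j _ => ?_
  by_cases h : i ∈ I ↔ j ∉ J
  · rw [hM i j h, zero_mul]
  · rw [hN j k (by tauto), mul_zero]

theorem Blk.diagonal (I : Finset ι) (d : ι → ℂ) : Blk I I (Matrix.diagonal d) := by
  intro i j hij
  refine Matrix.diagonal_apply_ne _ ?_
  rintro rfl
  tauto

theorem blk_Jd (I : Finset ι) (a : ι → ℝ) : Blk I I (Jd a) := Blk.diagonal I _

theorem blk_Dg (I : Finset ι) (a : ι → ℝ) : Blk I I (Dg a) := Blk.diagonal I _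

theorem Blk.ct {I : Finset ι} {J : Finset κ} {M : Matrix ι κ ℂ} (h : Blk I J M) : Blk J I Mᴴ := by
  intro i j hij
  rw [Matrix.conjTranspose_apply, h j i (by tauto), star_zero]

theorem Blk.Qs {I : Finset ι} {J : Finset κ} {M : Matrix ι κ ℂ} (h : Blk I J M) (ε₁ : ι → ℝ)
    (ε₂ : κ → ℝ) : Blk J I (Qs ε₁ ε₂ M) :=
  ((Blk.diagonal J _).mul h.ct).mul (Blk.diagonal I _)

theorem sbm_mul {I : Finset ι} {J : Finset κ} (K : Finset μ) {M : Matrix ι κ ℂ} (N : Matrix κ μ ℂ)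
    (hM : Blk I J M) : sbm I K (M * N) = sbm I J M * sbm J K N := by
  ext i k
  simp only [sbm, Matrix.mul_apply]
  rw [Finset.sum_coe_sort J (fun j => M i j * N j k)]
  symm
  refine Finset.sum_subset (Finset.subset_univ _) fun j _ hj => ?_
  rw [hM i j (by simp [i.2, hj]), zero_mul]

theorem sbm_diagonal (I : Finset ι) (d : ι → ℂ) :
    sbm I I (Matrix.diagonal d) = Matrix.diagonal fun i : I => d i := by
  ext i j
  simp only [sbm, Matrix.diagonal_apply, Subtype.ext_iff]

theorem sbm_Jd (I : Finset ι) (ε : ι → ℝ) : sbm I I (Jd ε) = Jd (res I ε) := sbm_diagonal I _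
theorem sbm_Dg (I : Finset ι) (ε : ι → ℝ) : sbm I I (Dg ε) = Dg (res I ε) := sbm_diagonal I _
theorem sbm_one (I : Finset ι) : sbm I I (1 : Matrix ι ι ℂ) = 1 := by
  rw [← Matrix.diagonal_one, sbm_diagonal, Matrix.diagonal_one]

theorem sbm_Qs {I : Finset ι} {J : Finset κ} {M : Matrix ι κ ℂ} (h : Blk I J M) (ε₁ : ι → ℝ)
    (ε₂ : κ → ℝ) : sbm J I (Qs ε₁ ε₂ M) = Qs (res I ε₁) (res J ε₂) (sbm I J M) := by
  unfold Qs
  rw [sbm_mul _ _ ((blk_Jd J _).mul h.ct), sbm_mul _ _ (blk_Jd J _)]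
  rw [← sbm_Jd, ← sbm_Jd]; rfl

theorem Blk.ext {I : Finset ι} {J : Finset κ} {M N : Matrix ι κ ℂ} (hM : Blk I J M)
    (hN : Blk I J N) (h1 : sbm I J M = sbm I J N) (h2 : sbm Iᶜ Jᶜ M = sbm Iᶜ Jᶜ N) : M = N := by
  ext i j
  by_cases hi : i ∈ I <;> by_cases hj : j ∈ J
  · exact congrFun (congrFun h1 ⟨i, hi⟩) ⟨j, hj⟩
  · rw [hM i j (by tauto), hN i j (by tauto)]
  · rw [hM i j (by tauto), hN i j (by tauto)]
  · exact congrFun (congrFun h2 ⟨i, by simpa using hi⟩) ⟨j, by simpa using hj⟩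

theorem sbm_IsoU_left {I : Finset ι} {J : Finset κ} {M : Matrix ι κ ℂ} (h : Blk I J M)
    (ε₁ : ι → ℝ) : sbm J J (Mᴴ * Jd ε₁ * M) = (sbm I J M)ᴴ * Jd (res I ε₁) * sbm I J M := by
  rw [sbm_mul (I := J) (J := I) _ _ (h.ct.mul (blk_Jd I _)), sbm_mul _ _ h.ct, sbm_Jd]; rfl

theorem sbm_IsoU_right {I : Finset ι} {J : Finset κ} {M : Matrix ι κ ℂ} (h : Blk I J M)
    (ε₂ : κ → ℝ) : sbm I I (M * Jd ε₂ * Mᴴ) = sbm I J M * Jd (res J ε₂) * (sbm I J M)ᴴ := by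
  rw [sbm_mul (I := I) (J := J) _ _ (h.mul (blk_Jd J _)), sbm_mul _ _ h, sbm_Jd]; rfl

theorem sbm_word {I : Finset ι} {J : Finset κ} {K : Finset μ} {Q : Matrix ι κ ℂ} {R : Matrix ι μ ℂ}
    (hQ : Blk I J Q) (hR : Blk I K R) (ε₁ : ι → ℝ) (ε₂ : κ → ℝ) (ε₃ : μ → ℝ)
    (a : ι → ℝ) (b : κ → ℝ) (c : μ → ℝ) :
    sbm I I (Dg a * (Q * Dg b * Qs ε₁ ε₂ Q) * (R * Dg c * Qs ε₁ ε₃ R)) =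
      Dg (res I a) * (sbm I J Q * Dg (res J b) * Qs (res I ε₁) (res J ε₂) (sbm I J Q)) *
      (sbm I K R * Dg (res K c) * Qs (res I ε₁) (res K ε₃) (sbm I K R)) := by
  have d : Blk I I (Dg a) := Blk.diagonal I _
  have hq : Blk I I (Q * Dg b * Qs ε₁ ε₂ Q) := (hQ.mul (blk_Dg J _)).mul (hQ.Qs _ _)
  rw [sbm_mul _ _ (d.mul hq), sbm_mul _ _ d, sbm_mul (I := I) (J := J) _ _ (hQ.mul (blk_Dg J _)),
    sbm_mul _ _ hQ, sbm_mul (I := I) (J := K) _ _ (hR.mul (blk_Dg K _)), sbm_mul _ _ hR,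
    sbm_Qs hQ, sbm_Qs hR, sbm_Dg, sbm_Dg, sbm_Dg]

theorem word_blk {I : Finset ι} {J : Finset κ} {K : Finset μ} {Q : Matrix ι κ ℂ} {R : Matrix ι μ ℂ}
    (hQ : Blk I J Q) (hR : Blk I K R) (ε₁ : ι → ℝ) (ε₂ : κ → ℝ) (ε₃ : μ → ℝ)
    (a : ι → ℝ) (b : κ → ℝ) (c : μ → ℝ) :
    Blk I I (Dg a * (Q * Dg b * Qs ε₁ ε₂ Q) * (R * Dg c * Qs ε₁ ε₃ R)) :=
  ((Blk.diagonal I _).mul ((hQ.mul (Blk.diagonal J _)).mul (hQ.Qs _ _))).mul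
    ((hR.mul (Blk.diagonal K _)).mul (hR.Qs _ _))

theorem IsoU.sbm {I : Finset ι} {J : Finset κ} {Q : Matrix ι κ ℂ} {ε₁ : ι → ℝ} {ε₂ : κ → ℝ}
    (h : IsoU ε₁ ε₂ Q) (hQ : Blk I J Q) : IsoU (res I ε₁) (res J ε₂) (sbm I J Q) := by
  constructor
  · rw [← sbm_IsoU_left hQ, h.1, sbm_Jd]
  · rw [← sbm_IsoU_right hQ, h.2, sbm_Jd]

/-- Restriction of a triple. -/
def res3 (I : Finset ι) (J : Finset κ) (K : Finset μ) :
    ((ι → ℝ) × (κ → ℝ) × (μ → ℝ)) →ₗ[ℝ] ((I → ℝ) × (J → ℝ) × (K → ℝ)) where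
  toFun x := (res I x.1, res J x.2.1, res K x.2.2)
  map_add' _ _ := rfl
  map_smul' _ _ := rfl

theorem HS_res {I : Finset ι} {J : Finset κ} {K : Finset μ} {Q : Matrix ι κ ℂ} {R : Matrix ι μ ℂ}
    {ε₁ : ι → ℝ} {ε₂ : κ → ℝ} {ε₃ : μ → ℝ} (iQ : IsoU ε₁ ε₂ Q) (iR : IsoU ε₁ ε₃ R)
    (hQ : Blk I J Q) (hR : Blk I K R) (x : (ι → ℝ) × (κ → ℝ) × (μ → ℝ))
    (heq : Dg x.1 * (Q * Dg x.2.1 * Qs ε₁ ε₂ Q) * (R * Dg x.2.2 * Qs ε₁ ε₃ R) = 1) :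
    res3 I J K x ∈ HS (res I ε₁) (res J ε₂) (res K ε₃) := by
  refine ⟨sbm I J Q, sbm I K R, iQ.sbm hQ, iR.sbm hR, ?_⟩
  have := sbm_word hQ hR ε₁ ε₂ ε₃ x.1 x.2.1 x.2.2
  rw [heq, sbm_one] at this
  exact this.symm

/-- Block diagonal assembly. -/
def asm (I : Finset ι) (J : Finset κ) (M : Matrix I J ℂ)
    (N : Matrix (Iᶜ : Finset ι) (Jᶜ : Finset κ) ℂ) : Matrix ι κ ℂ := fun i j =>
  if h : i ∈ I then if h' : j ∈ J then M ⟨i, h⟩ ⟨j, h'⟩ else 0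
  else if h' : j ∈ J then 0 else N ⟨i, Finset.mem_compl.2 h⟩ ⟨j, Finset.mem_compl.2 h'⟩

theorem asm_blk (I : Finset ι) (J : Finset κ) (M : Matrix I J ℂ)
    (N : Matrix (Iᶜ : Finset ι) (Jᶜ : Finset κ) ℂ) : Blk I J (asm I J M N) := by
  intro i j h
  by_cases hi : i ∈ I <;> by_cases hj : j ∈ J <;> simp [asm, hi, hj]
  · tauto
  · tauto

theorem sbm_asm (I : Finset ι) (J : Finset κ) (M : Matrix I J ℂ)
    (N : Matrix (Iᶜ : Finset ι) (Jᶜ : Finset κ) ℂ) : sbm I J (asm I J M N) = M := by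
  ext i j
  simp [sbm, asm]

theorem sbm_asm_compl (I : Finset ι) (J : Finset κ) (M : Matrix I J ℂ)
    (N : Matrix (Iᶜ : Finset ι) (Jᶜ : Finset κ) ℂ) : sbm Iᶜ Jᶜ (asm I J M N) = N := by
  ext i j
  have hi := Finset.mem_compl.1 i.2
  have hj := Finset.mem_compl.1 j.2
  simp [sbm, asm, hi, hj]

theorem IsoU.asm {I : Finset ι} {J : Finset κ} {M : Matrix I J ℂ}
    {N : Matrix (Iᶜ : Finset ι) (Jᶜ : Finset κ) ℂ} {ε₁ : ι → ℝ} {ε₂ : κ → ℝ}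
    (hM : IsoU (res I ε₁) (res J ε₂) M) (hN : IsoU (res Iᶜ ε₁) (res Jᶜ ε₂) N) :
    IsoU ε₁ ε₂ (asm I J M N) := by
  have hb := asm_blk I J M N
  constructor
  · refine Blk.ext (I := J) (J := J) ((hb.ct.mul (Blk.diagonal I _)).mul hb) (Blk.diagonal J _) ?_ ?_
    · rw [sbm_IsoU_left hb, sbm_Jd, sbm_asm, hM.1]
    · rw [sbm_IsoU_left hb.compl, sbm_Jd, sbm_asm_compl, hN.1]
  · refine Blk.ext (I := I) (J := I) ((hb.mul (Blk.diagonal J _)).mul hb.ct) (Blk.diagonal I _) ?_ ?_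
    · rw [sbm_IsoU_right hb, sbm_Jd, sbm_asm, hM.2]
    · rw [sbm_IsoU_right hb.compl, sbm_Jd, sbm_asm_compl, hN.2]

theorem HS_asm {I : Finset ι} {J : Finset κ} {K : Finset μ}
    {ε₁ : ι → ℝ} {ε₂ : κ → ℝ} {ε₃ : μ → ℝ} (x : (ι → ℝ) × (κ → ℝ) × (μ → ℝ))
    (h1 : res3 I J K x ∈ HS (res I ε₁) (res J ε₂) (res K ε₃))
    (h2 : res3 Iᶜ Jᶜ Kᶜ x ∈ HS (res Iᶜ ε₁) (res Jᶜ ε₂) (res Kᶜ ε₃)) : x ∈ HS ε₁ ε₂ ε₃ := by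
  obtain ⟨Q, R, iQ, iR, e⟩ := h1
  obtain ⟨Q', R', iQ', iR', e'⟩ := h2
  have bQ := asm_blk I J Q Q'
  have bR := asm_blk I K R R'
  refine ⟨Horn.asm I J Q Q', Horn.asm I K R R', iQ.asm iQ', iR.asm iR', ?_⟩
  refine Blk.ext (word_blk bQ bR _ _ _ _ _ _) (by rw [← Matrix.diagonal_one]; exact Blk.diagonal I _) ?_ ?_
  · rw [sbm_word bQ bR, sbm_one, sbm_asm, sbm_asm]; exact e
  · rw [sbm_word bQ.compl bR.compl, sbm_one, sbm_asm_compl, sbm_asm_compl]; exact e'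

theorem Reg.exp_ne {a : ι → ℝ} (h : Reg a) {i j : ι} (hij : i ≠ j) :
    Complex.exp ((a i : ℂ) * Complex.I) ≠ Complex.exp ((a j : ℂ) * Complex.I) := by
  intro he
  have h1 := h.cos_lt hij
  have h2 : Complex.exp (((a i - a j : ℝ) : ℂ) * Complex.I) = 1 := by
    push_cast
    rw [sub_mul, Complex.exp_sub, he, div_self (Complex.exp_ne_zero _)]
  have h3 := congrArg Complex.re h2
  rw [Complex.exp_ofReal_mul_I_re, Complex.one_re] at h3
  linarith

theorem Reg.commute {a : ι → ℝ} (h : Reg a) {Z : Matrix ι ι ℂ} (hZ : Z * Dg a = Dg a * Z) :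
    Z = Matrix.diagonal fun i => Z i i := by
  ext i j
  by_cases hij : i = j
  · subst hij; simp
  rw [Matrix.diagonal_apply_ne _ hij]
  have := congrFun (congrFun hZ i) j
  unfold Dg at this
  rw [Matrix.mul_diagonal, Matrix.diagonal_mul] at this
  have h2 : (Complex.exp ((a j : ℂ) * Complex.I) - Complex.exp ((a i : ℂ) * Complex.I)) * Z i j = 0 := by
    linear_combination this
  rcases mul_eq_zero.1 h2 with h3 | h3
  · exact absurd (sub_eq_zero.1 h3).symm (h.exp_ne hij)
  · exact h3

theorem intertwine {ε₁ : ι → ℝ} {ε₂ : κ → ℝ} (h₁ : Sgn ε₁) (h₂ : Sgn ε₂) {Q : Matrix ι κ ℂ}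
    (hQ : IsoU ε₁ ε₂ Q) {b : κ → ℝ} (hb : Reg b) {z : ι → ℂ}
    (hZ : Matrix.diagonal z * (Q * Dg b * Qs ε₁ ε₂ Q) = (Q * Dg b * Qs ε₁ ε₂ Q) * Matrix.diagonal z) :
    ∃ z' : κ → ℂ, ∀ i j, z i * Q i j = Q i j * z' j := by
  set S := Qs ε₁ ε₂ Q with hS
  have e1 : Q * S = 1 := hQ.mul_Qs h₁
  have e2 : S * Q = 1 := hQ.Qs_mul h₂
  have hc : (S * Matrix.diagonal z * Q) * Dg b = Dg b * (S * Matrix.diagonal z * Q) := by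
    calc _ = S * Matrix.diagonal z * Q * Dg b * (S * Q) := by rw [e2, Matrix.mul_one]
      _ = S * (Matrix.diagonal z * (Q * Dg b * S)) * Q := by simp only [Matrix.mul_assoc]
      _ = (S * Q) * Dg b * S * Matrix.diagonal z * Q := by rw [hZ]; simp only [Matrix.mul_assoc]
      _ = _ := by rw [e2, Matrix.one_mul]; simp only [Matrix.mul_assoc]
  have hd := hb.commute hc
  refine ⟨fun j => (S * Matrix.diagonal z * Q) j j, fun i j => ?_⟩
  have : Matrix.diagonal z * Q = Q * (S * Matrix.diagonal z * Q) := by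
    calc _ = (Q * S) * Matrix.diagonal z * Q := by rw [e1, Matrix.one_mul]
      _ = _ := by simp only [Matrix.mul_assoc]
  rw [hd] at this
  have := congrFun (congrFun this i) j
  rwa [Matrix.diagonal_mul, Matrix.mul_diagonal] at this

theorem reducible_of {ε₁ : ι → ℝ} {ε₂ : κ → ℝ} {ε₃ : μ → ℝ} (h₁ : Sgn ε₁) (h₂ : Sgn ε₂) (h₃ : Sgn ε₃)
    (x : (ι → ℝ) × (κ → ℝ) × (μ → ℝ)) (ra : Reg x.1) (rb : Reg x.2.1) (rc : Reg x.2.2)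
    {Q : Matrix ι κ ℂ} {R : Matrix ι μ ℂ} (hQ : IsoU ε₁ ε₂ Q) (hR : IsoU ε₁ ε₃ R)
    (heq : Dg x.1 * (Q * Dg x.2.1 * Qs ε₁ ε₂ Q) * (R * Dg x.2.2 * Qs ε₁ ε₃ R) = 1)
    (Z : Matrix ι ι ℂ) (hZA : Z * Dg x.1 = Dg x.1 * Z)
    (hZP : Z * (Dg x.1 * (Q * Dg x.2.1 * Qs ε₁ ε₂ Q)) = (Dg x.1 * (Q * Dg x.2.1 * Qs ε₁ ε₂ Q)) * Z)
    (hns : ¬ ∃ z : ℂ, Z = z • 1) :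
    ∃ (I : Finset ι) (J : Finset κ) (K : Finset μ), I ≠ ∅ ∧ I ≠ Finset.univ ∧
      res3 I J K x ∈ HS (res I ε₁) (res J ε₂) (res K ε₃) ∧
      res3 Iᶜ Jᶜ Kᶜ x ∈ HS (res Iᶜ ε₁) (res Jᶜ ε₂) (res Kᶜ ε₃) := by
  classical
  have hι : Nonempty ι := by
    by_contra hne
    rw [not_nonempty_iff] at hne
    exact hns ⟨0, Subsingleton.elim _ _⟩
  obtain ⟨i0⟩ := hι
  set A := Dg x.1 with hA
  set B := Q * Dg x.2.1 * Qs ε₁ ε₂ Q with hB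
  set C := R * Dg x.2.2 * Qs ε₁ ε₃ R with hC
  have hA' : Dg (-x.1) * A = 1 := Dg_neg_mul _
  have hZB : Z * B = B * Z := by
    calc _ = (Dg (-x.1) * A) * Z * B := by rw [hA', Matrix.one_mul]
      _ = Dg (-x.1) * (Z * A) * B := by rw [hZA]; simp only [Matrix.mul_assoc]
      _ = Dg (-x.1) * (Z * (A * B)) := by simp only [Matrix.mul_assoc]
      _ = (Dg (-x.1) * A) * B * Z := by rw [hZP]; simp only [Matrix.mul_assoc]
      _ = _ := by rw [hA', Matrix.one_mul]
  have heq' : C * (A * B) = 1 := mul_eq_one_comm.1 heq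
  have hZC : Z * C = C * Z := by
    calc _ = (C * (A * B)) * Z * C := by rw [heq', Matrix.one_mul]
      _ = C * (Z * (A * B)) * C := by rw [hZP]; simp only [Matrix.mul_assoc]
      _ = C * Z * (A * B * C) := by simp only [Matrix.mul_assoc]
      _ = _ := by rw [heq, Matrix.mul_one]
  have hd := ra.commute hZA
  set z : ι → ℂ := fun i => Z i i with hz
  rw [hd] at hZB hZC
  obtain ⟨z', hz'⟩ := intertwine h₁ h₂ hQ rb hZB
  obtain ⟨z'', hz''⟩ := intertwine h₁ h₃ hR rc hZC
  let I : Finset ι := Finset.univ.filter fun i => z i = z i0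
  let J : Finset κ := Finset.univ.filter fun i => z' i = z i0
  let K : Finset μ := Finset.univ.filter fun i => z'' i = z i0
  have bQ : Blk I J Q := by
    intro i j hij
    have h := hz' i j
    simp only [I, J, Finset.mem_filter, Finset.mem_univ, true_and] at hij
    by_contra hne
    have : z i = z' j := mul_right_cancel₀ hne (by rw [h, mul_comm])
    rw [this] at hij; tauto
  have bR : Blk I K R := by
    intro i j hij
    have h := hz'' i j
    simp only [I, K, Finset.mem_filter, Finset.mem_univ, true_and] at hij
    by_contra hne
    have : z i = z'' j := mul_right_cancel₀ hne (by rw [h, mul_comm])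
    rw [this] at hij; tauto
  refine ⟨I, J, K, ?_, ?_, HS_res hQ hR bQ bR x heq, HS_res hQ hR bQ.compl bR.compl x heq⟩
  · exact Finset.ne_empty_of_mem (a := i0) (by simp [I])
  · intro hu
    refine hns ⟨z i0, ?_⟩
    rw [hd, Matrix.smul_one_eq_diagonal]
    congr 1
    funext i
    have : i ∈ I := by rw [hu]; exact Finset.mem_univ _
    simpa [I] using this

end
end Horn

namespace Horn

section
variable {ι κ μ : Type} [Fintype ι] [DecidableEq ι] [Fintype κ] [DecidableEq κ]
  [Fintype μ] [DecidableEq μ]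

/-- Bounded regular region. -/
def Om (ι κ μ : Type) (M : ℝ) : Set ((ι → ℝ) × (κ → ℝ) × (μ → ℝ)) :=
  {x | (Reg x.1 ∧ ∀ i, |x.1 i| ≤ M) ∧ (Reg x.2.1 ∧ ∀ i, |x.2.1 i| ≤ M) ∧
    (Reg x.2.2 ∧ ∀ i, |x.2.2 i| ≤ M)}

theorem SL.and {E : Type*} [AddCommGroup E] [Module ℝ E] {S T : Set E} (h : SL S) (h' : SL T) :
    SL (S ∩ T) := SL.inter S T h h'

theorem SL.abs_lt {E : Type*} [AddCommGroup E] [Module ℝ E] (f : E →ₗ[ℝ] ℝ) (c : ℝ) :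
    SL {x | |f x| < c} := by
  have : {x | |f x| < c} = {x | f x < c} ∩ {x | (-f) x < c} := by
    ext x
    simp only [Set.mem_ofPred_eq, Set.mem_inter_iff, LinearMap.neg_apply]
    rw [_root_.abs_lt]
    constructor <;> rintro ⟨h1, h2⟩ <;> constructor <;> linarith
  rw [this]
  exact (SL.lt f c).and (SL.lt (-f) c)

theorem SL.abs_le {E : Type*} [AddCommGroup E] [Module ℝ E] (f : E →ₗ[ℝ] ℝ) (c : ℝ) :
    SL {x | |f x| ≤ c} := by
  have : {x | |f x| ≤ c} = {x | f x ≤ c} ∩ {x | (-f) x ≤ c} := by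
    ext x
    simp only [Set.mem_ofPred_eq, Set.mem_inter_iff, LinearMap.neg_apply]
    rw [_root_.abs_le]
    constructor <;> rintro ⟨h1, h2⟩ <;> constructor <;> linarith
  rw [this]
  exact (SL.le f c).and (SL.le (-f) c)

theorem SL.reg (M : ℝ) : SL {a : ι → ℝ | Reg a ∧ ∀ i, |a i| ≤ M} := by
  have h1 : SL {a : ι → ℝ | Reg a} := by
    unfold Reg
    refine SL.all (fun (i : ι) (a : ι → ℝ) => ∀ j, i ≠ j → a i ≠ a j ∧ |a i - a j| < 2 * π) fun i => ?_
    refine SL.all (fun (j : ι) (a : ι → ℝ) => i ≠ j → a i ≠ a j ∧ |a i - a j| < 2 * π) fun j => ?_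
    by_cases hij : i = j
    · have : {a : ι → ℝ | i ≠ j → a i ≠ a j ∧ |a i - a j| < 2 * π} = Set.univ := by
        ext a; simp [hij]
      rw [this]; exact SL.univ
    · let f : (ι → ℝ) →ₗ[ℝ] ℝ := (LinearMap.proj i : (ι → ℝ) →ₗ[ℝ] ℝ) - (LinearMap.proj j : (ι → ℝ) →ₗ[ℝ] ℝ)
      have : {a : ι → ℝ | i ≠ j → a i ≠ a j ∧ |a i - a j| < 2 * π} =
          {a | f a = 0}ᶜ ∩ {a | |f a| < 2 * π} := by
        ext a; simp [hij, f, sub_eq_zero]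
      rw [this]
      exact (SL.compl _ (SL.eq f 0)).and (SL.abs_lt f _)
  have h2 : SL {a : ι → ℝ | ∀ i, |a i| ≤ M} :=
    SL.all (fun (i : ι) (a : ι → ℝ) => |a i| ≤ M) fun i => SL.abs_le (LinearMap.proj i : (ι → ℝ) →ₗ[ℝ] ℝ) M
  exact h1.and h2

theorem SL.om (M : ℝ) : SL (Om ι κ μ M) := by
  have h1 := (SL.reg (ι := ι) M).preimage_lin (LinearMap.fst ℝ (ι → ℝ) ((κ → ℝ) × (μ → ℝ)))
  have h2 := (SL.reg (ι := κ) M).preimage_lin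
    ((LinearMap.fst ℝ (κ → ℝ) (μ → ℝ)).comp (LinearMap.snd ℝ (ι → ℝ) ((κ → ℝ) × (μ → ℝ))))
  have h3 := (SL.reg (ι := μ) M).preimage_lin
    ((LinearMap.snd ℝ (κ → ℝ) (μ → ℝ)).comp (LinearMap.snd ℝ (ι → ℝ) ((κ → ℝ) × (μ → ℝ))))
  exact h1.and (h2.and h3)

def smL : ((ι → ℝ) × (κ → ℝ) × (μ → ℝ)) →ₗ[ℝ] ℝ where
  toFun := sm
  map_add' x y := by simp only [sm, Prod.fst_add, Prod.snd_add, Pi.add_apply,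
    Finset.sum_add_distrib]; ring
  map_smul' c x := by simp only [sm, Prod.smul_fst, Prod.smul_snd, Pi.smul_apply, smul_eq_mul,
    ← Finset.mul_sum, RingHom.id_apply]; ring

theorem abs_sm_le {M : ℝ} {x : (ι → ℝ) × (κ → ℝ) × (μ → ℝ)} (h : x ∈ Om ι κ μ M) :
    |sm x| ≤ (Fintype.card ι + Fintype.card κ + Fintype.card μ) * M := by
  have key : ∀ {τ : Type} [Fintype τ] (a : τ → ℝ), (∀ i, |a i| ≤ M) →
      |∑ i, a i| ≤ Fintype.card τ * M := by
    intro τ _ a ha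
    refine (Finset.abs_sum_le_sum_abs _ _).trans ?_
    refine (Finset.sum_le_sum fun i _ => ha i).trans ?_
    simp
  have e1 := key _ h.1.2
  have e2 := key _ h.2.1.2
  have e3 := key _ h.2.2.2
  unfold sm
  refine (abs_add_three _ _ _).trans ?_
  linarith

theorem HS_sm {ε₁ : ι → ℝ} {ε₂ : κ → ℝ} {ε₃ : μ → ℝ} (h₁ : Sgn ε₁) (h₂ : Sgn ε₂) (h₃ : Sgn ε₃)
    {x : (ι → ℝ) × (κ → ℝ) × (μ → ℝ)} (hx : x ∈ HS ε₁ ε₂ ε₃) : ∃ m : ℤ, sm x = 2 * π * m := by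
  obtain ⟨Q, R, hQ, hR, e⟩ := hx
  have := det_sol h₁ h₂ h₃ hQ hR x
  rw [e, Matrix.det_one] at this
  obtain ⟨m, hm⟩ := Complex.exp_eq_one_iff.1 this.symm
  refine ⟨m, ?_⟩
  have h2 : (sm x : ℂ) = ((2 * π * m : ℝ) : ℂ) := by
    push_cast
    have := mul_right_cancel₀ Complex.I_ne_zero (b := Complex.I) (a := (sm x : ℂ)) (c := 2 * π * m)
      (by rw [hm]; ring)
    exact this
  exact_mod_cast h2

theorem Reg.res {a : ι → ℝ} (h : Reg a) (I : Finset ι) : Reg (res I a) :=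
  fun i j hij => h i j fun h' => hij (Subtype.ext h')

theorem Sig.res {ε : ι → ℝ} (h : Sig ε) (I : Finset ι) : Sig (res I ε) :=
  ⟨fun i => h.1 i, fun i j hi hj => Subtype.ext (h.2 i j hi hj)⟩

theorem Om.res {M : ℝ} {x : (ι → ℝ) × (κ → ℝ) × (μ → ℝ)} (h : x ∈ Om ι κ μ M)
    (I : Finset ι) (J : Finset κ) (K : Finset μ) : res3 I J K x ∈ Om I J K M :=
  ⟨⟨h.1.1.res I, fun i => h.1.2 i⟩, ⟨h.2.1.1.res J, fun i => h.2.1.2 i⟩,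
    ⟨h.2.2.1.res K, fun i => h.2.2.2 i⟩⟩

/-- The reducible locus. -/
def Rd (ε₁ : ι → ℝ) (ε₂ : κ → ℝ) (ε₃ : μ → ℝ) (M : ℝ) : Set ((ι → ℝ) × (κ → ℝ) × (μ → ℝ)) :=
  Om ι κ μ M ∩ ⋃ t : Finset ι × Finset κ × Finset μ, {_x | t.1 ≠ ∅ ∧ t.1 ≠ Finset.univ} ∩
    ({x | res3 t.1 t.2.1 t.2.2 x ∈ HS (res t.1 ε₁) (res t.2.1 ε₂) (res t.2.2 ε₃) ∩ Om _ _ _ M} ∩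
     {x | res3 t.1ᶜ t.2.1ᶜ t.2.2ᶜ x ∈
        HS (res t.1ᶜ ε₁) (res t.2.1ᶜ ε₂) (res t.2.2ᶜ ε₃) ∩ Om _ _ _ M})

end

theorem SL_HS (n : ℕ) : ∀ (ι κ μ : Type) [Fintype ι] [DecidableEq ι] [Fintype κ] [DecidableEq κ]
    [Fintype μ] [DecidableEq μ] (ε₁ : ι → ℝ) (ε₂ : κ → ℝ) (ε₃ : μ → ℝ),
    Sig ε₁ → Sig ε₂ → Sig ε₃ → Fintype.card ι = n → ∀ M : ℝ,
    SL (HS ε₁ ε₂ ε₃ ∩ Om ι κ μ M) := by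
  induction n using Nat.strong_induction_on with
  | _ n ih =>
  intro ι κ μ _ _ _ _ _ _ ε₁ ε₂ ε₃ h₁ h₂ h₃ hn M
  have hRd : SL (Rd ε₁ ε₂ ε₃ M) := by
    refine (SL.om M).and (SL.iUnion _ ?_)
    rintro ⟨I, J, K⟩
    by_cases hI : I ≠ ∅ ∧ I ≠ Finset.univ
    · refine (SL.const _).and (SL.and ?_ ?_)
      · refine SL.preimage_lin (ih (Fintype.card I) ?_ _ _ _ _ _ _ (h₁.res I) (h₂.res J) (h₃.res K)
          rfl M) _
        rw [← hn, Fintype.card_coe]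
        exact Finset.card_lt_univ_of_notMem (x := Classical.choose
          (not_forall.1 fun h => hI.2 (Finset.eq_univ_iff_forall.2 h)))
          (Classical.choose_spec (not_forall.1 fun h => hI.2 (Finset.eq_univ_iff_forall.2 h)))
      · refine SL.preimage_lin (ih (Fintype.card (Iᶜ : Finset ι)) ?_ _ _ _ _ _ _ (h₁.res Iᶜ)
          (h₂.res Jᶜ) (h₃.res Kᶜ) rfl M) _
        rw [← hn, Fintype.card_coe]
        obtain ⟨i, hi⟩ := Finset.nonempty_iff_ne_empty.2 hI.1
        exact Finset.card_lt_univ_of_notMem (x := i) (by simpa using hi)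
    · have : {_x : (ι → ℝ) × (κ → ℝ) × (μ → ℝ) | I ≠ ∅ ∧ I ≠ Finset.univ} = ∅ := by
        ext x; simp only [Set.mem_ofPred_eq, Set.mem_empty_iff_false, iff_false]; exact hI
      simp only [this, Set.empty_inter]
      exact SL.empty
  have hRdHS : Rd ε₁ ε₂ ε₃ M ⊆ HS ε₁ ε₂ ε₃ ∩ Om ι κ μ M := by
    rintro x ⟨hx, hx2⟩
    obtain ⟨⟨I, J, K⟩, -, ⟨hx3, -⟩, ⟨hx4, -⟩⟩ := Set.mem_iUnion.1 hx2
    exact ⟨HS_asm x hx3 hx4, hx⟩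
  let X : ℤ → Set ((ι → ℝ) × (κ → ℝ) × (μ → ℝ)) := fun m =>
    (Om ι κ μ M ∩ {x | smL x = 2 * π * m}) \ Rd ε₁ ε₂ ε₃ M
  have hX : ∀ m, SL (X m) := fun m => ((SL.om M).and (SL.eq _ _)).diff hRd
  have hY : ∀ m, SL (HS ε₁ ε₂ ε₃ ∩ X m) := by
    intro m
    refine SL.of_clopen (hX m) Set.inter_subset_right ?_ ?_
    · rintro x ⟨⟨Q, R, hQ, hR, heq⟩, ⟨hxO, hxm⟩, hxR⟩
      by_cases hirr : ∀ Z : Matrix ι ι ℂ, Z * Dg x.1 = Dg x.1 * Z →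
        Z * (Dg x.1 * (Q * Dg x.2.1 * Qs ε₁ ε₂ Q)) = (Dg x.1 * (Q * Dg x.2.1 * Qs ε₁ ε₂ Q)) * Z →
        ∃ z : ℂ, Z = z • 1
      · filter_upwards [HS_open h₁.1 h₂.1 h₃.1 x hQ hR heq hirr] with y hy hyX
        refine ⟨hy ?_, hyX⟩
        have e1 : sm y = 2 * π * m := hyX.1.2
        have e2 : sm x = 2 * π * m := hxm
        rw [e1, e2]
      · exfalso
        push Not at hirr
        obtain ⟨Z, hZA, hZP, hns⟩ := hirr
        obtain ⟨I, J, K, hI, hI', hr, hr'⟩ := reducible_of h₁.1 h₂.1 h₃.1 x hxO.1.1 hxO.2.1.1 hxO.2.2.1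
          hQ hR heq Z hZA hZP (by push Not; exact hns)
        exact hxR ⟨hxO, Set.mem_iUnion.2 ⟨(I, J, K), ⟨hI, hI'⟩, ⟨hr, Om.res hxO _ _ _⟩,
          ⟨hr', Om.res hxO _ _ _⟩⟩⟩
    · intro x hx hxc
      exact ⟨HS_closed h₁ h₂ h₃ x hx.1.1.1.1 hx.1.1.2.1.1 hx.1.1.2.2.1
        (closure_mono Set.inter_subset_left hxc), hx⟩
  let N : ℤ := ⌈(Fintype.card ι + Fintype.card κ + Fintype.card μ) * M⌉
  have hfin : HS ε₁ ε₂ ε₃ ∩ Om ι κ μ M = Rd ε₁ ε₂ ε₃ M ∪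
      ⋃ m ∈ Finset.Icc (-N) N, HS ε₁ ε₂ ε₃ ∩ X m := by
    ext x
    constructor
    · rintro ⟨hx, hxO⟩
      by_cases hR : x ∈ Rd ε₁ ε₂ ε₃ M
      · exact Or.inl hR
      obtain ⟨m, hm⟩ := HS_sm h₁.1 h₂.1 h₃.1 hx
      refine Or.inr (Set.mem_iUnion₂.2 ⟨m, ?_, hx, ⟨hxO, hm⟩, hR⟩)
      have hb := abs_sm_le hxO
      rw [hm, abs_mul, abs_of_pos Real.two_pi_pos] at hb
      have h3 : (3 : ℝ) < π := Real.pi_gt_three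
      have hb2 : |(m : ℝ)| ≤ (Fintype.card ι + Fintype.card κ + Fintype.card μ) * M := by
        nlinarith [abs_nonneg (m : ℝ)]
      have hb3 : |(m : ℝ)| ≤ N := hb2.trans (Int.le_ceil _)
      rw [Finset.mem_Icc]
      rw [_root_.abs_le] at hb3
      exact ⟨by exact_mod_cast hb3.1, by exact_mod_cast hb3.2⟩
    · rintro (hx | hx)
      · exact hRdHS hx
      · obtain ⟨m, -, hx1, hx2⟩ := Set.mem_iUnion₂.1 hx
        exact ⟨hx1, hx2.1.1⟩
  rw [hfin]
  exact hRd.union (SL.biUnion _ _ fun m _ => hY m)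

end Horn

namespace Horn

theorem Poly.isPolytope {n : ℕ} {Q : Set (TriN n)} (h : Poly Q) : IsPolytope Q := by
  induction h with
  | univ =>
    exact ⟨0, Fin.elim0, Fin.elim0, Fin.elim0, by ext x; simp⟩
  | lt f c Q _ ih =>
    obtain ⟨m, g, d, s, rfl⟩ := ih
    refine ⟨m + 1, Fin.cons f g, Fin.cons c d, Fin.cons true s, ?_⟩
    ext x
    simp only [Set.mem_inter_iff, Set.mem_iInter, Set.mem_ofPred_eq, Fin.forall_fin_succ,
      Fin.cons_zero, Fin.cons_succ, if_true]
  | le f c Q _ ih =>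
    obtain ⟨m, g, d, s, rfl⟩ := ih
    refine ⟨m + 1, Fin.cons f g, Fin.cons c d, Fin.cons false s, ?_⟩
    ext x
    simp only [Set.mem_inter_iff, Set.mem_iInter, Set.mem_ofPred_eq, Fin.forall_fin_succ,
      Fin.cons_zero, Fin.cons_succ, Bool.false_eq_true, if_false]

/-- The signature. -/
def sg (n : ℕ) : Fin (n + 1) → ℝ := fun i => if (i : ℕ) = n then -1 else 1

theorem sig_sg (n : ℕ) : Sig (sg n) := by
  constructor
  · intro i; unfold sg; split_ifs <;> simp
  · intro i j hi hj
    unfold sg at hi hj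
    split_ifs at hi hj with h1 h2
    · exact Fin.ext (h1.trans h2.symm)
    · exact absurd hj (by norm_num)
    · exact absurd hi (by norm_num)
    · exact absurd hi (by norm_num)

theorem Jn_eq (n : ℕ) : Jn n = Jd (sg n) := by
  unfold Jn Jd sg
  congr 1; funext i; split_ifs <;> simp

/-- Extension by zero. -/
def ex (n : ℕ) : (Fin n → ℝ) →ₗ[ℝ] (Fin (n + 1) → ℝ) where
  toFun α := fun i => if h : (i : ℕ) < n then α ⟨i.1, h⟩ else 0
  map_add' a b := by funext i; simp only [Pi.add_apply]; split_ifs <;> simp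
  map_smul' a b := by funext i; simp only [Pi.smul_apply]; split_ifs <;> simp

theorem ex_apply (n : ℕ) (α : Fin n → ℝ) (i : Fin (n + 1)) :
    ex n α i = if h : (i : ℕ) < n then α ⟨i.1, h⟩ else 0 := rfl

theorem En_eq (n : ℕ) (α : Fin n → ℝ) : En n α = Dg (ex n α) := by
  unfold En Dg
  congr 1; funext i
  rw [ex_apply]; split_ifs <;> simp

theorem memUn_of {n : ℕ} {M : MatN n} (h : M * Qs (sg n) (sg n) M = 1) : memUn n M := by
  have h2 : Qs (sg n) (sg n) M * M = 1 := mul_eq_one_comm.1 h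
  unfold memUn
  rw [Jn_eq]
  calc _ = (Jd (sg n) * Jd (sg n)) * (Mᴴ * Jd (sg n) * M) := by
        rw [Jd_mul_Jd (sig_sg n).1, Matrix.one_mul]
    _ = Jd (sg n) * (Qs (sg n) (sg n) M * M) := by unfold Qs; simp only [Matrix.mul_assoc]
    _ = _ := by rw [h2, Matrix.mul_one]

theorem _root_.memUn.un {n : ℕ} {M : MatN n} (h : memUn n M) : M * Qs (sg n) (sg n) M = 1 := by
  unfold memUn at h
  rw [Jn_eq] at h
  refine mul_eq_one_comm.1 ?_
  calc _ = Jd (sg n) * (Mᴴ * Jd (sg n) * M) := by unfold Qs; simp only [Matrix.mul_assoc]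
    _ = 1 := by rw [h, Jd_mul_Jd (sig_sg n).1]

theorem _root_.memUn.iso {n : ℕ} {M : MatN n} (h : memUn n M) : IsoU (sg n) (sg n) M := by
  have h1 := h.un
  unfold memUn at h
  rw [Jn_eq] at h
  refine ⟨h, ?_⟩
  calc _ = (M * Jd (sg n) * Mᴴ) * (Jd (sg n) * Jd (sg n)) := by
        rw [Jd_mul_Jd (sig_sg n).1, Matrix.mul_one]
    _ = (M * Qs (sg n) (sg n) M) * Jd (sg n) := by unfold Qs; simp only [Matrix.mul_assoc]
    _ = _ := by rw [h1, Matrix.one_mul]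

theorem inv_eq_Qs {n : ℕ} {M : MatN n} (h : M * Qs (sg n) (sg n) M = 1) :
    M⁻¹ = Qs (sg n) (sg n) M := Matrix.inv_eq_right_inv h

theorem Dg_shift {ι : Type} [Fintype ι] [DecidableEq ι] (c : ι → ℝ) (l : ℝ) :
    Dg (fun i => c i - l) = Complex.exp (-((l : ℂ) * Complex.I)) • Dg c := by
  unfold Dg
  rw [← Matrix.diagonal_smul]
  congr 1; funext i
  simp only [Pi.smul_apply, smul_eq_mul]
  rw [← Complex.exp_add]; congr 1; push_cast; ring

/-- Extension of a triple. -/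
def ex3 (n : ℕ) : TriN n →ₗ[ℝ] (Fin (n + 1) → ℝ) × (Fin (n + 1) → ℝ) × (Fin (n + 1) → ℝ) where
  toFun τ := (ex n τ.1, ex n τ.2.1, ex n τ.2.2)
  map_add' a b := by simp
  map_smul' a b := by simp

/-- The angle of the scalar. -/
def el (n : ℕ) (m : ℕ) (τ : TriN n) : ℝ := (sm (ex3 n τ) + 2 * π * m) / (n + 1)

/-- The lifted triple. -/
def lf (n : ℕ) (m : ℕ) (τ : TriN n) : (Fin (n + 1) → ℝ) × (Fin (n + 1) → ℝ) × (Fin (n + 1) → ℝ) :=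
  (ex n τ.1, ex n τ.2.1, fun i => ex n τ.2.2 i - el n m τ)

theorem SL_lf (n m : ℕ) {S : Set ((Fin (n + 1) → ℝ) × (Fin (n + 1) → ℝ) × (Fin (n + 1) → ℝ))}
    (hS : SL S) : SL {τ : TriN n | lf n m τ ∈ S} := by
  let sh : ℝ →ₗ[ℝ] (Fin (n + 1) → ℝ) × (Fin (n + 1) → ℝ) × (Fin (n + 1) → ℝ) :=
    { toFun := fun t => (0, 0, fun _ => -t / (n + 1))
      map_add' := fun a b => by
        refine Prod.ext (by simp) (Prod.ext (by simp) ?_)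
        funext i; simp; ring
      map_smul' := fun a b => by
        refine Prod.ext (by simp) (Prod.ext (by simp) ?_)
        funext i; simp; ring }
  have := hS.preimage (ex3 n + sh ∘ₗ smL ∘ₗ ex3 n) (0, 0, fun _ => -(2 * π * m) / (n + 1))
  convert this using 1
  ext τ
  simp only [Set.mem_ofPred_eq]
  have e : lf n m τ = (ex3 n + sh ∘ₗ smL ∘ₗ ex3 n) τ + (0, 0, fun _ => -(2 * π * m) / (n + 1)) := by
    refine Prod.ext ?_ (Prod.ext ?_ ?_)
    · simp [lf, ex3, sh]
    · simp [lf, ex3, sh]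
    · funext i
      simp only [lf, el, LinearMap.add_apply, LinearMap.comp_apply]
      change ex n τ.2.2 i - (sm (ex3 n τ) + 2 * π * m) / (n + 1) =
        ex n τ.2.2 i + -sm (ex3 n τ) / (n + 1) + -(2 * π * m) / (n + 1)
      ring
  rw [e]

theorem ex_bd {n : ℕ} {α : Fin n → ℝ} (h : memTnInt n α) (i : Fin (n + 1)) :
    0 ≤ ex n α i ∧ ex n α i < 2 * π := by
  rw [ex_apply]
  split_ifs with hi
  · exact ⟨(h.1 _).1.le, (h.1 _).2⟩
  · exact ⟨le_rfl, Real.two_pi_pos⟩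

theorem ex_reg {n : ℕ} {α : Fin n → ℝ} (h : memTnInt n α) : Reg (ex n α) := by
  intro i j hij
  constructor
  · rw [ex_apply, ex_apply]
    have hij' : (i : ℕ) ≠ j := fun h => hij (Fin.ext h)
    split_ifs with hi hj hj
    · rcases lt_or_gt_of_ne hij' with h1 | h1
      · exact (h.2 ⟨i, hi⟩ ⟨j, hj⟩ h1).ne'
      · exact (h.2 ⟨j, hj⟩ ⟨i, hi⟩ h1).ne
    · exact (h.1 _).1.ne'
    · exact (h.1 _).1.ne
    · have := i.2; have := j.2; omega
  · have h1 := ex_bd h i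
    have h2 := ex_bd h j
    rw [_root_.abs_lt]; constructor <;> linarith

theorem Reg.shift {ι : Type} {a : ι → ℝ} (h : Reg a) (l : ℝ) : Reg fun i => a i - l := by
  intro i j hij
  have := h i j hij
  rw [sub_sub_sub_cancel_right]
  exact ⟨fun h' => this.1 (by linarith), this.2⟩

theorem _root_.memTnInt.mem {n : ℕ} {α : Fin n → ℝ} (h : memTnInt n α) : memTn n α :=
  ⟨fun i => ⟨(h.1 i).1.le, (h.1 i).2⟩, fun i j hij => by
    rcases hij.eq_or_lt with rfl | h1
    · exact le_rfl
    · exact (h.2 i j h1).le⟩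

theorem lf_om {n m : ℕ} (hm : m < n + 1) {τ : TriN n} (h : memTnInt3 n τ) :
    lf n m τ ∈ Om (Fin (n + 1)) (Fin (n + 1)) (Fin (n + 1)) (10 * π) := by
  have hp := Real.pi_pos
  have hsum : ∀ {α : Fin n → ℝ}, memTnInt n α → 0 ≤ ∑ i, ex n α i ∧
      ∑ i, ex n α i ≤ (n + 1) * (2 * π) := by
    intro α hα
    refine ⟨Finset.sum_nonneg fun i _ => (ex_bd hα i).1, ?_⟩
    refine (Finset.sum_le_sum fun i _ => (ex_bd hα i).2.le).trans ?_
    simp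
  have s1 := hsum h.1
  have s2 := hsum h.2.1
  have s3 := hsum h.2.2
  have hn : (0 : ℝ) < n + 1 := by positivity
  have hm' : (m : ℝ) ≤ n + 1 := by exact_mod_cast hm.le
  have hsm : sm (ex3 n τ) = ∑ i, ex n τ.1 i + ∑ i, ex n τ.2.1 i + ∑ i, ex n τ.2.2 i := rfl
  have l0 : 0 ≤ el n m τ := by
    unfold el
    rw [hsm]
    have : 0 ≤ 2 * π * m := by positivity
    apply div_nonneg <;> linarith
  have l1 : el n m τ ≤ 8 * π := by
    unfold el
    rw [div_le_iff₀ hn, hsm]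
    nlinarith
  refine ⟨⟨ex_reg h.1, fun i => ?_⟩, ⟨ex_reg h.2.1, fun i => ?_⟩, ⟨(ex_reg h.2.2).shift _, fun i => ?_⟩⟩
  · have := ex_bd h.1 i
    change |ex n τ.1 i| ≤ _
    rw [_root_.abs_le]; constructor <;> linarith
  · have := ex_bd h.2.1 i
    change |ex n τ.2.1 i| ≤ _
    rw [_root_.abs_le]; constructor <;> linarith
  · have := ex_bd h.2.2 i
    change |ex n τ.2.2 i - el n m τ| ≤ _
    rw [_root_.abs_le]; constructor <;> linarith

theorem conj_iso {n : ℕ} {P Q : MatN n} (hP : memUn n P) (hQ : memUn n Q) :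
    IsoU (sg n) (sg n) (Qs (sg n) (sg n) P * Q) ∧
    Qs (sg n) (sg n) (Qs (sg n) (sg n) P * Q) = Qs (sg n) (sg n) Q * P := by
  have hs := (sig_sg n).1
  have := hQ.iso.mul_left hs hs (g := Qs (sg n) (sg n) P)
    (by rw [Qs_Qs hs]; exact mul_eq_one_comm.1 hP.un)
  rwa [Qs_Qs hs] at this

theorem fwd {n : ℕ} {τ : TriN n} (h : τ ∈ HornSolN n) :
    ∃ m < n + 1, lf n m τ ∈ HS (sg n) (sg n) (sg n) := by
  have hs := (sig_sg n).1
  obtain ⟨-, A, B, C, -, -, -, ⟨P, hP, rfl⟩, ⟨Q, hQ, rfl⟩, ⟨R, hR, rfl⟩, lam, hlam⟩ := h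
  rw [inv_eq_Qs hP.un, inv_eq_Qs hQ.un, inv_eq_Qs hR.un, En_eq, En_eq, En_eq] at hlam
  obtain ⟨iQ, sQ⟩ := conj_iso hP hQ
  obtain ⟨iR, sR⟩ := conj_iso hP hR
  have hP1 := hP.un
  have hP2 : Qs (sg n) (sg n) P * P = 1 := mul_eq_one_comm.1 hP1
  set P' := Qs (sg n) (sg n) P with hP'
  have key : Dg (ex n τ.1) * ((P' * Q) * Dg (ex n τ.2.1) * Qs (sg n) (sg n) (P' * Q)) *
      ((P' * R) * Dg (ex n τ.2.2) * Qs (sg n) (sg n) (P' * R)) = lam • (1 : MatN n) := by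
    rw [sQ, sR]
    calc _ = (P' * P) * Dg (ex n τ.1) * P' * Q * Dg (ex n τ.2.1) * Qs (sg n) (sg n) Q * (P * P') * R *
          Dg (ex n τ.2.2) * Qs (sg n) (sg n) R * P := by
          rw [hP2, Matrix.one_mul]; simp only [Matrix.mul_assoc]
      _ = P' * (P * Dg (ex n τ.1) * P' * (Q * Dg (ex n τ.2.1) * Qs (sg n) (sg n) Q) * (P * P') * (R *
          Dg (ex n τ.2.2) * Qs (sg n) (sg n) R)) * P := by simp only [Matrix.mul_assoc]
      _ = _ := by
          rw [hP1, Matrix.mul_one, hlam, Matrix.mul_smul, Matrix.mul_one, Matrix.smul_mul, hP2]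
  have hdet := det_sol hs hs hs iQ iR (ex3 n τ)
  have hdet' : lam ^ (n + 1) = Complex.exp ((sm (ex3 n τ) : ℂ) * Complex.I) := by
    rw [← hdet]
    change _ = (Dg (ex n τ.1) * ((P' * Q) * Dg (ex n τ.2.1) * Qs (sg n) (sg n) (P' * Q)) *
      ((P' * R) * Dg (ex n τ.2.2) * Qs (sg n) (sg n) (P' * R))).det
    rw [key, Matrix.det_smul, Matrix.det_one, mul_one, Fintype.card_fin]
  have hn0 : ((n : ℂ) + 1) ≠ 0 := by exact_mod_cast Nat.succ_ne_zero n
  have hroot : (lam * Complex.exp (-((sm (ex3 n τ) : ℂ) * Complex.I / (n + 1)))) ^ (n + 1) = 1 := by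
    rw [mul_pow, hdet', ← Complex.exp_nat_mul, ← Complex.exp_add]
    convert Complex.exp_zero using 2
    push_cast
    field_simp
    ring
  obtain ⟨m, hm, hζ⟩ := (Complex.isPrimitiveRoot_exp (n + 1) (Nat.succ_ne_zero n)).eq_pow_of_pow_eq_one
    hroot
  refine ⟨m, hm, P' * Q, P' * R, iQ, iR, ?_⟩
  change Dg (ex n τ.1) * ((P' * Q) * Dg (ex n τ.2.1) * Qs (sg n) (sg n) (P' * Q)) *
      ((P' * R) * Dg (fun i => ex n τ.2.2 i - el n m τ) * Qs (sg n) (sg n) (P' * R)) = 1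
  rw [Dg_shift, Matrix.mul_smul, Matrix.smul_mul, Matrix.mul_smul, key, smul_smul]
  have hl : lam = Complex.exp ((el n m τ : ℂ) * Complex.I) := by
    have : lam = (lam * Complex.exp (-((sm (ex3 n τ) : ℂ) * Complex.I / (n + 1)))) *
        Complex.exp ((sm (ex3 n τ) : ℂ) * Complex.I / (n + 1)) := by
      rw [mul_assoc, ← Complex.exp_add, neg_add_cancel, Complex.exp_zero, mul_one]
    rw [this, ← hζ, ← Complex.exp_nat_mul, ← Complex.exp_add]
    congr 1
    unfold el
    push_cast
    field_simp
    ring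
  rw [hl, ← Complex.exp_add, neg_add_cancel, Complex.exp_zero, one_smul]

theorem bwd {n m : ℕ} {τ : TriN n} (hτ : memTnInt3 n τ) (h : lf n m τ ∈ HS (sg n) (sg n) (sg n)) :
    τ ∈ HornSolN n := by
  have hs := (sig_sg n).1
  obtain ⟨Q, R, hQ, hR, e⟩ := h
  have uQ := hQ.mul_Qs hs
  have uR := hR.mul_Qs hs
  change Dg (ex n τ.1) * (Q * Dg (ex n τ.2.1) * Qs (sg n) (sg n) Q) *
      (R * Dg (fun i => ex n τ.2.2 i - el n m τ) * Qs (sg n) (sg n) R) = 1 at e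
  refine ⟨⟨hτ.1.mem, hτ.2.1.mem, hτ.2.2.mem⟩, Dg (ex n τ.1), Q * Dg (ex n τ.2.1) * Qs (sg n) (sg n) Q,
    R * Dg (ex n τ.2.2) * Qs (sg n) (sg n) R, memUn_of (un_Dg hs _), memUn_of (un_conj hs hs hQ _),
    memUn_of (un_conj hs hs hR _), ⟨1, ?_, ?_⟩, ⟨Q, memUn_of uQ, ?_⟩, ⟨R, memUn_of uR, ?_⟩,
    Complex.exp ((el n m τ : ℂ) * Complex.I), ?_⟩
  · simp [memUn]
  · simp [En_eq]
  · rw [inv_eq_Qs uQ, En_eq]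
  · rw [inv_eq_Qs uR, En_eq]
  · rw [Dg_shift, Matrix.mul_smul, Matrix.smul_mul, Matrix.mul_smul] at e
    rw [← e, smul_smul, ← Complex.exp_add, add_neg_cancel, Complex.exp_zero, one_smul]

end Horn

/-- Polyhedrality of the elliptic Horn solution set in PU(n,1). -/
theorem horn_polyhedral (n : ℕ) (hn : 1 ≤ n) :
    ∃ (N : ℕ) (Q : Fin N → Set (TriN n)),
      (∀ a : Fin N, IsPolytope (Q a)) ∧
      HornSolN n ∩ {τ : TriN n | memTnInt3 n τ} =
        (⋃ a : Fin N, Q a) ∩ {τ : TriN n | memTnInt3 n τ} := by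
  have hsl : Horn.SL (⋃ m ∈ Finset.range (n + 1), {τ : TriN n | Horn.lf n m τ ∈
      Horn.HS (Horn.sg n) (Horn.sg n) (Horn.sg n) ∩ Horn.Om _ _ _ (10 * π)}) :=
    Horn.SL.biUnion _ _ fun m _ => Horn.SL_lf n m (Horn.SL_HS _ _ _ _ _ _ _ (Horn.sig_sg n)
      (Horn.sig_sg n) (Horn.sig_sg n) rfl _)
  obtain ⟨F, hF, hP, hS⟩ := hsl.fp
  obtain ⟨N, Q, -, hQ⟩ := hF.fin_param
  refine ⟨N, Q, fun a => (hP _ (hQ ▸ Set.mem_range_self a)).isPolytope, ?_⟩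
  rw [← Set.sUnion_range, hQ, ← hS]
  ext τ
  constructor
  · rintro ⟨h1, h2⟩
    obtain ⟨m, hm, hx⟩ := Horn.fwd h1
    exact ⟨Set.mem_iUnion₂.2 ⟨m, Finset.mem_range.2 hm, hx, Horn.lf_om hm h2⟩, h2⟩
  · rintro ⟨h1, h2⟩
    obtain ⟨m, hm, hx, -⟩ := Set.mem_iUnion₂.1 h1
    exact ⟨Horn.bwd h2 hx, h2⟩
end
end

section
/- Closedness of the solution set in the interior: Fix n ≥ 1 and a complex number u with u^{n+1} = 1. If (τ_m) is a sequence in 𝒫ₙ,ᵤ converging in (ℝⁿ)³ to a point τ ∈ (𝒯ₙ°)³, then τ ∈ 𝒫ₙ,ᵤ. Equivalently, 𝒫ₙ,ᵤ ∩ (𝒯ₙ°)³ is closed in the subspace topology of (𝒯ₙ°)³. -/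
open Real Matrix Set

noncomputable section

/-- The standard lift Lₙ(α) ∈ SU(n,1):
diag(e^{i(nα₁−(α₂+⋯+αₙ))/(n+1)}, …, e^{i(nαₙ−(α₁+⋯+α_{n−1}))/(n+1)}, e^{−i(α₁+⋯+αₙ)/(n+1)}). -/
def Ln (n : ℕ) (α : Fin n → ℝ) : MatN n :=
  Matrix.diagonal (fun i =>
    if h : (i : ℕ) < n then
      Complex.exp (((((n : ℝ) * α ⟨i.1, h⟩ - ((∑ l, α l) - α ⟨i.1, h⟩)) / ((n : ℝ) + 1)) : ℝ)
        * Complex.I)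
    else Complex.exp (((-(∑ l, α l) / ((n : ℝ) + 1)) : ℝ) * Complex.I))

/-- `𝒫ₙ,ᵤ`: solution set with standard lifts multiplying to `u·I`. -/
def PsolN (n : ℕ) (u : ℂ) : Set (TriN n) := {τ | memTn3 n τ ∧ ∃ A B C : MatN n,
  memUn n A ∧ memUn n B ∧ memUn n C ∧
  (∃ P : MatN n, memUn n P ∧ A = P * Ln n τ.1 * P⁻¹) ∧
  (∃ P : MatN n, memUn n P ∧ B = P * Ln n τ.2.1 * P⁻¹) ∧
  (∃ P : MatN n, memUn n P ∧ C = P * Ln n τ.2.2 * P⁻¹) ∧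
  A * B * C = u • (1 : MatN n)}

/-- The Hermitian form of signature `(n,1)`. -/
def Hf (n : ℕ) (w z : Fin (n + 1) → ℂ) : ℂ := star w ⬝ᵥ (Jn n *ᵥ z)

/-- The last standard basis vector. -/
def eL (n : ℕ) : Fin (n + 1) → ℂ := Pi.single (Fin.last n) 1

lemma Hf_eq (n : ℕ) (w z : Fin (n + 1) → ℂ) :
    Hf n w z = ∑ i : Fin n, star (w i.castSucc) * z i.castSucc
      - star (w (Fin.last n)) * z (Fin.last n) := by
  have h : ∀ i : Fin n, ((i : ℕ) = n) = False := fun i => by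
    simpa using i.2.ne
  simp [Hf, Jn, dotProduct, Matrix.mulVec_diagonal, Fin.sum_univ_castSucc, h, sub_eq_add_neg]

lemma Hf_smul_left (n : ℕ) (c : ℂ) (w z : Fin (n + 1) → ℂ) :
    Hf n (c • w) z = star c * Hf n w z := by
  simp [Hf, smul_dotProduct]

lemma Hf_smul_right (n : ℕ) (c : ℂ) (w z : Fin (n + 1) → ℂ) :
    Hf n w (c • z) = c * Hf n w z := by
  simp [Hf, Matrix.mulVec_smul, dotProduct_smul]

lemma Hf_star (n : ℕ) (w z : Fin (n + 1) → ℂ) : star (Hf n w z) = Hf n z w := by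
  simp only [Hf_eq, star_sub, star_sum, star_mul, star_star]

lemma Hf_norm_comm (n : ℕ) (w z : Fin (n + 1) → ℂ) : ‖Hf n w z‖ = ‖Hf n z w‖ := by
  rw [← Hf_star, norm_star]

lemma Hf_unitary {n : ℕ} {M : MatN n} (hM : memUn n M) (w z : Fin (n + 1) → ℂ) :
    Hf n (M *ᵥ w) (M *ᵥ z) = Hf n w z := by
  unfold memUn at hM
  unfold Hf
  rw [Matrix.star_mulVec, ← Matrix.dotProduct_mulVec, Matrix.mulVec_mulVec,
    Matrix.mulVec_mulVec, hM]

lemma Jn_sq (n : ℕ) : Jn n * Jn n = 1 := by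
  unfold Jn
  rw [Matrix.diagonal_mul_diagonal, ← Matrix.diagonal_one]
  congr 1
  funext i
  split_ifs <;> simp

lemma Jn_conj (n : ℕ) : (Jn n)ᴴ = Jn n := by
  unfold Jn
  rw [Matrix.diagonal_conjTranspose]
  congr 1
  funext i
  simp only [Pi.star_apply]
  split_ifs <;> simp

lemma memUn_left {n : ℕ} {P : MatN n} (hP : memUn n P) : (Jn n * Pᴴ * Jn n) * P = 1 := by
  unfold memUn at hP
  rw [Matrix.mul_assoc, Matrix.mul_assoc, ← Matrix.mul_assoc Pᴴ, hP, Jn_sq]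

lemma memUn_inv_eq {n : ℕ} {P : MatN n} (hP : memUn n P) : P⁻¹ = Jn n * Pᴴ * Jn n :=
  Matrix.inv_eq_left_inv (memUn_left hP)

lemma memUn_mul_inv {n : ℕ} {P : MatN n} (hP : memUn n P) : P * P⁻¹ = 1 := by
  rw [memUn_inv_eq hP]
  exact mul_eq_one_comm.mp (memUn_left hP)

lemma memUn_inv_mul {n : ℕ} {P : MatN n} (hP : memUn n P) : P⁻¹ * P = 1 := by
  rw [memUn_inv_eq hP]
  exact memUn_left hP

lemma memUn_mul {n : ℕ} {P Q : MatN n} (hP : memUn n P) (hQ : memUn n Q) :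
    memUn n (P * Q) := by
  unfold memUn at *
  rw [Matrix.conjTranspose_mul]
  calc Qᴴ * Pᴴ * Jn n * (P * Q) = Qᴴ * (Pᴴ * Jn n * P) * Q := by simp only [Matrix.mul_assoc]
    _ = Jn n := by rw [hP, hQ]

lemma memUn_inv {n : ℕ} {P : MatN n} (hP : memUn n P) : memUn n P⁻¹ := by
  have h1 := memUn_mul_inv hP
  have h2 : (P⁻¹)ᴴ * Pᴴ = 1 := by
    rw [← Matrix.conjTranspose_mul, h1, Matrix.conjTranspose_one]
  have hP' := hP
  unfold memUn at *
  calc (P⁻¹)ᴴ * Jn n * P⁻¹ = (P⁻¹)ᴴ * (Pᴴ * Jn n * P) * P⁻¹ := by rw [hP']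
    _ = ((P⁻¹)ᴴ * Pᴴ) * Jn n * (P * P⁻¹) := by simp only [Matrix.mul_assoc]
    _ = Jn n := by rw [h1, h2]; simp

lemma memUn_one (n : ℕ) : memUn n 1 := by simp [memUn]

/-- The last eigenvalue of the standard lift. -/
def lamL (n : ℕ) (α : Fin n → ℝ) : ℂ :=
  Complex.exp (((-(∑ l, α l) / ((n : ℝ) + 1)) : ℝ) * Complex.I)

lemma norm_lamL (n : ℕ) (α : Fin n → ℝ) : ‖lamL n α‖ = 1 := Complex.norm_exp_ofReal_mul_I _

lemma Ln_eq (n : ℕ) (α : Fin n → ℝ) : Ln n α = lamL n α • En n α := by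
  unfold Ln En
  rw [← Matrix.diagonal_smul]
  congr 1
  funext i
  simp only [Pi.smul_apply, smul_eq_mul, lamL]
  split_ifs with h
  · rw [← Complex.exp_add]
    congr 1
    rw [← add_mul, ← Complex.ofReal_add]
    congr 2
    have : (n : ℝ) + 1 ≠ 0 := by positivity
    field_simp
    ring
  · simp

lemma En_mem (n : ℕ) (α : Fin n → ℝ) : memUn n (En n α) := by
  unfold memUn En Jn
  rw [Matrix.diagonal_conjTranspose, Matrix.diagonal_mul_diagonal, Matrix.diagonal_mul_diagonal]
  congr 1
  funext i
  simp only [Pi.star_apply]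
  have key : ∀ x : ℝ, star (Complex.exp (x * Complex.I)) * Complex.exp (x * Complex.I) = 1 := by
    intro x
    have := Complex.conj_mul' (Complex.exp (x * Complex.I))
    rw [Complex.norm_exp_ofReal_mul_I] at this
    simpa using this
  split_ifs with h h2 h2
  · omega
  · rw [mul_one, key]
  · simp
  · omega

lemma memUn_smul {n : ℕ} {P : MatN n} (hP : memUn n P) {c : ℂ} (hc : ‖c‖ = 1) :
    memUn n (c • P) := by
  unfold memUn at *
  have : c * star c = 1 := by
    have := Complex.mul_conj' c
    rw [hc] at this
    simpa using this
  rw [Matrix.conjTranspose_smul, Matrix.smul_mul, Matrix.smul_mul, Matrix.mul_smul, smul_smul, hP,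
    mul_comm, this, one_smul]

lemma Ln_mem (n : ℕ) (α : Fin n → ℝ) : memUn n (Ln n α) := by
  rw [Ln_eq]
  exact memUn_smul (En_mem n α) (norm_lamL n α)

lemma En_eL (n : ℕ) (α : Fin n → ℝ) : En n α *ᵥ eL n = eL n := by
  funext i
  simp only [En, eL, Matrix.mulVec_diagonal]
  by_cases hi : i = Fin.last n
  · subst hi; simp
  · simp [Pi.single_eq_of_ne hi]

lemma Ln_eL (n : ℕ) (α : Fin n → ℝ) : Ln n α *ᵥ eL n = lamL n α • eL n := by
  rw [Ln_eq, Matrix.smul_mulVec, En_eL]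

lemma Hf_eL (n : ℕ) (z : Fin (n + 1) → ℂ) : Hf n (eL n) z = - z (Fin.last n) := by
  have h : ∀ i : Fin n, i.castSucc ≠ Fin.last n := fun i => (Fin.castSucc_lt_last i).ne
  simp [Hf_eq, eL]

/-- Negative unit vectors: norm relation. -/
lemma neg_rel {n : ℕ} {z : Fin (n + 1) → ℂ} (hz : Hf n z z = -1) :
    ‖z (Fin.last n)‖ ^ 2 = 1 + ∑ i : Fin n, ‖z i.castSucc‖ ^ 2 := by
  rw [Hf_eq] at hz
  simp only [Complex.star_def, Complex.conj_mul'] at hz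
  have : (((∑ i : Fin n, ‖z i.castSucc‖ ^ 2) - ‖z (Fin.last n)‖ ^ 2 : ℝ) : ℂ) = ((-1 : ℝ) : ℂ) := by
    push_cast
    exact hz
  have := Complex.ofReal_injective this
  linarith

lemma disp_base {n : ℕ} {α : Fin n → ℝ} {c : ℝ} (hc : c ≤ 1)
    (hα : ∀ j, c ≤ 1 - Real.cos (α j)) {z : Fin (n + 1) → ℂ} (hz : Hf n z z = -1) :
    c * ‖z (Fin.last n)‖ ^ 2 ≤ ‖Hf n z (Ln n α *ᵥ z)‖ := by
  rw [Ln_eq, Matrix.smul_mulVec, Hf_smul_right, norm_mul, norm_lamL, one_mul]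
  have hre : (Hf n z (En n α *ᵥ z)).re
      = ∑ i : Fin n, Real.cos (α i) * ‖z i.castSucc‖ ^ 2 - ‖z (Fin.last n)‖ ^ 2 := by
    have e1 : Hf n z (En n α *ᵥ z)
      = ∑ i : Fin n, Complex.exp (α i * Complex.I) * ((‖z i.castSucc‖ ^ 2 : ℝ) : ℂ)
        - ((‖z (Fin.last n)‖ ^ 2 : ℝ) : ℂ) := by
      rw [Hf_eq]
      congr 1
      · apply Finset.sum_congr rfl
        intro i _
        simp only [En, Matrix.mulVec_diagonal, Complex.ofReal_pow, ← Complex.conj_mul']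
        simp
        ring
      · simp only [En, Matrix.mulVec_diagonal, Complex.ofReal_pow, ← Complex.conj_mul']
        simp
    rw [e1, Complex.sub_re, Complex.re_sum, Complex.ofReal_re]
    congr 1
    apply Finset.sum_congr rfl
    intro i _
    rw [Complex.re_mul_ofReal, Complex.exp_ofReal_mul_I_re]
  have h1 := neg_rel hz
  have h2 : c * ∑ i : Fin n, ‖z i.castSucc‖ ^ 2
      ≤ ∑ i : Fin n, (1 - Real.cos (α i)) * ‖z i.castSucc‖ ^ 2 := by
    rw [Finset.mul_sum]
    exact Finset.sum_le_sum fun i _ => mul_le_mul_of_nonneg_right (hα i) (by positivity)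
  simp only [sub_mul, one_mul, Finset.sum_sub_distrib] at h2
  have h3 := Complex.abs_re_le_norm (Hf n z (En n α *ᵥ z))
  have h4 := neg_le_abs (Hf n z (En n α *ᵥ z)).re
  rw [hre] at h4 h3
  nlinarith

/-- Displacement of a vector under an elliptic element. -/
lemma disp {n : ℕ} {α : Fin n → ℝ} {c : ℝ} (hc : c ≤ 1)
    (hα : ∀ j, c ≤ 1 - Real.cos (α j)) {P : MatN n} (hP : memUn n P)
    {w : Fin (n + 1) → ℂ} (hw : Hf n w w = -1) :
    c * ‖Hf n (P *ᵥ eL n) w‖ ^ 2 ≤ ‖Hf n w ((P * Ln n α * P⁻¹) *ᵥ w)‖ := by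
  obtain ⟨z, rfl⟩ : ∃ z, w = P *ᵥ z :=
    ⟨P⁻¹ *ᵥ w, by rw [Matrix.mulVec_mulVec, memUn_mul_inv hP, Matrix.one_mulVec]⟩
  rw [Hf_unitary hP] at hw
  rw [Hf_unitary hP, Matrix.mulVec_mulVec, Matrix.mul_assoc, memUn_inv_mul hP, Matrix.mul_one,
    ← Matrix.mulVec_mulVec, Hf_unitary hP, Hf_eL, norm_neg]
  exact disp_base hc hα hw

lemma core_ineq {E : Type*} [NormedAddCommGroup E] [InnerProductSpace ℂ E] (x y v : E)
    (hx : ‖x‖ ≤ 1) (hy : ‖y‖ ≤ 1) (hv : ‖v‖ ≤ 1) :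
    ‖1 - inner ℂ x y‖ ≤ 5 * (‖1 - inner ℂ v x‖ + ‖1 - inner ℂ v y‖) := by
  have hsym : ‖1 - inner ℂ x v‖ = ‖1 - inner ℂ v x‖ := by
    rw [← norm_star, star_sub, star_one, Complex.star_def, inner_conj_symm]
  have hd : ∀ w : E, ‖w‖ ≤ 1 → ‖v - w‖ ^ 2 ≤ 2 * ‖1 - inner ℂ v w‖ := by
    intro w hw
    have h1 := @norm_sub_sq ℂ E _ _ _ v w
    have h2 := Complex.re_le_norm (1 - inner ℂ v w)
    rw [Complex.sub_re, Complex.one_re] at h2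
    simp only [RCLike.re_to_complex] at h1
    nlinarith [norm_nonneg v, norm_nonneg w]
  have h0 : (1 : ℂ) - inner ℂ x y = (1 - inner ℂ x v) + inner ℂ (x - v) (v - y)
      + (inner ℂ v v - 1) + (1 - inner ℂ v y) := by
    simp only [inner_sub_left, inner_sub_right]
    ring
  have h3 : ‖inner ℂ (x - v) (v - y)‖ ≤ ‖1 - inner ℂ v x‖ + ‖1 - inner ℂ v y‖ := by
    have := norm_inner_le_norm (𝕜 := ℂ) (x - v) (v - y)
    rw [norm_sub_rev x v] at this
    nlinarith [hd x hx, hd y hy, sq_nonneg (‖v - x‖ - ‖v - y‖)]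
  have h4 : ‖inner ℂ v v - (1 : ℂ)‖ ≤ 2 * ‖1 - inner ℂ v y‖ := by
    have e : inner ℂ v v - (1 : ℂ) = ((‖v‖ ^ 2 - 1 : ℝ) : ℂ) := by
      rw [inner_self_eq_norm_sq_to_K]; push_cast; rfl
    rw [e, Complex.norm_real, Real.norm_eq_abs, abs_le]
    have h5 := norm_inner_le_norm (𝕜 := ℂ) v y
    have h6 := norm_sub_norm_le (1 : ℂ) (inner ℂ v y)
    rw [norm_one] at h6
    have h7 : ‖v‖ * ‖y‖ ≤ ‖v‖ := by nlinarith [norm_nonneg v]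
    constructor <;> nlinarith [norm_nonneg v, norm_nonneg (1 - inner ℂ v y)]
  rw [h0]
  have t1 := norm_add_le ((1 - inner ℂ x v) + inner ℂ (x - v) (v - y)
      + (inner ℂ v v - 1)) (1 - inner ℂ v y)
  have t2 := norm_add_le ((1 - inner ℂ x v) + inner ℂ (x - v) (v - y)) (inner ℂ v v - 1)
  have t3 := norm_add_le (1 - inner ℂ x v) (inner ℂ (x - v) (v - y))
  rw [hsym] at t3
  have n1 := norm_nonneg (1 - inner ℂ v x)
  have n2 := norm_nonneg (1 - inner ℂ v y)
  linarith

/-- The affine chart of a negative vector. -/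
def aff (n : ℕ) (z : Fin (n + 1) → ℂ) : EuclideanSpace ℂ (Fin n) :=
  WithLp.toLp 2 (fun i => (z (Fin.last n))⁻¹ * z i.castSucc)

lemma last_ne {n : ℕ} {z : Fin (n + 1) → ℂ} (hz : Hf n z z = -1) : z (Fin.last n) ≠ 0 := by
  intro h
  have := neg_rel hz
  rw [h, norm_zero] at this
  have : 0 ≤ ∑ i : Fin n, ‖z i.castSucc‖ ^ 2 := by positivity
  nlinarith

lemma aff_norm {n : ℕ} {z : Fin (n + 1) → ℂ} (hz : Hf n z z = -1) : ‖aff n z‖ ≤ 1 := by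
  have h0 : 0 < ‖z (Fin.last n)‖ := norm_pos_iff.mpr (last_ne hz)
  have h1 := neg_rel hz
  have h2 : ‖aff n z‖ ^ 2 = (‖z (Fin.last n)‖ ^ 2)⁻¹ * ∑ i : Fin n, ‖z i.castSucc‖ ^ 2 := by
    rw [EuclideanSpace.norm_sq_eq, Finset.mul_sum]
    apply Finset.sum_congr rfl
    intro i _
    simp [aff, mul_pow]
  have h3 : ‖aff n z‖ ^ 2 ≤ 1 := by
    rw [h2, inv_mul_le_one₀ (by positivity)]
    linarith
  nlinarith [norm_nonneg (aff n z)]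

lemma Hf_aff {n : ℕ} {w z : Fin (n + 1) → ℂ} (hw : Hf n w w = -1) (hz : Hf n z z = -1) :
    ‖Hf n w z‖ = ‖w (Fin.last n)‖ * ‖z (Fin.last n)‖ * ‖1 - inner ℂ (aff n w) (aff n z)‖ := by
  have h1 := last_ne hw
  have h2 := last_ne hz
  have h3 : star (w (Fin.last n)) ≠ 0 := star_ne_zero.mpr h1
  have : Hf n w z = - (star (w (Fin.last n)) * z (Fin.last n)
      * (1 - inner ℂ (aff n w) (aff n z))) := by
    have e : inner ℂ (aff n w) (aff n z) = (star (w (Fin.last n)))⁻¹ * (z (Fin.last n))⁻¹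
        * ∑ i : Fin n, star (w i.castSucc) * z i.castSucc := by
      rw [PiLp.inner_apply, Finset.mul_sum]
      apply Finset.sum_congr rfl
      intro i _
      simp [aff]
      ring
    rw [e, Hf_eq]
    field_simp
    ring
  rw [this, norm_neg, norm_mul, norm_mul, norm_star]

/-- Coarse four point inequality. -/
lemma four_point {n : ℕ} {P : MatN n} (hP : memUn n P) {q r s : Fin (n + 1) → ℂ}
    (hq : Hf n q q = -1) (hr : Hf n r r = -1) (hs : Hf n s s = -1) :
    ‖Hf n (P *ᵥ eL n) q‖ * ‖Hf n r s‖ ≤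
      5 * (‖Hf n (P *ᵥ eL n) s‖ * ‖Hf n q r‖ + ‖Hf n (P *ᵥ eL n) r‖ * ‖Hf n q s‖) := by
  have ex : ∀ w : Fin (n + 1) → ℂ, ∃ z, w = P *ᵥ z := fun w =>
    ⟨P⁻¹ *ᵥ w, by rw [Matrix.mulVec_mulVec, memUn_mul_inv hP, Matrix.one_mulVec]⟩
  obtain ⟨q, rfl⟩ := ex q
  obtain ⟨r, rfl⟩ := ex r
  obtain ⟨s, rfl⟩ := ex s
  simp only [Hf_unitary hP] at *
  simp only [Hf_eL, norm_neg]
  rw [Hf_aff hr hs, Hf_aff hq hr, Hf_aff hq hs]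
  have := core_ineq (aff n r) (aff n s) (aff n q) (aff_norm hr) (aff_norm hs) (aff_norm hq)
  have h := mul_le_mul_of_nonneg_left this
    (show 0 ≤ ‖q (Fin.last n)‖ * ‖r (Fin.last n)‖ * ‖s (Fin.last n)‖ by positivity)
  linarith

lemma Hf_neg {n : ℕ} {P : MatN n} (hP : memUn n P) :
    Hf n (P *ᵥ eL n) (P *ᵥ eL n) = -1 := by
  rw [Hf_unitary hP, Hf_eL]; simp [eL]

lemma conj_eL {n : ℕ} {P : MatN n} (hP : memUn n P) (α : Fin n → ℝ) :
    (P * Ln n α * P⁻¹) *ᵥ (P *ᵥ eL n) = lamL n α • (P *ᵥ eL n) := by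
  rw [Matrix.mulVec_mulVec, Matrix.mul_assoc, memUn_inv_mul hP, Matrix.mul_one,
    ← Matrix.mulVec_mulVec, Ln_eL, Matrix.mulVec_smul]

lemma conj_mem {n : ℕ} {P : MatN n} (hP : memUn n P) (α : Fin n → ℝ) :
    memUn n (P * Ln n α * P⁻¹) :=
  memUn_mul (memUn_mul hP (Ln_mem n α)) (memUn_inv hP)

lemma Hf_pos {n : ℕ} {P : MatN n} (hP : memUn n P) {w : Fin (n + 1) → ℂ}
    (hw : Hf n w w = -1) : 0 < ‖Hf n (P *ᵥ eL n) w‖ := by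
  obtain ⟨z, rfl⟩ : ∃ z, w = P *ᵥ z :=
    ⟨P⁻¹ *ᵥ w, by rw [Matrix.mulVec_mulVec, memUn_mul_inv hP, Matrix.one_mulVec]⟩
  rw [Hf_unitary hP] at *
  rw [Hf_eL, norm_neg]
  exact norm_pos_iff.mpr (last_ne hw)

/-- The key estimate: fixed points of the first two elements are at bounded distance. -/
lemma key_bound {n : ℕ} {α β γ : Fin n → ℝ} {c : ℝ} (hc0 : 0 < c) (hc : c ≤ 1)
    (hα : ∀ j, c ≤ 1 - Real.cos (α j)) (hβ : ∀ j, c ≤ 1 - Real.cos (β j))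
    {P Q R : MatN n} (hP : memUn n P) (hQ : memUn n Q) (hR : memUn n R)
    {u : ℂ} (hu : ‖u‖ = 1)
    (h : (P * Ln n α * P⁻¹) * (Q * Ln n β * Q⁻¹) * (R * Ln n γ * R⁻¹) = u • (1 : MatN n)) :
    ‖(P⁻¹ * Q) (Fin.last n) (Fin.last n)‖ ≤ 10 / c := by
  have hA := conj_mem hP α
  have hB := conj_mem hQ β
  have hAp := conj_eL hP α
  have hBq := conj_eL hQ β
  have hCr := conj_eL hR γ
  have dA := fun w hw => @disp n α c hc hα P hP w hw
  have dB := fun w hw => @disp n β c hc hβ Q hQ w hw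
  have np := Hf_neg hP
  have nq := Hf_neg hQ
  have nr := Hf_neg hR
  have fp := fun q r s h1 h2 h3 => @four_point n P hP q r s h1 h2 h3
  have goal_eq : ‖(P⁻¹ * Q) (Fin.last n) (Fin.last n)‖
      = ‖Hf n (P *ᵥ eL n) (Q *ᵥ eL n)‖ := by
    have : Q *ᵥ eL n = P *ᵥ ((P⁻¹ * Q) *ᵥ eL n) := by
      rw [Matrix.mulVec_mulVec, ← Matrix.mul_assoc, memUn_mul_inv hP, Matrix.one_mul]
    rw [this, Hf_unitary hP, Hf_eL, norm_neg]
    simp [eL]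
  rw [goal_eq]
  have pp := Hf_pos hP nr
  have pq := Hf_pos hQ nr
  generalize P * Ln n α * P⁻¹ = A at *
  generalize Q * Ln n β * Q⁻¹ = B at *
  generalize R * Ln n γ * R⁻¹ = C at *
  generalize P *ᵥ eL n = p at *
  generalize Q *ᵥ eL n = q at *
  generalize R *ᵥ eL n = r at *
  have hγ0 : lamL n γ ≠ 0 := by
    rw [← norm_pos_iff, norm_lamL]; exact one_pos
  have hAs : A *ᵥ (B *ᵥ r) = (u * (lamL n γ)⁻¹) • r := by
    have h1 : (A * B * C) *ᵥ r = u • r := by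
      rw [h, Matrix.smul_mulVec, Matrix.one_mulVec]
    rw [← Matrix.mulVec_mulVec, hCr, Matrix.mulVec_smul, ← Matrix.mulVec_mulVec] at h1
    rw [mul_comm, mul_smul, ← h1, inv_smul_smul₀ hγ0]
  have hμ : ‖u * (lamL n γ)⁻¹‖ = 1 := by rw [norm_mul, norm_inv, norm_lamL, hu]; simp
  generalize u * (lamL n γ)⁻¹ = μ at *
  have ns : Hf n (B *ᵥ r) (B *ᵥ r) = -1 := by rw [Hf_unitary hB, nr]
  have e1 : ‖Hf n q (B *ᵥ r)‖ = ‖Hf n q r‖ := by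
    have := Hf_unitary hB q r
    rw [hBq, Hf_smul_left] at this
    rw [← this, norm_mul, norm_star, norm_lamL, one_mul]
  have e2 : ‖Hf n p (B *ᵥ r)‖ = ‖Hf n p r‖ := by
    have := Hf_unitary hA p (B *ᵥ r)
    rw [hAp, hAs, Hf_smul_left, Hf_smul_right] at this
    rw [← this, norm_mul, norm_mul, norm_star, norm_lamL, hμ, one_mul, one_mul]
  have i1 := dB r nr
  have i2 := dA _ ns
  rw [hAs, Hf_smul_right, norm_mul, hμ, one_mul, Hf_norm_comm n (B *ᵥ r) r, e2] at i2
  have i3 := fp q r (B *ᵥ r) nq nr ns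
  rw [e1, e2] at i3
  rw [le_div_iff₀ hc0]
  generalize ‖Hf n p r‖ = x at *
  generalize ‖Hf n q r‖ = y at *
  generalize ‖Hf n r (B *ᵥ r)‖ = t at *
  have hk := norm_nonneg (Hf n p q)
  generalize ‖Hf n p q‖ = k at *
  have ht : c * (x * y) ≤ t := by nlinarith [mul_nonneg hc0.le (sq_nonneg (x - y))]
  have hxy : 0 < x * y := mul_pos pp pq
  have h1 : k * (c * (x * y)) ≤ k * t := mul_le_mul_of_nonneg_left ht hk
  have h2 : (k * c) * (x * y) ≤ 10 * (x * y) := by nlinarith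
  exact le_of_mul_le_mul_right h2 hxy

lemma entry_bound {n : ℕ} {Q : MatN n} (hQ : memUn n Q) {K : ℝ}
    (hK : ‖Q (Fin.last n) (Fin.last n)‖ ≤ K) (i j : Fin (n + 1)) : ‖Q i j‖ ≤ K + 1 := by
  have hK0 : 0 ≤ K := (norm_nonneg _).trans hK
  have hent : ∀ j, ‖Q⁻¹ j (Fin.last n)‖ = ‖Q (Fin.last n) j‖ := by
    intro j
    rw [memUn_inv_eq hQ]
    simp only [Jn, Matrix.mul_diagonal, Matrix.diagonal_mul, Matrix.conjTranspose_apply,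
      norm_mul, norm_star]
    split_ifs <;> simp
  have hrow : ∀ j, ‖Q (Fin.last n) j‖ ≤ K := by
    intro j
    have h1 := neg_rel (Hf_neg (memUn_inv hQ))
    simp only [eL, Matrix.mulVec_single_one, Matrix.col_apply, hent] at h1
    refine le_trans ?_ hK
    induction j using Fin.lastCases with
    | last => exact le_rfl
    | cast j =>
      have h2 := Finset.single_le_sum (f := fun j : Fin n => ‖Q (Fin.last n) j.castSucc‖ ^ 2)
        (fun i _ => by positivity) (Finset.mem_univ j)
      refine (pow_le_pow_iff_left₀ (norm_nonneg _) (norm_nonneg _) two_ne_zero).mp ?_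
      linarith
  induction i using Fin.lastCases with
  | last => linarith [hrow j]
  | cast i =>
    have h1 := Hf_unitary hQ (Pi.single j 1) (Pi.single j 1)
    have h2 : (Hf n (Pi.single j 1) (Pi.single j 1)).re ≤ 1 := by
      have : star (Pi.single j 1 : Fin (n + 1) → ℂ) = Pi.single j 1 := by
        rw [← Pi.single_star, star_one]
      simp only [Hf, this, Jn, single_one_dotProduct, Matrix.mulVec_diagonal]
      split_ifs <;> simp
    rw [← h1, Hf_eq] at h2
    simp only [Matrix.mulVec_single_one, Matrix.col_apply, Complex.star_def,
      Complex.conj_mul'] at h2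
    have h3 : (∑ i : Fin n, ‖Q i.castSucc j‖ ^ 2) - ‖Q (Fin.last n) j‖ ^ 2 ≤ 1 := by
      have e : (∑ i : Fin n, (‖Q i.castSucc j‖ : ℂ) ^ 2) - (‖Q (Fin.last n) j‖ : ℂ) ^ 2
        = (((∑ i : Fin n, ‖Q i.castSucc j‖ ^ 2) - ‖Q (Fin.last n) j‖ ^ 2 : ℝ) : ℂ) := by
        push_cast; rfl
      rw [e, Complex.ofReal_re] at h2
      exact h2
    have h4 := Finset.single_le_sum (f := fun i : Fin n => ‖Q i.castSucc j‖ ^ 2)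
        (fun i _ => by positivity) (Finset.mem_univ i)
    have h5 := hrow j
    nlinarith [norm_nonneg (Q i.castSucc j), norm_nonneg (Q (Fin.last n) j)]

lemma unif_const {n : ℕ} (hn : 1 ≤ n) {αs : ℕ → Fin n → ℝ} {α : Fin n → ℝ}
    (hα : memTnInt n α) (hs : Filter.Tendsto αs Filter.atTop (nhds α)) :
    ∃ c : ℝ, 0 < c ∧ ∀ᶠ m in Filter.atTop, ∀ j, c ≤ 1 - Real.cos (αs m j) := by
  have : Nonempty (Fin n) := ⟨⟨0, hn⟩⟩
  obtain ⟨j0, hj0⟩ := Finite.exists_min (fun j => 1 - Real.cos (α j))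
  have hpos : ∀ j, 0 < 1 - Real.cos (α j) := by
    intro j
    have h1 := hα.1 j
    have h2 : Real.cos (α j) ≠ 1 := by
      intro h
      have := (Real.cos_eq_one_iff_of_lt_of_lt (by linarith) h1.2).mp h
      linarith
    have := lt_of_le_of_ne (Real.cos_le_one (α j)) h2
    linarith
  refine ⟨(1 - Real.cos (α j0)) / 2, by linarith [hpos j0], ?_⟩
  rw [Filter.eventually_all]
  intro j
  have h1 : Filter.Tendsto (fun m => 1 - Real.cos (αs m j)) Filter.atTop
      (nhds (1 - Real.cos (α j))) :=
    ((Real.continuous_cos.tendsto _).comp ((tendsto_pi_nhds.mp hs) j)).const_sub 1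
  have h2 : (1 - Real.cos (α j0)) / 2 < 1 - Real.cos (α j) := by
    have := hj0 j
    linarith [hpos j0]
  filter_upwards [h1.eventually (lt_mem_nhds h2)] with m hm using hm.le

lemma Ln_cont (n : ℕ) : Continuous (Ln n) := by
  unfold Ln
  refine Continuous.matrix_diagonal (continuous_pi fun i => ?_)
  split_ifs with h <;> fun_prop

lemma compact_bdd (n : ℕ) (K : ℝ) : IsCompact {Q : MatN n | ∀ i j, ‖Q i j‖ ≤ K} := by
  have : {Q : MatN n | ∀ i j, ‖Q i j‖ ≤ K}
      = Set.pi Set.univ fun _ => Set.pi Set.univ fun _ => Metric.closedBall (0 : ℂ) K := by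
    ext Q
    constructor
    · intro h i _ j _
      exact mem_closedBall_zero_iff.mpr (h i j)
    · intro h i j
      exact mem_closedBall_zero_iff.mp (h i trivial j trivial)
  rw [this]
  exact isCompact_univ_pi fun _ => isCompact_univ_pi fun _ => isCompact_closedBall _ _

lemma closed_Un (n : ℕ) : IsClosed {Q : MatN n | memUn n Q} := by
  unfold memUn
  exact isClosed_eq (by fun_prop) continuous_const

lemma memTn_of_int {n : ℕ} {α : Fin n → ℝ} (h : memTnInt n α) : memTn n α := by
  refine ⟨fun i => ⟨(h.1 i).1.le, (h.1 i).2⟩, fun i j hij => ?_⟩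
  rcases hij.eq_or_lt with rfl | h'
  · exact le_rfl
  · exact (h.2 i j h').le

/-- Closedness of the solution set in the interior of the space of conjugacy classes. -/
theorem closedness_in_interior (n : ℕ) (hn : 1 ≤ n) (u : ℂ) (hu : u ^ (n + 1) = 1)
    (τseq : ℕ → TriN n) (hseq : ∀ m, τseq m ∈ PsolN n u)
    (τ : TriN n) (hτ : memTnInt3 n τ)
    (hconv : Filter.Tendsto τseq Filter.atTop (nhds τ)) :
    τ ∈ PsolN n u := by
  have hu1 : ‖u‖ = 1 := Complex.norm_eq_one_of_pow_eq_one hu (Nat.succ_ne_zero n)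
  have t1 : Filter.Tendsto (fun m => (τseq m).1) Filter.atTop (nhds τ.1) :=
    (continuous_fst.tendsto _).comp hconv
  have t2 : Filter.Tendsto (fun m => (τseq m).2.1) Filter.atTop (nhds τ.2.1) :=
    ((continuous_fst.comp continuous_snd).tendsto _).comp hconv
  have t3 : Filter.Tendsto (fun m => (τseq m).2.2) Filter.atTop (nhds τ.2.2) :=
    ((continuous_snd.comp continuous_snd).tendsto _).comp hconv
  obtain ⟨c1, hc1, h1⟩ := unif_const hn hτ.1 t1
  obtain ⟨c2, hc2, h2⟩ := unif_const hn hτ.2.1 t2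
  obtain ⟨c3, hc3, h3⟩ := unif_const hn hτ.2.2 t3
  obtain ⟨c, hc0, hcle, hcc1, hcc2, hcc3⟩ : ∃ c : ℝ, 0 < c ∧ c ≤ 1 ∧ c ≤ c1 ∧ c ≤ c2 ∧ c ≤ c3 :=
    ⟨min 1 (min c1 (min c2 c3)), by positivity, by simp, by simp, by simp, by simp⟩
  have hPs : ∀ m, ∃ P Q R : MatN n, memUn n P ∧ memUn n Q ∧ memUn n R ∧
      (P * Ln n (τseq m).1 * P⁻¹) * (Q * Ln n (τseq m).2.1 * Q⁻¹)
        * (R * Ln n (τseq m).2.2 * R⁻¹) = u • (1 : MatN n) := by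
    intro m
    obtain ⟨-, A, B, C, -, -, -, ⟨P, hP, rfl⟩, ⟨Q, hQ, rfl⟩, ⟨R, hR, rfl⟩, h⟩ := hseq m
    exact ⟨P, Q, R, hP, hQ, hR, h⟩
  choose P Q R hP hQ hR hprod using hPs
  -- relative position matrices
  set S : ℕ → MatN n × MatN n := fun m => ((P m)⁻¹ * Q m, (R m)⁻¹ * P m) with hS
  have hSU : ∀ m, memUn n (S m).1 ∧ memUn n (S m).2 := fun m =>
    ⟨memUn_mul (memUn_inv (hP m)) (hQ m), memUn_mul (memUn_inv (hR m)) (hP m)⟩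
  have hSeq : ∀ m, Ln n (τseq m).1
      * ((S m).1 * Ln n (τseq m).2.1 * (Jn n * (S m).1ᴴ * Jn n))
      * ((Jn n * (S m).2ᴴ * Jn n) * Ln n (τseq m).2.2 * (S m).2) = u • (1 : MatN n) := by
    intro m
    have e1 : Jn n * (S m).1ᴴ * Jn n = (Q m)⁻¹ * P m := by
      rw [← memUn_inv_eq (hSU m).1]
      refine Matrix.inv_eq_left_inv ?_
      simp only [hS]
      rw [Matrix.mul_assoc, ← Matrix.mul_assoc (P m), memUn_mul_inv (hP m), Matrix.one_mul,
        memUn_inv_mul (hQ m)]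
    have e2 : Jn n * (S m).2ᴴ * Jn n = (P m)⁻¹ * R m := by
      rw [← memUn_inv_eq (hSU m).2]
      refine Matrix.inv_eq_left_inv ?_
      simp only [hS]
      rw [Matrix.mul_assoc, ← Matrix.mul_assoc (R m), memUn_mul_inv (hR m), Matrix.one_mul,
        memUn_inv_mul (hP m)]
    have e3 : (P m)⁻¹ * ((P m * Ln n (τseq m).1 * (P m)⁻¹)
        * (Q m * Ln n (τseq m).2.1 * (Q m)⁻¹)
        * (R m * Ln n (τseq m).2.2 * (R m)⁻¹)) * P m = u • (1 : MatN n) := by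
      rw [hprod m, Matrix.mul_smul, Matrix.smul_mul, Matrix.mul_one, memUn_inv_mul (hP m)]
    rw [e1, e2, ← e3]
    have k1 : ∀ X : MatN n, (P m)⁻¹ * (P m * X) = X := fun X => by
      rw [← Matrix.mul_assoc, memUn_inv_mul (hP m), Matrix.one_mul]
    have k2 : ∀ X : MatN n, P m * ((P m)⁻¹ * X) = X := fun X => by
      rw [← Matrix.mul_assoc, memUn_mul_inv (hP m), Matrix.one_mul]
    simp only [hS, Matrix.mul_assoc, k1, k2]
  have hbd : ∀ᶠ m in Filter.atTop, S m ∈ {X : MatN n | ∀ i j, ‖X i j‖ ≤ 10 / c + 1} ×ˢ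
      {X : MatN n | ∀ i j, ‖X i j‖ ≤ 10 / c + 1} := by
    filter_upwards [h1, h2, h3] with m a1 a2 a3
    have b1 := key_bound hc0 hcle (fun j => hcc1.trans (a1 j)) (fun j => hcc2.trans (a2 j))
      (hP m) (hQ m) (hR m) hu1 (hprod m)
    have hprod' : (R m * Ln n (τseq m).2.2 * (R m)⁻¹) * (P m * Ln n (τseq m).1 * (P m)⁻¹)
        * (Q m * Ln n (τseq m).2.1 * (Q m)⁻¹) = u • (1 : MatN n) := by
      have hC := conj_mem (hR m) (τseq m).2.2
      have := hprod m
      generalize R m * Ln n (τseq m).2.2 * (R m)⁻¹ = C at *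
      calc _ = C * ((P m * Ln n (τseq m).1 * (P m)⁻¹)
        * (Q m * Ln n (τseq m).2.1 * (Q m)⁻¹) * C) * C⁻¹ := by
            simp only [Matrix.mul_assoc, memUn_mul_inv hC, Matrix.mul_one]
        _ = u • 1 := by
            rw [this, Matrix.mul_smul, Matrix.smul_mul, Matrix.mul_one, memUn_mul_inv hC]
    have b2 := key_bound hc0 hcle (fun j => hcc3.trans (a3 j)) (fun j => hcc1.trans (a1 j))
      (hR m) (hP m) (hQ m) hu1 hprod'
    exact ⟨fun i j => entry_bound (hSU m).1 b1 i j, fun i j => entry_bound (hSU m).2 b2 i j⟩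
  have : FirstCountableTopology (MatN n) :=
    inferInstanceAs (FirstCountableTopology (Fin (n + 1) → Fin (n + 1) → ℂ))
  obtain ⟨X, -, φ, hφ, hlim⟩ :=
    ((compact_bdd n (10 / c + 1)).prod (compact_bdd n (10 / c + 1))).tendsto_subseq'
      hbd.frequently
  have l1 : Filter.Tendsto (fun m => (S (φ m)).1) Filter.atTop (nhds X.1) :=
    (continuous_fst.tendsto _).comp hlim
  have l2 : Filter.Tendsto (fun m => (S (φ m)).2) Filter.atTop (nhds X.2) :=
    (continuous_snd.tendsto _).comp hlim
  have hX1 : memUn n X.1 := (closed_Un n).mem_of_tendsto l1 (.of_forall fun m => (hSU (φ m)).1)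
  have hX2 : memUn n X.2 := (closed_Un n).mem_of_tendsto l2 (.of_forall fun m => (hSU (φ m)).2)
  have hcont : Continuous (fun y : TriN n × (MatN n × MatN n) => Ln n y.1.1
      * (y.2.1 * Ln n y.1.2.1 * (Jn n * y.2.1ᴴ * Jn n))
      * ((Jn n * y.2.2ᴴ * Jn n) * Ln n y.1.2.2 * y.2.2)) := by
    have := Ln_cont n
    fun_prop
  have hfin := (hcont.tendsto (τ, X)).comp
    ((hconv.comp hφ.tendsto_atTop).prodMk_nhds hlim)
  have hfin2 := tendsto_nhds_unique hfin
    (tendsto_const_nhds.congr fun m => (hSeq (φ m)).symm)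
  simp only at hfin2
  rw [← memUn_inv_eq hX1, ← memUn_inv_eq hX2] at hfin2
  have hX2' := memUn_inv hX2
  have hii : (X.2⁻¹)⁻¹ = X.2 := Matrix.inv_eq_left_inv (memUn_mul_inv hX2)
  refine ⟨⟨memTn_of_int hτ.1, memTn_of_int hτ.2.1, memTn_of_int hτ.2.2⟩,
    Ln n τ.1, X.1 * Ln n τ.2.1 * X.1⁻¹, X.2⁻¹ * Ln n τ.2.2 * (X.2⁻¹)⁻¹,
    Ln_mem n _, conj_mem hX1 _, conj_mem hX2' _,
    ⟨1, memUn_one n, by simp⟩, ⟨X.1, hX1, rfl⟩, ⟨X.2⁻¹, hX2', rfl⟩, ?_⟩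
  rw [hii]
  exact hfin2
end
end
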